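/- arXiv:1301.3595 — 3 statements merged into one kernel-verified Lean document; each statement's English description precedes it below -/
import Mathlib

section
/- Let x_0 ∈ [0,1] and let (ℓ_n)_{n≥1} be a sequence of positive integers with ℓ_n → ∞ as n → ∞. Set α = liminf_{n→∞} ℓ_n/n (a value in [0,∞]). Then the Hausdorff dimension of the set E({ℓ_n}, x_0) = {β > 1 : |T_β^n 1 − x_0| < β^{−ℓ_n} for infinitely many n ∈ ℕ} equals 1/(1+α), interpreted as 0 when α = ∞. -/
open Filter MeasureTheory Set
open scoped ENNReal

/-- The β-transformation `T_β x = βx - ⌊βx⌋`. -/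
noncomputable def betaT (β : ℝ) : ℝ → ℝ := fun x => β * x - (⌊β * x⌋ : ℝ)

/-- The digits of the β-expansion of 1: `epsDig β i = ε_{i+1}(1,β) = ⌊β · T_β^i 1⌋`. -/
noncomputable def epsDig (β : ℝ) (i : ℕ) : ℕ := (⌊β * (betaT β)^[i] 1⌋).toNat

/-- Strict lexicographic order on words of length `m` (identified with their
extensions by zeros). -/
def wordLexLt (m : ℕ) (a b : ℕ → ℕ) : Prop :=
  ∃ k < m, (∀ j < k, a j = b j) ∧ a k < b k

/-- Non-strict lexicographic order on words of length `m`. -/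
def wordLexLe (m : ℕ) (a b : ℕ → ℕ) : Prop :=
  wordLexLt m a b ∨ ∀ j < m, a j = b j

/-- A word `w = (w 0, …, w (n-1))` is self-admissible if `σ^i w ⪯ (w 0, …, w (n-1-i))`
for all `0 ≤ i < n`. -/
def SelfAdmissible (n : ℕ) (w : ℕ → ℕ) : Prop :=
  ∀ i < n, wordLexLe (n - i) (fun j => w (i + j)) w

/-- The recurrence time `τ(w)` of a word of length `n`: the least `1 ≤ k < n` with
`σ^k w = (w 0, …, w (n-1-k))`, and `n` if no such `k` exists. -/
noncomputable def recTime (n : ℕ) (w : ℕ → ℕ) : ℕ :=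
  sInf ({k | 1 ≤ k ∧ k < n ∧ ∀ j < n - k, w (k + j) = w j} ∪ {n})

/-- The cylinder of order `n` in the parameter space: the set of `β > 1` whose
β-expansion of 1 starts with the word `w`. -/
def cylP (n : ℕ) (w : ℕ → ℕ) : Set ℝ := {β | 1 < β ∧ ∀ i < n, epsDig β i = w i}

open Classical in
/-- The infinite β-expansion of 1: if the expansion of 1 is finite with last
nonzero digit at (0-indexed) position `m`, it is `(ε_1, …, ε_m, ε_{m+1} - 1)^∞`;
otherwise it is the expansion of 1 itself. -/
noncomputable def epsStar (β : ℝ) : ℕ → ℕ :=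
  if h : ∃ m, epsDig β m ≠ 0 ∧ ∀ i, m < i → epsDig β i = 0 then
    fun i => if i % (h.choose + 1) = h.choose then epsDig β h.choose - 1
             else epsDig β (i % (h.choose + 1))
  else epsDig β

/-- `runLenStar β n` is the number of consecutive zeros in `ε*(1,β)` just after
(1-indexed) index `n`, i.e. the largest `k` with `ε*_{n+1} = … = ε*_{n+k} = 0`. -/
noncomputable def runLenStar (β : ℝ) (n : ℕ) : ℕ :=
  sSup {k | ∀ j < k, epsStar β (n + j) = 0}

/-- `runLen β n` is the number of consecutive zeros in `ε(1,β)` just after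
(1-indexed) index `n`. -/
noncomputable def runLen (β : ℝ) (n : ℕ) : ℕ :=
  sSup {k | ∀ j < k, epsDig β (n + j) = 0}

/-- Strict lexicographic order on infinite sequences. -/
def seqLexLt (a b : ℕ → ℕ) : Prop := ∃ k, (∀ j < k, a j = b j) ∧ a k < b k

/-- Non-strict lexicographic order on infinite sequences. -/
def seqLexLe (a b : ℕ → ℕ) : Prop := seqLexLt a b ∨ a = b

/-- The β-shift `S_β` (via Parry's criterion): all sequences whose every shift is
lexicographically at most `ε*(1,β)`. -/
def Sbeta (β : ℝ) : Set (ℕ → ℕ) := {w | ∀ i, seqLexLe (fun j => w (i + j)) (epsStar β)}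


/-- The orbit of `1`. -/
noncomputable def orb (β : ℝ) (n : ℕ) : ℝ := (betaT β)^[n] 1

/-- Integer digits of the expansion of `1`. -/
noncomputable def dgt (β : ℝ) (n : ℕ) : ℤ := ⌊β * orb β n⌋

lemma orb_zero (β : ℝ) : orb β 0 = 1 := rfl

lemma orb_succ (β : ℝ) (n : ℕ) : orb β (n+1) = β * orb β n - dgt β n := by
  simp only [orb, dgt, Function.iterate_succ_apply']
  rfl

lemma orb_nonneg (β : ℝ) (n : ℕ) : 0 ≤ orb β n := by
  cases n with
  | zero => simp [orb_zero]
  | succ n => rw [orb_succ]; have := Int.floor_le (β * orb β n); unfold dgt; linarith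

lemma orb_le_one (β : ℝ) (n : ℕ) : orb β n ≤ 1 := by
  cases n with
  | zero => simp [orb_zero]
  | succ n => rw [orb_succ]; have := Int.lt_floor_add_one (β * orb β n); unfold dgt; linarith

lemma dgt_nonneg {β : ℝ} (hβ : 0 ≤ β) (n : ℕ) : 0 ≤ dgt β n :=
  Int.floor_nonneg.2 (mul_nonneg hβ (orb_nonneg β n))

/-- Expansion in parameter space. -/
lemma orb_expand {a β β' : ℝ} (ha : 1 < a) (h1 : a ≤ β) (h2 : β ≤ β') (n : ℕ)
    (hd : ∀ i < n + 1, dgt β i = dgt β' i) :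
    a ^ n * (β' - β) ≤ orb β' (n+1) - orb β (n+1) := by
  induction n with
  | zero =>
    rw [orb_succ, orb_succ, hd 0 (by simp), orb_zero, orb_zero]; simp
  | succ n ih =>
    have ih := ih (fun i hi => hd i (by omega))
    rw [orb_succ β' (n+1), orb_succ β (n+1), hd (n+1) (by omega)]
    have h0 := orb_nonneg β (n+1)
    have hd0 : 0 ≤ orb β' (n+1) - orb β (n+1) :=
      le_trans (mul_nonneg (by positivity) (by linarith)) ih
    have : a ^ (n+1) * (β' - β) ≤ a * (orb β' (n+1) - orb β (n+1)) := by
      rw [pow_succ']; nlinarith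
    nlinarith

/-- Value of the block of digits `k, …, k+m-1` in base `b`, scaled by `b^m`. -/
noncomputable def blk (b β : ℝ) (k : ℕ) : ℕ → ℝ
  | 0 => 0
  | m+1 => b * blk b β k m + dgt β (k+m)

lemma blk_succ' (b β : ℝ) (m : ℕ) : ∀ k, blk b β k (m+1) = dgt β k * b ^ m + blk b β (k+1) m := by
  induction m with
  | zero => intro k; simp [blk]
  | succ m ih =>
    intro k
    rw [blk, ih, blk, show k + 1 + m = k + (m+1) by ring]; ring

lemma blk_nonneg {b β : ℝ} (hb : 0 ≤ b) (hβ : 0 ≤ β) (k m : ℕ) : 0 ≤ blk b β k m := by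
  induction m with
  | zero => simp [blk]
  | succ m ih =>
    have : (0:ℝ) ≤ dgt β (k+m) := by exact_mod_cast dgt_nonneg hβ _
    rw [blk]; positivity

lemma blk_le {b β : ℝ} (hβ : 0 ≤ β) (hb : β ≤ b) (m : ℕ) :
    ∀ k, blk b β k m ≤ b ^ m * orb β k := by
  induction m with
  | zero => intro k; simp [blk, orb_nonneg]
  | succ m ih =>
    intro k
    rw [blk_succ']
    have h := ih (k+1)
    rw [orb_succ] at h
    have hb0 : 0 ≤ b := hβ.trans hb
    have : b ^ m * (β * orb β k) ≤ b ^ m * (b * orb β k) := by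
      gcongr; exact orb_nonneg _ _
    rw [pow_succ]; nlinarith

lemma blk_congr {b β β' : ℝ} {k m : ℕ} (h : ∀ i < k + m, dgt β i = dgt β' i) :
    blk b β k m = blk b β' k m := by
  induction m with
  | zero => rfl
  | succ m ih => rw [blk, blk, ih (fun i hi => h i (by omega)), h (k+m) (by omega)]

/-- The first `n` digits form a full word in base `b`. -/
def FullW (b β : ℝ) (n : ℕ) : Prop := ∀ k m, k + m = n → blk b β k m + 1 ≤ b ^ m

lemma blk_sep {b β β' : ℝ} (hb : 0 ≤ b) (hβ' : 0 ≤ β') {n k : ℕ} (hk : k < n)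
    (heq : ∀ i < k, dgt β i = dgt β' i) (hlt : dgt β k < dgt β' k) (hf : FullW b β n) :
    blk b β 0 n + 1 ≤ blk b β' 0 n := by
  -- compare blocks starting at position `j ≤ k`
  have key : ∀ d, ∀ j m, j + d = k → j + m = n → blk b β j m + 1 ≤ blk b β' j m := by
    intro d
    induction d with
    | zero =>
      intro j m hj hm
      obtain ⟨m, rfl⟩ : ∃ m', m = m' + 1 := ⟨m - 1, by omega⟩
      rw [blk_succ', blk_succ']
      have h1 := hf (j+1) m (by omega)
      have h2 := blk_nonneg hb hβ' (j+1) m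
      have h3 : (dgt β j : ℝ) + 1 ≤ dgt β' j := by
        have : j = k := by omega
        rw [this]; exact_mod_cast hlt
      have h4 : 0 ≤ b ^ m := by positivity
      nlinarith
    | succ d ih =>
      intro j m hj hm
      obtain ⟨m, rfl⟩ : ∃ m', m = m' + 1 := ⟨m - 1, by omega⟩
      rw [blk_succ', blk_succ', heq j (by omega)]
      have := ih (j+1) m (by omega) (by omega)
      linarith
  exact key k 0 n (by omega) (by omega)

lemma digits_code {a b : ℝ} (ha : 1 < a) (hab : a ≤ b) (n : ℕ) :
    ∃ K : ℕ, (K : ℝ) ≤ (n + 1) * (2 * b ^ n) ∧ ∃ code : ℝ → Fin K,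
      ∀ β ∈ Icc a b, ∀ β' ∈ Icc a b, code β = code β' → ∀ i < n, dgt β i = dgt β' i := by
  classical
  have hb1 : 1 ≤ b := by linarith
  have hb0 : 0 ≤ b := by linarith
  induction n with
  | zero => exact ⟨1, by norm_num, fun _ => 0, by simp⟩
  | succ n ih =>
    obtain ⟨K, hK, code, hcode⟩ := ih
    set L := ⌊b^(n+1)⌋₊ + 1 with hL
    have hfl : ∀ β ∈ Icc a b, ⌊blk b β 0 (n+1)⌋₊ < L := by
      intro β hβ
      rw [hL, Nat.lt_succ_iff]
      apply Nat.floor_le_floor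
      have := blk_le (b := b) (β := β) (by linarith [hβ.1]) hβ.2 (n+1) 0
      simpa [orb_zero] using this
    refine ⟨K + L, ?_, fun β => if FullW b β (n+1) then
      Fin.natAdd K ⟨⌊blk b β 0 (n+1)⌋₊ % L, Nat.mod_lt _ (by omega)⟩
      else Fin.castAdd L (code β), ?_⟩
    · have h1 : (L:ℝ) ≤ 2 * b^(n+1) := by
        have := Nat.floor_le (a := b^(n+1)) (by positivity)
        have h2 : 1 ≤ b^(n+1) := one_le_pow₀ hb1
        rw [hL]; push_cast; linarith
      have h3 : b^n ≤ b^(n+1) := pow_le_pow_right₀ hb1 (by omega)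
      push_cast
      nlinarith
    · intro β hβ β' hβ' hc
      have pos : 0 ≤ β := by linarith [hβ.1]
      have pos' : 0 ≤ β' := by linarith [hβ'.1]
      by_cases hf : FullW b β (n+1) <;> by_cases hf' : FullW b β' (n+1)
      · simp only [hf, hf', if_true, Fin.natAdd_inj, Fin.mk.injEq] at hc
        rw [Nat.mod_eq_of_lt (hfl β hβ), Nat.mod_eq_of_lt (hfl β' hβ')] at hc
        by_contra hcon
        push Not at hcon
        have hex : ∃ i, i < n+1 ∧ dgt β i ≠ dgt β' i := hcon
        have hs := Nat.find_spec hex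
        have hm : ∀ i < Nat.find hex, dgt β i = dgt β' i := by
          intro i hi
          have := Nat.find_min hex hi
          by_contra h
          exact this ⟨by omega, h⟩
        have haux : ∀ x y : ℝ, 0 ≤ x → x + 1 ≤ y → ⌊x⌋₊ ≠ ⌊y⌋₊ := by
          intro x y hx hxy h
          have h1 := Nat.floor_le hx
          have h2 := Nat.lt_floor_add_one y
          have h3 : ⌊x⌋₊ + 1 ≤ ⌊y⌋₊ := Nat.le_floor (by push_cast; linarith)
          omega
        rcases lt_or_gt_of_ne hs.2 with h | h
        · exact haux _ _ (blk_nonneg hb0 pos _ _) (blk_sep hb0 pos' hs.1 hm h hf) hc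
        · exact haux _ _ (blk_nonneg hb0 pos' _ _)
            (blk_sep hb0 pos hs.1 (fun i hi => (hm i hi).symm) h hf') hc.symm
      · simp only [hf, hf', if_true, if_false] at hc
        have := congrArg Fin.val hc
        simp at this; have := (code β').2; omega
      · simp only [hf, hf', if_true, if_false] at hc
        have := congrArg Fin.val hc
        simp at this; have := (code β).2; omega
      · simp only [hf, hf', if_false, Fin.castAdd_inj] at hc
        have hd := hcode β hβ β' hβ' hc
        have aux : ∀ β ∈ Icc a b, ∀ β' ∈ Icc a b, (∀ i < n, dgt β i = dgt β' i) →
            dgt β n < dgt β' n → FullW b β (n+1) := by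
          intro β hβ β' hβ' hd hlt k m hkm
          have pos' : 0 ≤ β' := by linarith [hβ'.1]
          cases m with
          | zero => simp [blk]
          | succ m =>
            have h1 := blk_le pos' hβ'.2 (m+1) k
            have h2 : b^(m+1) * orb β' k ≤ b^(m+1) :=
              mul_le_of_le_one_right (by positivity) (orb_le_one _ _)
            have h3 : (dgt β n : ℝ) + 1 ≤ dgt β' n := by exact_mod_cast hlt
            rw [blk] at h1 ⊢
            rw [blk_congr (fun i hi => hd i (by omega)), show k + m = n by omega]
            rw [show k + m = n by omega] at h1
            linarith
        intro i hi
        rcases Nat.lt_succ_iff_lt_or_eq.1 hi with h | rfl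
        · exact hd i h
        · rcases lt_trichotomy (dgt β i) (dgt β' i) with h | h | h
          · exact absurd (aux β hβ β' hβ' hd h) hf
          · exact h
          · exact absurd (aux β' hβ' β hβ (fun i hi => (hd i hi).symm) h) hf'


lemma upper_local (x₀ : ℝ) (ℓ : ℕ → ℕ) {a b s κ : ℝ} (ha : 1 < a) (hab : a ≤ b) (hκ : 0 ≤ κ)
    (hs : 0 < s) (hq : b < a ^ ((1 + κ) * s)) (hev : ∀ᶠ n : ℕ in atTop, κ * n ≤ ℓ n) :
    μH[s] ({β : ℝ | ∃ᶠ n in atTop, |orb β n - x₀| < β ^ (-(ℓ n : ℤ))} ∩ Icc a b) = 0 := by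
  have ha0 : 0 < a := by linarith
  have hb0 : 0 < b := by linarith
  choose K hK code hcode using fun n => digits_code ha hab n
  set q : ℝ := a ^ (-(1 + κ)) with hqdef
  have hq0 : 0 < q := Real.rpow_pos_of_pos ha0 _
  have hq1 : q < 1 := Real.rpow_lt_one_of_one_lt_of_neg ha (by linarith)
  have hqs : b * q ^ s < 1 := by
    rw [hqdef, ← Real.rpow_mul ha0.le, neg_mul, Real.rpow_neg ha0.le, ← div_eq_mul_inv,
      div_lt_one (Real.rpow_pos_of_pos ha0 _)]
    exact hq
  set D : ℕ → ℝ := fun n => 2 * a * q ^ n with hD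
  have hDpos : ∀ n, 0 < D n := fun n => by simp only [hD]; positivity
  let t : ∀ N : ℕ, (Σ m : ℕ, Fin (K (m + N))) → Set ℝ := fun N i =>
    {β | β ∈ Icc a b ∧ code (i.1 + N) β = i.2 ∧ |orb β (i.1 + N) - x₀| < a ^ (-(ℓ (i.1 + N) : ℤ))}
  obtain ⟨N0, hN0⟩ := eventually_atTop.1 hev
  -- diameters
  have hdiam : ∀ N, max N0 1 ≤ N → ∀ i, Metric.ediam (t N i) ≤ ENNReal.ofReal (D (i.1 + N)) := by
    intro N hN i
    have hNa : N0 ≤ N := le_trans (le_max_left _ _) hN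
    have hNb : 1 ≤ N := le_trans (le_max_right _ _) hN
    set n := i.1 + N with hn
    have hnpos : 1 ≤ n := by omega
    have hpow : a ^ (-(ℓ n : ℤ)) * (a * (a ^ n)⁻¹) ≤ a * q ^ n := by
      have h1 : a ^ (-(ℓ n : ℤ)) * (a ^ n)⁻¹ ≤ q ^ n := by
        rw [hqdef, ← Real.rpow_natCast (a ^ (-(1+κ))) n, ← Real.rpow_mul ha0.le,
          ← Real.rpow_natCast a n, ← Real.rpow_neg ha0.le, ← Real.rpow_intCast,
          ← Real.rpow_add ha0]
        apply Real.rpow_le_rpow_of_exponent_le ha.le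
        have := hN0 n (by omega)
        push_cast
        linarith
      nlinarith
    have main : ∀ β ∈ t N i, ∀ β' ∈ t N i, β ≤ β' → β' - β ≤ D n := by
      intro β hβ β' hβ' hle
      obtain ⟨n', hn'⟩ : ∃ n', n = n' + 1 := ⟨n - 1, by omega⟩
      have hdig := hcode n β hβ.1 β' hβ'.1 (hβ.2.1.trans hβ'.2.1.symm)
      have hexp := orb_expand ha hβ.1.1 hle n' (fun i hi => hdig i (by omega))
      rw [← hn'] at hexp
      have h1 := abs_lt.1 hβ.2.2
      have h2 := abs_lt.1 hβ'.2.2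
      rw [← hn] at h1 h2
      have h3 : a ^ n' * (β' - β) ≤ 2 * a ^ (-(ℓ n : ℤ)) := by linarith [h1.1, h2.2]
      have h4 : a * (a ^ n)⁻¹ = (a ^ n')⁻¹ := by
        rw [hn', pow_succ]; field_simp
      rw [h4] at hpow
      have h5 : β' - β ≤ 2 * a ^ (-(ℓ n : ℤ)) * (a ^ n')⁻¹ := by
        rw [← div_eq_mul_inv, le_div_iff₀ (by positivity)]; linarith
      simp only [hD]; linarith
    apply Metric.ediam_le
    intro β hβ β' hβ'
    rw [edist_dist]
    apply ENNReal.ofReal_le_ofReal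
    rw [Real.dist_eq, abs_le]
    rcases le_total β β' with h | h
    · have := main β hβ β' hβ' h
      constructor <;> linarith [hDpos n]
    · have := main β' hβ' β hβ h
      constructor <;> linarith [hDpos n]
  set f : ℕ → ℝ≥0∞ := fun n => (K n : ℝ≥0∞) * ENNReal.ofReal (D n) ^ s with hf
  have hfsum : ∑' n, f n ≠ ∞ := by
    have hle : ∀ n, f n ≤ ENNReal.ofReal
        ((2 * (2 * a) ^ s) * ((n:ℝ) ^ 1 * (b * q ^ s) ^ n) + (2 * (2 * a) ^ s) * (b * q ^ s) ^ n) := by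
      intro n
      simp only [hf]
      rw [ENNReal.ofReal_rpow_of_pos (hDpos n), ← ENNReal.ofReal_natCast,
        ← ENNReal.ofReal_mul (by positivity)]
      apply ENNReal.ofReal_le_ofReal
      have e : D n ^ s = (2 * a) ^ s * (q ^ s) ^ n := by
        simp only [hD]
        rw [Real.mul_rpow (by positivity) (by positivity), ← Real.rpow_natCast q n,
          ← Real.rpow_natCast (q ^ s) n, ← Real.rpow_mul hq0.le, ← Real.rpow_mul hq0.le, mul_comm s]
      calc (K n : ℝ) * D n ^ s ≤ ((n + 1) * (2 * b ^ n)) * D n ^ s := by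
            gcongr; exact hK n
        _ = _ := by rw [e, mul_pow]; ring
    refine ne_top_of_le_ne_top ?_ (ENNReal.tsum_le_tsum hle)
    have hr0 : 0 ≤ b * q ^ s := by positivity
    apply Summable.tsum_ofReal_ne_top
    apply Summable.add
    · apply Summable.mul_left
      apply summable_pow_mul_geometric_of_norm_lt_one
      rw [Real.norm_eq_abs, abs_of_nonneg hr0]; exact hqs
    · apply Summable.mul_left
      exact summable_geometric_of_lt_one hr0 hqs
  have hbound := Measure.hausdorffMeasure_le_liminf_tsum (ι := fun N => (Σ m : ℕ, Fin (K (m + N)))) s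
    ({β : ℝ | ∃ᶠ n in atTop, |orb β n - x₀| < β ^ (-(ℓ n : ℤ))} ∩ Icc a b)
    (l := atTop) (fun N => ENNReal.ofReal (D N)) ?_ t ?_ ?_
  · rw [← nonpos_iff_eq_zero]
    refine hbound.trans ?_
    have hlim : Tendsto (fun N => ∑' m, f (m + N)) atTop (nhds 0) :=
      ENNReal.tendsto_sum_nat_add f hfsum
    rw [← hlim.liminf_eq]
    refine liminf_le_liminf ?_
    filter_upwards [eventually_ge_atTop (max N0 1)] with N hN
    rw [ENNReal.tsum_sigma']
    apply ENNReal.tsum_le_tsum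
    intro m
    rw [tsum_fintype]
    calc ∑ j : Fin (K (m + N)), Metric.ediam (t N ⟨m, j⟩) ^ s
        ≤ ∑ j : Fin (K (m + N)), ENNReal.ofReal (D (m + N)) ^ s := by
          apply Finset.sum_le_sum
          intro j _
          exact ENNReal.rpow_le_rpow (hdiam N hN ⟨m, j⟩) hs.le
      _ = f (m + N) := by simp [hf]
  · rw [← ENNReal.ofReal_zero]
    apply ENNReal.tendsto_ofReal
    have := (tendsto_pow_atTop_nhds_zero_of_lt_one hq0.le hq1).const_mul (2 * a)
    simpa [hD] using this
  · filter_upwards [eventually_ge_atTop (max N0 1)] with N hN i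
    refine (hdiam N hN i).trans (ENNReal.ofReal_le_ofReal ?_)
    simp only [hD]
    gcongr 2 * a * ?_
    exact pow_le_pow_of_le_one hq0.le hq1.le (by omega)
  · refine Eventually.of_forall fun N => ?_
    rintro β ⟨hβ, hI⟩
    obtain ⟨n, hn, hlt⟩ := (frequently_atTop.1 hβ) N
    obtain ⟨m, rfl⟩ : ∃ m, n = m + N := ⟨n - N, by omega⟩
    refine mem_iUnion.2 ⟨⟨m, code _ β⟩, hI, rfl, hlt.trans_le ?_⟩
    rw [zpow_neg, zpow_neg, zpow_natCast, zpow_natCast]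
    have h1 : a ^ ℓ (m + N) ≤ β ^ ℓ (m + N) := pow_le_pow_left₀ ha0.le hI.1 _
    exact inv_anti₀ (by positivity) h1

lemma upper_bound (x₀ : ℝ) (ℓ : ℕ → ℕ) {s : NNReal} {κ : ℝ} (hκ : 0 ≤ κ)
    (hs : 0 < s) (hq : 1 < (1 + κ) * s) (hev : ∀ᶠ n : ℕ in atTop, κ * n ≤ ℓ n) :
    dimH {β : ℝ | 1 < β ∧ ∃ᶠ n in atTop, |orb β n - x₀| < β ^ (-(ℓ n : ℤ))} ≤ s := by
  set E := {β : ℝ | ∃ᶠ n in atTop, |orb β n - x₀| < β ^ (-(ℓ n : ℤ))} with hE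
  let S : Set (ℚ × ℚ) := {p | (1:ℝ) < p.1 ∧ (p.1 : ℝ) ≤ p.2 ∧ (p.2:ℝ) < (p.1:ℝ) ^ ((1+κ) * s)}
  have hsub : {β : ℝ | 1 < β ∧ ∃ᶠ n in atTop, |orb β n - x₀| < β ^ (-(ℓ n : ℤ))} ⊆
      ⋃ p : S, (E ∩ Icc (p.1.1 : ℝ) (p.1.2 : ℝ)) := by
    rintro β ⟨h1, hβ⟩
    have hcont : ContinuousAt (fun x : ℝ => x ^ ((1+κ) * (s:ℝ))) β :=
      Real.continuousAt_rpow_const _ _ (Or.inl (by linarith))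
    have hlt : β < β ^ ((1+κ) * (s:ℝ)) := by
      conv_lhs => rw [← Real.rpow_one β]
      exact Real.rpow_lt_rpow_of_exponent_lt h1 hq
    obtain ⟨m, hm1, hm2⟩ := exists_between hlt
    have hev2 := hcont.eventually (lt_mem_nhds hm2)
    obtain ⟨ε, hε, hball⟩ := Metric.eventually_nhds_iff.1 hev2
    obtain ⟨p, hp1, hp2⟩ := exists_rat_btwn (show max 1 (β - ε) < β by
      apply max_lt <;> linarith)
    obtain ⟨r, hr1, hr2⟩ := exists_rat_btwn hm1
    refine mem_iUnion.2 ⟨⟨(p, r), ?_, ?_, ?_⟩, hβ, hp2.le, hr1.le⟩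
    · exact (le_max_left _ _).trans_lt hp1
    · exact (hp2.trans hr1).le
    · refine hr2.trans (hball ?_)
      rw [Real.dist_eq, abs_lt]
      have := (le_max_right _ _).trans_lt hp1
      constructor <;> linarith
  refine (dimH_mono hsub).trans ?_
  rw [dimH_iUnion]
  refine iSup_le fun p => ?_
  apply dimH_le_of_hausdorffMeasure_ne_top
  rw [hE, upper_local x₀ ℓ p.2.1 p.2.2.1 hκ (by exact_mod_cast hs) p.2.2.2 hev]
  simp


/-- On `[p,q) ⊆ [M,M+1]` the map `β ↦ T_β^n 1` is given by the increasing function `g`. -/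
structure IsPiece (M n : ℕ) (p q : ℝ) (g : ℝ → ℝ) : Prop where
  hM : (M:ℝ) ≤ p
  hpq : p < q
  hM' : q ≤ M + 1
  cont : Continuous g
  mono : StrictMonoOn g (Icc p q)
  g0 : 0 ≤ g p
  g1 : g q ≤ 1
  heq : ∀ β ∈ Ico p q, orb β n = g β
  lip : ∀ x y, p ≤ x → x ≤ y → y ≤ q → g y - g x ≤ (((M:ℝ) + 1) ^ n - 1) * (y - x)

/-- A full branch of `β ↦ T_β^n 1`. -/
def IsBr (M n : ℕ) (u v : ℝ) : Prop := ∃ g, IsPiece M n u v g ∧ g u = 0 ∧ g v = 1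

lemma IsPiece.sub {M n : ℕ} {p q p' q' : ℝ} {g : ℝ → ℝ} (h : IsPiece M n p q g)
    (hp : p ≤ p') (hq : q' ≤ q) (hlt : p' < q') : IsPiece M n p' q' g where
  hM := h.hM.trans hp
  hpq := hlt
  hM' := hq.trans h.hM'
  cont := h.cont
  mono := h.mono.mono (Icc_subset_Icc hp hq)
  g0 := h.g0.trans (h.mono.monotoneOn ⟨le_rfl, h.hpq.le⟩ ⟨hp, by linarith⟩ hp)
  g1 := (h.mono.monotoneOn ⟨by linarith, hq⟩ ⟨h.hpq.le, le_rfl⟩ hq).trans h.g1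
  heq := fun β hβ => h.heq β ⟨hp.trans hβ.1, hβ.2.trans_le hq⟩
  lip := fun x y hx hxy hy => h.lip x y (hp.trans hx) hxy (hy.trans hq)

lemma IsPiece.nonneg {M n : ℕ} {p q : ℝ} {g : ℝ → ℝ} (h : IsPiece M n p q g) {x : ℝ}
    (hx : x ∈ Icc p q) : 0 ≤ g x :=
  h.g0.trans (h.mono.monotoneOn ⟨le_rfl, h.hpq.le⟩ hx hx.1)

lemma IsPiece.le_one {M n : ℕ} {p q : ℝ} {g : ℝ → ℝ} (h : IsPiece M n p q g) {x : ℝ}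
    (hx : x ∈ Icc p q) : g x ≤ 1 :=
  (h.mono.monotoneOn hx ⟨h.hpq.le, le_rfl⟩ hx.2).trans h.g1

lemma IsPiece.mul_mono {M n : ℕ} {p q : ℝ} {g : ℝ → ℝ} (hM : 0 < M) (h : IsPiece M n p q g) :
    StrictMonoOn (fun β => β * g β) (Icc p q) := by
  intro x hx y hy hxy
  have h1 := h.mono hx hy hxy
  have h2 := h.nonneg hx
  have h3 : (0:ℝ) < M := by exact_mod_cast hM
  have h4 := h.hM
  have h5 : 0 < y := by linarith [hy.1]
  show x * g x < y * g y
  nlinarith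

lemma IsPiece.next {M n : ℕ} {p q : ℝ} {g : ℝ → ℝ} (hM : 0 < M) (h : IsPiece M n p q g)
    (d : ℤ) (h0 : (d:ℝ) ≤ p * g p) (h1 : q * g q ≤ d + 1) :
    IsPiece M (n+1) p q (fun β => β * g β - d) where
  hM := h.hM
  hpq := h.hpq
  hM' := h.hM'
  cont := by have := h.cont; fun_prop
  mono := by
    intro x hx y hy hxy
    have := h.mul_mono hM hx hy hxy
    simp only at this ⊢
    linarith
  g0 := by linarith
  g1 := by linarith
  heq := by
    intro β hβ
    have hβ' : β ∈ Icc p q := ⟨hβ.1, hβ.2.le⟩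
    rw [orb_succ, dgt, h.heq β hβ]
    have ha := h.mul_mono hM hβ' ⟨h.hpq.le, le_rfl⟩ hβ.2
    have hb := (h.mul_mono hM).monotoneOn ⟨le_rfl, h.hpq.le⟩ hβ' hβ.1
    simp only at ha hb
    have : ⌊β * g β⌋ = d := Int.floor_eq_iff.2 ⟨by linarith, by linarith⟩
    rw [this]
  lip := by
    intro x y hx hxy hy
    have h2 := h.lip x y hx hxy hy
    have hx' : x ∈ Icc p q := ⟨hx, hxy.trans hy⟩
    have hM1 : (1:ℝ) ≤ M := by exact_mod_cast hM
    have hy0 : 0 ≤ y := by linarith [h.hM]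
    have hyB : y ≤ M + 1 := hy.trans h.hM'
    have hg0 : 0 ≤ g y - g x := by
      have := h.mono.monotoneOn hx' ⟨hx.trans hxy, hy⟩ hxy
      linarith
    have hg1 := h.le_one hx'
    have e : y * g y - d - (x * g x - d) = y * (g y - g x) + (y - x) * g x := by ring
    rw [e, pow_succ]
    have i1 : y * (g y - g x) ≤ (M + 1) * (g y - g x) := by gcongr
    have i2 : ((M:ℝ) + 1) * (g y - g x) ≤ (M + 1) * ((((M:ℝ) + 1) ^ n - 1) * (y - x)) := by gcongr
    have i3 : (y - x) * g x ≤ (y - x) * 1 := by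
      apply mul_le_mul_of_nonneg_left hg1; linarith
    have i4 : 0 ≤ (M - 1 : ℝ) * (y - x) := mul_nonneg (by linarith) (by linarith)
    nlinarith

lemma IsBr.base {M : ℕ} (hM : 0 < M) : IsBr M 1 M (M+1) := by
  refine ⟨fun β => β - M, ⟨le_rfl, by linarith, le_rfl, by fun_prop, ?_, by simp, by simp, ?_, ?_⟩,
    by simp, by simp⟩
  · intro x _ y _ h; simp only; linarith
  · intro β hβ
    rw [orb_succ, dgt, orb_zero, mul_one]
    have : ⌊β⌋ = (M:ℤ) := Int.floor_eq_iff.2 ⟨by simpa using hβ.1, by simpa using hβ.2⟩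
    rw [this]; simp
  · intro x y _ h _
    have hM1 : (1:ℝ) ≤ M := by exact_mod_cast hM
    nlinarith

lemma IsBr.length {M n : ℕ} {u v : ℝ} (h : IsBr M n u v) : ((((M:ℝ) + 1) ^ n)⁻¹) ≤ v - u := by
  obtain ⟨g, h, h0, h1⟩ := h
  have := h.lip u v le_rfl h.hpq.le le_rfl
  rw [h0, h1] at this
  have h2 := h.hpq
  rw [inv_le_iff_one_le_mul₀ (by positivity)]
  nlinarith

/-- intermediate values of `β * g β` -/
lemma IsPiece.ivt {M n : ℕ} {p q : ℝ} {g : ℝ → ℝ} (h : IsPiece M n p q g)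
    {y : ℝ} (h0 : p * g p ≤ y) (h1 : y ≤ q * g q) : ∃ x ∈ Icc p q, x * g x = y := by
  have := intermediate_value_Icc h.hpq.le (f := fun β => β * g β)
    (by have := h.cont; fun_prop) ⟨h0, h1⟩
  exact this

lemma IsBr.children {M n : ℕ} {u v : ℝ} (hM : 0 < M) (h : IsBr M n u v) :
    ∃ z : ℕ → ℝ, (∀ d < M, IsBr M (n+1) (z d) (z (d+1))) ∧ (∀ d ≤ M, z d ∈ Icc u v) := by
  obtain ⟨g, h, h0, h1⟩ := h
  have hv : (M:ℝ) ≤ v := h.hM.trans h.hpq.le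
  have : ∀ d : ℕ, ∃ x, d ≤ M → x ∈ Icc u v ∧ x * g x = d := by
    intro d
    by_cases hd : d ≤ M
    · have hd' : (d:ℝ) ≤ M := by exact_mod_cast hd
      obtain ⟨x, hx, hx'⟩ := h.ivt (y := d) (by rw [h0]; simp) (by rw [h1]; linarith)
      exact ⟨x, fun _ => ⟨hx, hx'⟩⟩
    · exact ⟨0, fun h => absurd h hd⟩
  choose z hz using this
  refine ⟨z, ?_, fun d hd => (hz d hd).1⟩
  intro d hd
  obtain ⟨a1, a2⟩ := hz d hd.le
  obtain ⟨b1, b2⟩ := hz (d+1) hd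
  push_cast at b2
  have hlt : z d < z (d+1) := by
    by_contra hcon
    have := (h.mul_mono hM).monotoneOn b1 a1 (not_lt.1 hcon)
    linarith
  exact ⟨_, (h.sub a1.1 b1.2 hlt).next hM d (by rw [a2]; simp) (by rw [b2]; simp),
    by simp [a2], by simp [b2]⟩

lemma IsPiece.gain {M Q : ℕ} (hMQ : M = 3 * Q) (hQ : 0 < Q) (K : ℕ) : ∀ {n : ℕ} {p q : ℝ} {g : ℝ → ℝ},
    IsPiece M n p q g → 2 ≤ (Q:ℝ) ^ K * (g q - g p) →
    ∃ k ≤ K, ∃ u v, IsBr M (n+k) u v ∧ p ≤ u ∧ v ≤ q := by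
  have hM : 0 < M := by omega
  have hMR : (M:ℝ) = 3 * Q := by exact_mod_cast hMQ
  have hQR : (0:ℝ) < Q := by exact_mod_cast hQ
  induction K with
  | zero =>
    intro n p q g h h2
    have := h.g0; have := h.g1
    simp at h2; linarith
  | succ K ih =>
    intro n p q g h h2
    have hgpq : 0 < g q - g p := by
      have := h.mono ⟨le_rfl, h.hpq.le⟩ ⟨h.hpq.le, le_rfl⟩ h.hpq; linarith
    have hgrow : M * (g q - g p) ≤ q * g q - p * g p := by
      have i1 : (M:ℝ) * (g q - g p) ≤ p * (g q - g p) := by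
        have := h.hM; gcongr
      have i2 : 0 ≤ (q - p) * g q :=
        mul_nonneg (by linarith [h.hpq]) (h.nonneg ⟨h.hpq.le, le_rfl⟩)
      nlinarith
    -- a piece of next generation whose image has length at least `Q * (g q - g p)` is enough
    have fin : ∀ p' q' (d : ℤ), p ≤ p' → q' ≤ q → p' < q' → (d:ℝ) ≤ p' * g p' →
        q' * g q' ≤ d + 1 → Q * (g q - g p) ≤ q' * g q' - p' * g p' →
        ∃ k ≤ K + 1, ∃ u v, IsBr M (n+k) u v ∧ p ≤ u ∧ v ≤ q := by
      intro p' q' d hp hq hlt hd0 hd1 hlen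
      obtain ⟨k, hk, u, v, hb, hu, hv⟩ := ih ((h.sub hp hq hlt).next hM d hd0 hd1) (by
        rw [pow_succ] at h2
        have : (Q:ℝ) ^ K * (Q * (g q - g p)) ≤ (Q:ℝ) ^ K * (q' * g q' - p' * g p') := by gcongr
        nlinarith)
      exact ⟨k+1, by omega, u, v, by rwa [show n + (k+1) = n + 1 + k by ring], hp.trans hu, hv.trans hq⟩
    set d := ⌈p * g p⌉ with hd
    have hd1 : p * g p ≤ d := Int.le_ceil _
    have hd2 : (d:ℝ) < p * g p + 1 := Int.ceil_lt_add_one _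
    by_cases hc : (d:ℝ) + 1 ≤ q * g q
    · obtain ⟨x, hx, hx'⟩ := h.ivt hd1 (by linarith)
      obtain ⟨y, hy, hy'⟩ := h.ivt (y := d + 1) (by linarith) hc
      have hlt : x < y := by
        by_contra hcon
        have := (h.mul_mono hM).monotoneOn hy hx (not_lt.1 hcon)
        linarith
      exact ⟨1, by omega, x, y, ⟨_, (h.sub hx.1 hy.2 hlt).next hM d hx'.ge hy'.le,
        by simp [hx'], by simp [hy']⟩, hx.1, hy.2⟩
    · push Not at hc
      by_cases hc2 : q * g q ≤ d
      · refine fin p q (d-1) le_rfl le_rfl h.hpq (by push_cast; linarith) (by push_cast; linarith) ?_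
        nlinarith
      · push Not at hc2
        obtain ⟨x, hx, hx'⟩ := h.ivt hd1 hc2.le
        have hxq : x < q := by
          by_contra hcon
          have : x = q := le_antisymm hx.2 (not_lt.1 hcon)
          rw [this] at hx'; linarith
        by_cases hbig : Q * (g q - g p) ≤ q * g q - x * g x
        · exact fin x q d hx.1 le_rfl hxq hx'.ge hc.le hbig
        · push Not at hbig
          have hbig2 : Q * (g q - g p) ≤ x * g x - p * g p := by nlinarith
          have hpx : p < x := by
            by_contra hcon
            have : x = p := le_antisymm (not_lt.1 hcon) hx.1
            rw [this] at hbig2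
            have := mul_pos hQR hgpq
            linarith
          refine fin p x (d-1) le_rfl hx.2 hpx (by push_cast; linarith) (by push_cast; linarith) hbig2

lemma IsBr.jump {M Q : ℕ} (hMQ : M = 3 * Q) (hQ : 0 < Q) {N : ℕ} {u v : ℝ} (h : IsBr M N u v)
    {x₀ : ℝ} (hx₀ : x₀ ∈ Icc (0:ℝ) 1) (l K : ℕ) (hK : 8 * ((M:ℝ) + 1) ^ l ≤ (Q:ℝ) ^ K) :
    ∃ k ≤ K, ∃ u' v', IsBr M (N+k) u' v' ∧ u ≤ u' ∧ v' ≤ v ∧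
      ∀ β ∈ Icc u' v', |orb β N - x₀| < β ^ (-(l:ℤ)) := by
  obtain ⟨g, h, h0, h1⟩ := h
  have hMR : (1:ℝ) ≤ M := by exact_mod_cast (show 1 ≤ M by omega)
  set ρ : ℝ := (((M:ℝ) + 1) ^ l)⁻¹ with hρ
  have hρ0 : 0 < ρ := by positivity
  have hρ1 : ρ ≤ 1 := inv_le_one_of_one_le₀ (one_le_pow₀ (by linarith))
  obtain ⟨c, hc0, hc1, hc2, hc3⟩ : ∃ c, 0 ≤ c ∧ c + ρ/4 < 1 ∧ x₀ - ρ < c ∧ c + ρ/4 < x₀ + ρ := by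
    by_cases hx : x₀ < 1/2
    · exact ⟨x₀, hx₀.1, by linarith, by linarith, by linarith⟩
    · exact ⟨x₀ - ρ/2, by linarith, by linarith [hx₀.2], by linarith, by linarith⟩
  have ivt : ∀ y, 0 ≤ y → y ≤ 1 → ∃ x ∈ Icc u v, g x = y := fun y hy0 hy1 =>
    intermediate_value_Icc h.hpq.le h.cont.continuousOn ⟨by rw [h0]; exact hy0, by rw [h1]; exact hy1⟩
  obtain ⟨p, hp, hp'⟩ := ivt c hc0 (by linarith)
  obtain ⟨q, hq, hq'⟩ := ivt (c + ρ/4) (by linarith) (by linarith)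
  have hlt : p < q := by
    by_contra hcon
    have := h.mono.monotoneOn hq hp (not_lt.1 hcon)
    linarith
  have hqv : q < v := by
    by_contra hcon
    have : q = v := le_antisymm hq.2 (not_lt.1 hcon)
    rw [this, h1] at hq'; linarith
  have hpc := h.sub hp.1 hq.2 hlt
  obtain ⟨k, hk, u', v', hb, hu, hv⟩ := hpc.gain hMQ hQ K (by
    rw [hp', hq']
    have : 8 ≤ (Q:ℝ) ^ K * ρ := by
      rw [hρ, ← div_eq_mul_inv, le_div_iff₀ (by positivity)]; exact hK
    linarith)
  refine ⟨k, hk, u', v', hb, hp.1.trans hu, hv.trans hq.2, ?_⟩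
  intro β hβ
  have hβ' : β ∈ Icc p q := ⟨hu.trans hβ.1, hβ.2.trans hv⟩
  rw [h.heq β ⟨hp.1.trans hβ'.1, hβ'.2.trans_lt hqv⟩]
  have i1 := hpc.mono.monotoneOn ⟨le_rfl, hlt.le⟩ hβ' hβ'.1
  have i2 := hpc.mono.monotoneOn hβ' ⟨hlt.le, le_rfl⟩ hβ'.2
  have hβ0 : 0 < β := by linarith [hpc.hM, hβ'.1]
  have i3 : ρ ≤ β ^ (-(l:ℤ)) := by
    rw [hρ, zpow_neg, zpow_natCast]
    apply inv_anti₀ (by positivity)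
    exact pow_le_pow_left₀ hβ0.le (hβ'.2.trans hpc.hM') _
  rw [abs_lt]
  constructor <;> linarith


open Classical in
/-- Sum of the weights of the sets `U i` that meet `[u,v]`. -/
noncomputable def pot (U : ℕ → Set ℝ) (c : ℕ → ℝ≥0∞) (u v : ℝ) : ℝ≥0∞ :=
  ∑' i, if (U i ∩ Icc u v).Nonempty then c i else 0

lemma pot_mono {U : ℕ → Set ℝ} {c : ℕ → ℝ≥0∞} {u v u' v' : ℝ} (hu : u ≤ u') (hv : v' ≤ v) :
    pot U c u' v' ≤ pot U c u v := by
  classical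
  apply ENNReal.tsum_le_tsum
  intro i
  by_cases h : (U i ∩ Icc u' v').Nonempty
  · have h' : (U i ∩ Icc u v).Nonempty :=
      h.mono (inter_subset_inter_right _ (Icc_subset_Icc hu hv))
    simp [h, h']
  · simp [h]

lemma le_pot {U : ℕ → Set ℝ} {c : ℕ → ℝ≥0∞} {u v : ℝ} {i : ℕ} (h : (U i ∩ Icc u v).Nonempty) :
    c i ≤ pot U c u v := by
  classical
  have := ENNReal.le_tsum (f := fun i => if (U i ∩ Icc u v).Nonempty then c i else 0) i
  unfold pot
  simp only [h, if_true] at this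
  convert this

lemma pot_le_of {U : ℕ → Set ℝ} {c c' : ℕ → ℝ≥0∞} {u v : ℝ} (a : ℝ≥0∞)
    (h : ∀ i, (U i ∩ Icc u v).Nonempty → c i ≤ a * c' i) :
    pot U c u v ≤ a * pot U c' u v := by
  classical
  unfold pot
  rw [← ENNReal.tsum_mul_left]
  apply ENNReal.tsum_le_tsum
  intro i
  by_cases hi : (U i ∩ Icc u v).Nonempty
  · simpa [hi] using h i hi
  · simp [hi]

lemma pot_step {M Q : ℕ} (hMQ : M = 3 * Q) (hQ : 0 < Q) {U : ℕ → Set ℝ} {r : ℕ → ℝ}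
    (hU : ∀ i, ∀ x ∈ U i, ∀ y ∈ U i, y - x ≤ r i) {n : ℕ} {u v : ℝ} (h : IsBr M n u v)
    (c c' : ℕ → ℝ≥0∞)
    (h1 : ∀ i, r i ≤ (((M:ℝ)+1)^(n+1))⁻¹ → c' i ≤ Q * c i)
    (h2 : ∀ i, (((M:ℝ)+1)^(n+1))⁻¹ < r i → c' i ≤ c i) :
    ∃ u' v', IsBr M (n+1) u' v' ∧ u ≤ u' ∧ v' ≤ v ∧ pot U c' u' v' ≤ pot U c u v := by
  classical
  have hM : 0 < M := by omega
  obtain ⟨z, hz, hzI⟩ := h.children hM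
  suffices hs : ∃ d < M, pot U c' (z d) (z (d+1)) ≤ pot U c u v by
    obtain ⟨d, hd, hle⟩ := hs
    exact ⟨z d, z (d+1), hz d hd, (hzI d hd.le).1, (hzI (d+1) hd).2, hle⟩
  have hsum : ∑ d ∈ Finset.range M, pot U c' (z d) (z (d+1)) ≤ M * pot U c u v := by
    unfold pot
    rw [← Summable.tsum_finsetSum (fun _ _ => ENNReal.summable), ← ENNReal.tsum_mul_left]
    apply ENNReal.tsum_le_tsum
    intro i
    rw [← Finset.sum_filter, Finset.sum_const, nsmul_eq_mul]
    set S := (Finset.range M).filter (fun d => (U i ∩ Icc (z d) (z (d+1))).Nonempty) with hS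
    by_cases hi : (U i ∩ Icc u v).Nonempty
    · rw [if_pos hi]
      by_cases hr : r i ≤ (((M:ℝ)+1)^(n+1))⁻¹
      · have hcard : S.card ≤ 3 := by
          by_cases hne : S.Nonempty
          · have hsub : S ⊆ Finset.Icc (S.min' hne) (S.min' hne + 2) := by
              intro e he
              rw [Finset.mem_Icc]
              refine ⟨S.min'_le e he, ?_⟩
              by_contra hcon
              push Not at hcon
              set d := S.min' hne with hd
              have hdS : d ∈ S := S.min'_mem hne
              rw [hS, Finset.mem_filter, Finset.mem_range] at he hdS
              obtain ⟨heM, y, hyU, hyI⟩ := he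
              obtain ⟨hdM, x, hxU, hxI⟩ := hdS
              have l1 := (hz (d+1) (by omega)).length
              have l2 := (hz (d+2) (by omega)).length
              have l3 : z (d+3) ≤ z e := by
                have : ∀ k, d + 3 + k ≤ M → z (d+3) ≤ z (d+3+k) := by
                  intro k
                  induction k with
                  | zero => intro _; exact le_rfl
                  | succ k ih =>
                    intro hk
                    have := (hz (d+3+k) (by omega)).length
                    have hp : (0:ℝ) ≤ (((M:ℝ)+1)^(n+1))⁻¹ := by positivity
                    have := ih (by omega)
                    rw [show d + 3 + (k+1) = d + 3 + k + 1 by ring]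
                    linarith
                have h' := this (e - (d+3)) (by omega)
                rwa [show d + 3 + (e - (d+3)) = e by omega] at h'
              have hp : (0:ℝ) < (((M:ℝ)+1)^(n+1))⁻¹ := by positivity
              have := hU i x hxU y hyU
              have := hxI.2
              have := hyI.1
              norm_num [add_assoc] at l1 l2
              linarith
            calc S.card ≤ _ := Finset.card_le_card hsub
              _ = 3 := by simp; omega
          · rw [Finset.not_nonempty_iff_eq_empty.1 hne]; simp
        calc (S.card : ℝ≥0∞) * c' i ≤ 3 * (Q * c i) := by
              gcongr
              · exact_mod_cast hcard
              · exact h1 i hr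
          _ = M * c i := by rw [hMQ]; push_cast; ring
      · push Not at hr
        have hcard : S.card ≤ M := by
          calc S.card ≤ (Finset.range M).card := Finset.card_filter_le _ _
            _ = M := by simp
        gcongr
        exact h2 i hr
    · have : S = ∅ := by
        rw [hS, Finset.filter_eq_empty_iff]
        intro d hd hne
        rw [Finset.mem_range] at hd
        exact hi (hne.mono (inter_subset_inter_right _
          (Icc_subset_Icc (hzI d hd.le).1 (hzI (d+1) hd).2)))
      rw [this]; simp
  by_contra hcon
  push Not at hcon
  have hlt : ∑ d ∈ Finset.range M, pot U c u v < ∑ d ∈ Finset.range M, pot U c' (z d) (z (d+1)) := by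
    apply ENNReal.sum_lt_sum_of_nonempty
    · exact ⟨0, Finset.mem_range.2 hM⟩
    · intro d hd
      exact hcon d (Finset.mem_range.1 hd)
  rw [Finset.sum_const, Finset.card_range, nsmul_eq_mul] at hlt
  exact absurd hsum (not_le.2 hlt)

/-- descend from level `n` to level `N`. -/
lemma pot_descend {M Q : ℕ} (hMQ : M = 3 * Q) (hQ : 0 < Q) {U : ℕ → Set ℝ} {r : ℕ → ℝ}
    (hU : ∀ i, ∀ x ∈ U i, ∀ y ∈ U i, y - x ≤ r i) (c : ℕ → ℕ → ℝ≥0∞)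
    (h1 : ∀ n i, r i ≤ (((M:ℝ)+1)^(n+1))⁻¹ → c (n+1) i ≤ Q * c n i)
    (h2 : ∀ n i, (((M:ℝ)+1)^(n+1))⁻¹ < r i → c (n+1) i ≤ c n i)
    {n : ℕ} {u v : ℝ} (h : IsBr M n u v) (k : ℕ) :
    ∃ u' v', IsBr M (n+k) u' v' ∧ u ≤ u' ∧ v' ≤ v ∧ pot U (c (n+k)) u' v' ≤ pot U (c n) u v := by
  induction k with
  | zero => exact ⟨u, v, h, le_rfl, le_rfl, le_rfl⟩
  | succ k ih =>
    obtain ⟨u1, v1, hb, hu, hv, hp⟩ := ih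
    obtain ⟨u2, v2, hb2, hu2, hv2, hp2⟩ := pot_step hMQ hQ hU hb (c (n+k)) (c (n+k+1))
      (h1 (n+k)) (h2 (n+k))
    exact ⟨u2, v2, hb2, hu.trans hu2, hv2.trans hv, hp2.trans hp⟩

lemma phase {M Q : ℕ} (hMQ : M = 3 * Q) (hQ : 2 ≤ Q) {U : ℕ → Set ℝ} {r : ℕ → ℝ}
    (hr : ∀ i, 0 < r i)
    (hU : ∀ i, ∀ x ∈ U i, ∀ y ∈ U i, y - x ≤ r i) {s t : ℝ} (hs : 0 < s) (hst : s < t)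
    (ht : ((M:ℝ) + 1) ^ t = Q) {n : ℕ} {u v : ℝ} (h : IsBr M n u v)
    (hpot : pot U (fun i => ENNReal.ofReal (r i ^ s)) u v ≤
      ENNReal.ofReal ((Q:ℝ) ^ (-(n * (s / t))) / (4 * Q))) (k : ℕ) :
    ∃ u' v', IsBr M (n+k) u' v' ∧ u ≤ u' ∧ v' ≤ v ∧
      pot U (fun i => ENNReal.ofReal (r i ^ s)) u' v' ≤
        ENNReal.ofReal ((Q:ℝ) ^ (n * (1 - s / t)) / (2 * (Q:ℝ) ^ (n + k + 1))) := by
  have ht0 : 0 < t := hs.trans hst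
  have hQR : (2:ℝ) ≤ Q := by exact_mod_cast hQ
  have hQ0 : (0:ℝ) < Q := by linarith
  have hB0 : (0:ℝ) < (M:ℝ) + 1 := by positivity
  set lam : ℝ := (Q:ℝ) ^ (-(n * (1 - s / t))) with hlam
  have hlam0 : 0 < lam := Real.rpow_pos_of_pos hQ0 _
  have hrt : ∀ i, 0 < r i ^ t := fun i => Real.rpow_pos_of_pos (hr i) _
  have hrs : ∀ i, 0 < r i ^ s := fun i => Real.rpow_pos_of_pos (hr i) _
  set c : ℕ → ℕ → ℝ≥0∞ := fun m i => ENNReal.ofReal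
    ((r i ^ t + lam * r i ^ s) * min ((Q:ℝ) ^ (m+1)) ((r i ^ t)⁻¹)) with hc
  have hBQ : ∀ m : ℕ, (((M:ℝ)+1)^m) ^ t = (Q:ℝ) ^ m := by
    intro m
    rw [← Real.rpow_natCast, ← Real.rpow_mul hB0.le, mul_comm, Real.rpow_mul hB0.le, ht,
      Real.rpow_natCast]
  have h1 : ∀ m i, r i ≤ (((M:ℝ)+1)^(m+1))⁻¹ → c (m+1) i ≤ Q * c m i := by
    intro m i _
    simp only [hc]
    rw [← ENNReal.ofReal_natCast, ← ENNReal.ofReal_mul (by positivity)]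
    apply ENNReal.ofReal_le_ofReal
    have hmin : min ((Q:ℝ) ^ (m+1+1)) ((r i ^ t)⁻¹) ≤ Q * min ((Q:ℝ) ^ (m+1)) ((r i ^ t)⁻¹) := by
      rw [mul_min_of_nonneg _ _ hQ0.le]
      apply min_le_min
      · rw [pow_succ' _ (m+1)]
      · have := inv_pos.2 (hrt i); nlinarith
    have := mul_le_mul_of_nonneg_left hmin
      (show 0 ≤ r i ^ t + lam * r i ^ s from by have := hrt i; have := hrs i; positivity)
    linarith
  have h2 : ∀ m i, (((M:ℝ)+1)^(m+1))⁻¹ < r i → c (m+1) i ≤ c m i := by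
    intro m i hlt
    simp only [hc]
    apply ENNReal.ofReal_le_ofReal
    have hle : (r i ^ t)⁻¹ ≤ (Q:ℝ) ^ (m+1) := by
      rw [← hBQ, ← Real.inv_rpow (hr i).le]
      apply Real.rpow_le_rpow (inv_nonneg.2 (hr i).le) _ ht0.le
      rw [inv_le_comm₀ (hr i) (by positivity)]
      exact hlt.le
    rw [min_eq_right hle]
    apply mul_le_mul_of_nonneg_left (min_le_right _ _)
    have := hrt i; have := hrs i; positivity
  obtain ⟨u', v', hb, hu, hv, hp⟩ := pot_descend hMQ (by omega) hU c h1 h2 h k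
  refine ⟨u', v', hb, hu, hv, ?_⟩
  -- initial bound
  have hinit : pot U (c n) u v ≤ ENNReal.ofReal (1/2) := by
    have hA : pot U (c n) u v ≤ ENNReal.ofReal (2 * lam * (Q:ℝ)^(n+1)) *
        pot U (fun i => ENNReal.ofReal (r i ^ s)) u v := by
      apply pot_le_of
      intro i hi
      simp only [hc]
      rw [← ENNReal.ofReal_mul (by positivity)]
      apply ENNReal.ofReal_le_ofReal
      have hri : r i ^ s ≤ (Q:ℝ) ^ (-(n * (s / t))) := by
        have := (le_pot (c := fun i => ENNReal.ofReal (r i ^ s)) hi).trans hpot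
        rw [ENNReal.ofReal_le_ofReal_iff (by positivity)] at this
        refine this.trans (div_le_self (by positivity) (by linarith))
      have hts : r i ^ t ≤ lam * r i ^ s := by
        have e1 : r i ^ t = (r i ^ s) ^ ((t - s) / s) * r i ^ s := by
          rw [← Real.rpow_mul (hr i).le, ← Real.rpow_add (hr i)]
          congr 1; field_simp; ring
        have e2 : lam = ((Q:ℝ) ^ (-(n * (s / t)))) ^ ((t - s) / s) := by
          rw [hlam, ← Real.rpow_mul hQ0.le]
          congr 1; field_simp
        rw [e1, e2]
        apply mul_le_mul_of_nonneg_right _ (hrs i).le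
        apply Real.rpow_le_rpow (hrs i).le hri
        exact div_nonneg (by linarith) hs.le
      have : (r i ^ t + lam * r i ^ s) * min ((Q:ℝ) ^ (n+1)) ((r i ^ t)⁻¹) ≤
          (2 * lam * r i ^ s) * (Q:ℝ)^(n+1) := by
        apply mul_le_mul _ (min_le_left _ _) _ _
        · linarith
        · have := hrt i; positivity
        · have := hrs i; positivity
      linarith
    refine hA.trans ?_
    calc _ ≤ ENNReal.ofReal (2 * lam * (Q:ℝ)^(n+1)) *
          ENNReal.ofReal ((Q:ℝ) ^ (-(n * (s / t))) / (4 * Q)) := by gcongr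
      _ = ENNReal.ofReal (1/2) := by
        rw [← ENNReal.ofReal_mul (by positivity)]
        congr 1
        have e : lam * (Q:ℝ) ^ (-(n * (s / t))) * (Q:ℝ)^n = 1 := by
          rw [hlam, ← Real.rpow_natCast, ← Real.rpow_add hQ0, ← Real.rpow_add hQ0]
          rw [show -(n * (1 - s / t)) + -(n * (s / t)) + (n:ℝ) = 0 by ring, Real.rpow_zero]
        rw [pow_succ]
        have e3 : 2 * lam * ((Q:ℝ)^n * Q) * ((Q:ℝ) ^ (-(n * (s / t))) / (4 * Q)) =
            (lam * (Q:ℝ) ^ (-(n * (s / t))) * (Q:ℝ)^n) * (2 * (Q * (1 / (4 * Q)))) := by ring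
        rw [e3, e]
        field_simp
        norm_num
  have hfin := hp.trans hinit
  have hB : pot U (fun i => ENNReal.ofReal (r i ^ s)) u' v' ≤
      ENNReal.ofReal ((lam * (Q:ℝ)^(n+k+1))⁻¹) * pot U (c (n+k)) u' v' := by
    apply pot_le_of
    intro i hi
    have hi1 := (le_pot (c := c (n+k)) hi).trans hfin
    simp only [hc] at hi1 ⊢
    rw [ENNReal.ofReal_le_ofReal_iff (by norm_num)] at hi1
    rw [← ENNReal.ofReal_mul (by positivity)]
    apply ENNReal.ofReal_le_ofReal
    have a1 := hrt i
    have a2 := hrs i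
    rcases le_total ((Q:ℝ) ^ (n+k+1)) ((r i ^ t)⁻¹) with hle | hle
    · rw [min_eq_left hle]
      rw [inv_mul_eq_div, le_div_iff₀ (by positivity)]
      have : 0 < r i ^ t * (Q:ℝ)^(n+k+1) := by positivity
      nlinarith
    · exfalso
      rw [min_eq_right hle, add_mul, mul_inv_cancel₀ a1.ne'] at hi1
      have : 0 < lam * r i ^ s * (r i ^ t)⁻¹ := by positivity
      linarith
  refine hB.trans ?_
  calc _ ≤ ENNReal.ofReal ((lam * (Q:ℝ)^(n+k+1))⁻¹) * ENNReal.ofReal (1/2) := by gcongr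
    _ = _ := by
      rw [← ENNReal.ofReal_mul (by positivity)]
      congr 1
      rw [hlam, Real.rpow_neg hQ0.le]
      field_simp


lemma loop_step {M Q : ℕ} (hMQ : M = 3 * Q) (hQ : 2 ≤ Q) {U : ℕ → Set ℝ} {r : ℕ → ℝ}
    (hr : ∀ i, 0 < r i)
    (hU : ∀ i, ∀ x ∈ U i, ∀ y ∈ U i, y - x ≤ r i) {s t κ : ℝ} (hs : 0 < s) (hst : s < t)
    (ht : ((M:ℝ) + 1) ^ t = Q) (hκ : 0 ≤ κ) (hκs : (s / t) * (1 + κ / t) < 1)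
    {x₀ : ℝ} (hx₀ : x₀ ∈ Icc (0:ℝ) 1) {ℓ : ℕ → ℕ} (hfr : ∃ᶠ n : ℕ in atTop, (ℓ n : ℝ) ≤ κ * n)
    {n : ℕ} {u v : ℝ} (h : IsBr M n u v)
    (hpot : pot U (fun i => ENNReal.ofReal (r i ^ s)) u v ≤
      ENNReal.ofReal ((Q:ℝ) ^ (-(n * (s / t))) / (4 * Q))) (N0 : ℕ) :
    ∃ N ≥ N0, ∃ n' ≥ N, ∃ u' v', IsBr M n' u' v' ∧ u ≤ u' ∧ v' ≤ v ∧
      (∀ β ∈ Icc u' v', |orb β N - x₀| < β ^ (-(ℓ N:ℤ))) ∧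
      pot U (fun i => ENNReal.ofReal (r i ^ s)) u' v' ≤
        ENNReal.ofReal ((Q:ℝ) ^ (-(n' * (s / t))) / (4 * Q)) := by
  have ht0 : 0 < t := hs.trans hst
  have hQR : (2:ℝ) ≤ Q := by exact_mod_cast hQ
  have hQ0 : (0:ℝ) < Q := by linarith
  have hB0 : (0:ℝ) < (M:ℝ) + 1 := by positivity
  have hθ0 : 0 < s / t := div_pos hs ht0
  set θ := s / t with hθ
  set δ := 1 - θ * (1 + κ / t) with hδ
  have hδ0 : 0 < δ := by linarith
  obtain ⟨N1, hN1⟩ := exists_nat_ge ((1 + n * (1 - θ) + 4 * θ) / δ)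
  obtain ⟨N, hN, hℓN⟩ := (frequently_atTop.1 hfr) (max N0 (max N1 n))
  have hN0 : N0 ≤ N := le_trans (le_max_left _ _) hN
  have hN1' : N1 ≤ N := le_trans (le_trans (le_max_left _ _) (le_max_right _ _)) hN
  have hnN : n ≤ N := le_trans (le_trans (le_max_right _ _) (le_max_right _ _)) hN
  obtain ⟨u1, v1, hb1, hu1, hv1, hp1⟩ := phase hMQ hQ hr hU hs hst ht h hpot (N - n)
  rw [show n + (N - n) = N by omega] at hb1 hp1
  set K := ⌈(ℓ N : ℝ) / t⌉₊ + 3 with hK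
  have hceil := Nat.le_ceil ((ℓ N : ℝ) / t)
  have hceil2 : ((⌈(ℓ N : ℝ) / t⌉₊ : ℕ) : ℝ) < (ℓ N : ℝ) / t + 1 :=
    Nat.ceil_lt_add_one (by positivity)
  have hKK : 8 * ((M:ℝ)+1)^(ℓ N) ≤ (Q:ℝ)^K := by
    have e1 : ((M:ℝ)+1)^(ℓ N) = (Q:ℝ) ^ ((ℓ N : ℝ) / t) := by
      rw [← ht, ← Real.rpow_mul hB0.le, mul_div_cancel₀ _ ht0.ne', Real.rpow_natCast]
    have e2 : (Q:ℝ) ^ ((ℓ N : ℝ) / t) ≤ (Q:ℝ) ^ (⌈(ℓ N : ℝ) / t⌉₊) := by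
      rw [← Real.rpow_natCast (Q:ℝ)]
      exact Real.rpow_le_rpow_of_exponent_le (by linarith) hceil
    have e3 : (8:ℝ) ≤ (Q:ℝ)^3 := by
      calc (8:ℝ) = 2^3 := by norm_num
        _ ≤ _ := by gcongr
    rw [e1, hK, pow_add, mul_comm]
    exact mul_le_mul e2 e3 (by norm_num) (by positivity)
  obtain ⟨k, hk, u2, v2, hb2, hu2, hv2, hc⟩ := IsBr.jump hMQ (by omega) hb1 hx₀ (ℓ N) K hKK
  refine ⟨N, hN0, N + k, by omega, u2, v2, hb2, hu1.trans hu2, hv2.trans hv1, hc, ?_⟩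
  refine (pot_mono hu2 hv2).trans (hp1.trans (ENNReal.ofReal_le_ofReal ?_))
  have hkR : (k:ℝ) ≤ κ * N / t + 4 := by
    have h1 : (k:ℝ) ≤ K := by exact_mod_cast hk
    have h2 : (K:ℝ) = (⌈(ℓ N : ℝ) / t⌉₊ : ℕ) + 3 := by rw [hK]; push_cast; ring
    have h3 : (ℓ N : ℝ) / t ≤ κ * N / t := by gcongr
    linarith
  have hNR : (1 + n * (1 - θ) + 4 * θ) ≤ N * δ := by
    rw [← div_le_iff₀ hδ0]
    exact hN1.trans (by exact_mod_cast hN1')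
  have hexp : 1 + n * (1 - θ) ≤ N - (N + k) * θ := by
    have h1 : (k:ℝ) * θ ≤ (κ * N / t + 4) * θ := by gcongr
    have h2 : (N:ℝ) * δ = N - N * θ - (κ * N / t) * θ := by rw [hδ]; ring
    nlinarith
  have key : (Q:ℝ) ^ (n * (1 - θ)) * 2 ≤ (Q:ℝ)^N * (Q:ℝ) ^ (-((N + k) * θ)) := by
    calc (Q:ℝ) ^ (n * (1 - θ)) * 2 ≤ (Q:ℝ) ^ (n * (1 - θ)) * Q := by gcongr
      _ = (Q:ℝ) ^ (n * (1 - θ) + 1) := by rw [Real.rpow_add hQ0, Real.rpow_one]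
      _ ≤ (Q:ℝ) ^ ((N:ℝ) + -((N + k) * θ)) :=
        Real.rpow_le_rpow_of_exponent_le (by linarith) (by linarith)
      _ = _ := by rw [Real.rpow_add hQ0, Real.rpow_natCast]
  push_cast
  rw [div_le_div_iff₀ (by positivity) (by positivity), pow_succ]
  generalize (Q:ℝ) ^ (n * (1 - θ)) = A at *
  generalize (Q:ℝ) ^ (-((N + k) * θ)) = D at *
  nlinarith

/-- The set in the theorem. -/
def Eset (ℓ : ℕ → ℕ) (x₀ : ℝ) : Set ℝ :=
  {β : ℝ | 1 < β ∧ ∃ᶠ n in atTop, |orb β n - x₀| < β ^ (-(ℓ n : ℤ))}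

lemma exists_uncovered {M Q : ℕ} (hMQ : M = 3 * Q) (hQ : 2 ≤ Q) {U : ℕ → Set ℝ} {r : ℕ → ℝ}
    (hr : ∀ i, 0 < r i)
    (hU : ∀ i, ∀ x ∈ U i, ∀ y ∈ U i, y - x ≤ r i) {s t κ : ℝ} (hs : 0 < s) (hst : s < t)
    (ht : ((M:ℝ) + 1) ^ t = Q) (hκ : 0 ≤ κ) (hκs : (s / t) * (1 + κ / t) < 1)
    {x₀ : ℝ} (hx₀ : x₀ ∈ Icc (0:ℝ) 1) {ℓ : ℕ → ℕ} (hfr : ∃ᶠ n : ℕ in atTop, (ℓ n : ℝ) ≤ κ * n)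
    (hsum : ∑' i, ENNReal.ofReal (r i ^ s) ≤ ENNReal.ofReal ((Q:ℝ) ^ (-(s / t)) / (4 * Q))) :
    ¬ Eset ℓ x₀ ⊆ ⋃ i, U i := by
  intro hcov
  have ht0 : 0 < t := hs.trans hst
  have hQR : (2:ℝ) ≤ Q := by exact_mod_cast hQ
  have hQ0 : (0:ℝ) < Q := by linarith
  have hθ0 : 0 < s / t := div_pos hs ht0
  let P : ℕ × ℝ × ℝ → Prop := fun p => IsBr M p.1 p.2.1 p.2.2 ∧
    pot U (fun i => ENNReal.ofReal (r i ^ s)) p.2.1 p.2.2 ≤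
      ENNReal.ofReal ((Q:ℝ) ^ (-(p.1 * (s / t))) / (4 * Q))
  have hstep : ∀ (j : ℕ) (p : {p // P p}), ∃ q : {p // P p}, ∃ N ≥ j, N ≤ q.1.1 ∧
      p.1.2.1 ≤ q.1.2.1 ∧ q.1.2.2 ≤ p.1.2.2 ∧
      ∀ β ∈ Icc q.1.2.1 q.1.2.2, |orb β N - x₀| < β ^ (-(ℓ N:ℤ)) := by
    rintro j ⟨⟨n, u, v⟩, h, hp⟩
    obtain ⟨N, hN, n', hn', u', v', hb, hu, hv, hc, hp'⟩ :=
      loop_step hMQ hQ hr hU hs hst ht hκ hκs hx₀ hfr h hp j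
    exact ⟨⟨⟨n', u', v'⟩, hb, hp'⟩, N, hN, hn', hu, hv, hc⟩
  choose F hF using hstep
  have h0 : P (1, (M:ℝ), (M:ℝ)+1) := by
    refine ⟨IsBr.base (by omega), ?_⟩
    simp only [Nat.cast_one, one_mul]
    refine le_trans ?_ hsum
    apply ENNReal.tsum_le_tsum
    intro i
    split_ifs <;> simp
  let p : ℕ → {p // P p} := fun j => Nat.rec ⟨_, h0⟩ (fun j q => F j q) j
  have hp0 : (p 0).1 = (1, (M:ℝ), (M:ℝ)+1) := rfl
  have hpS : ∀ j, p (j+1) = F j (p j) := fun j => rfl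
  have hle : ∀ j, (p j).1.2.1 ≤ (p j).1.2.2 := by
    intro j
    have := (p j).2.1.length
    have hp : (0:ℝ) < (((M:ℝ)+1)^((p j).1.1))⁻¹ := by positivity
    linarith
  have hmono : Monotone fun j => (p j).1.2.1 := by
    apply monotone_nat_of_le_succ
    intro j
    obtain ⟨N, _, _, hu, _, _⟩ := hF j (p j)
    rw [hpS]; exact hu
  have hanti : Antitone fun j => (p j).1.2.2 := by
    apply antitone_nat_of_succ_le
    intro j
    obtain ⟨N, _, _, _, hv, _⟩ := hF j (p j)
    rw [hpS]; exact hv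
  have hmem := hmono.ciSup_mem_iInter_Icc_of_antitone hanti hle
  set β := ⨆ j, (p j).1.2.1 with hβ
  rw [mem_iInter] at hmem
  have hβM : (M:ℝ) ≤ β := by have := (hmem 0).1; rw [hp0] at this; exact this
  have hM2 : (2:ℝ) ≤ M := by
    have : 2 ≤ M := by omega
    exact_mod_cast this
  have hE : β ∈ Eset ℓ x₀ := by
    refine ⟨by linarith, ?_⟩
    rw [frequently_atTop]
    intro j
    obtain ⟨N, hN, _, _, _, hc⟩ := hF j (p j)
    refine ⟨N, hN, hc β ?_⟩
    have := hmem (j+1)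
    rw [hpS] at this
    exact this
  obtain ⟨i, hi⟩ := mem_iUnion.1 (hcov hE)
  have hsmall : ∀ j : ℕ, r i ^ s ≤ (Q:ℝ) ^ (-((j:ℝ) * (s / t))) := by
    intro j
    have h1 := (le_pot (c := fun i => ENNReal.ofReal (r i ^ s)) (U := U)
      ⟨β, hi, hmem (j+1)⟩).trans (p (j+1)).2.2
    rw [ENNReal.ofReal_le_ofReal_iff (by positivity)] at h1
    refine h1.trans ((div_le_self (by positivity) (by linarith)).trans ?_)
    apply Real.rpow_le_rpow_of_exponent_le (by linarith)
    obtain ⟨N, hN, hN', _, _, _⟩ := hF j (p j)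
    have : (j:ℝ) ≤ (p (j+1)).1.1 := by
      rw [hpS]; exact_mod_cast (le_trans hN hN')
    have := mul_le_mul_of_nonneg_right this hθ0.le
    linarith
  have hlim : Tendsto (fun j : ℕ => (Q:ℝ) ^ (-((j:ℝ) * (s / t)))) atTop (nhds 0) := by
    have e : (fun j : ℕ => (Q:ℝ) ^ (-((j:ℝ) * (s / t)))) =
        fun j : ℕ => ((Q:ℝ) ^ (-(s/t))) ^ j := by
      funext j
      rw [← Real.rpow_natCast, ← Real.rpow_mul hQ0.le]
      congr 1; ring
    rw [e]
    apply tendsto_pow_atTop_nhds_zero_of_lt_one (by positivity)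
    exact Real.rpow_lt_one_of_one_lt_of_neg (by linarith) (by linarith)
  have := ge_of_tendsto' hlim hsmall
  have := Real.rpow_pos_of_pos (hr i) s
  linarith

lemma exists_base {s κ : ℝ} (hs : 0 < s) (hκ : 0 ≤ κ) (h : s * (1 + κ) < 1) :
    ∃ Q : ℕ, 2 ≤ Q ∧ ∃ t : ℝ, s < t ∧ (((3 * Q : ℕ):ℝ) + 1) ^ t = Q ∧
      (s / t) * (1 + κ / t) < 1 := by
  have hlog : Tendsto (fun Q : ℕ => Real.log Q / Real.log (((3 * Q : ℕ):ℝ) + 1)) atTop (nhds 1) := by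
    have hl : Tendsto (fun Q : ℕ => Real.log (Q:ℝ)) atTop atTop :=
      Real.tendsto_log_atTop.comp tendsto_natCast_atTop_atTop
    have hlow : Tendsto (fun Q : ℕ => Real.log Q / (Real.log 4 + Real.log Q)) atTop (nhds 1) := by
      have h1 : Tendsto (fun Q : ℕ => 1 - Real.log 4 / (Real.log 4 + Real.log (Q:ℝ))) atTop
          (nhds (1 - 0)) := by
        apply Tendsto.sub tendsto_const_nhds
        apply Tendsto.div_atTop tendsto_const_nhds
        exact tendsto_atTop_add_const_left _ _ hl
      rw [sub_zero] at h1
      refine h1.congr' ?_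
      filter_upwards [eventually_ge_atTop 2] with Q hQ
      have : 0 ≤ Real.log Q := Real.log_natCast_nonneg Q
      have : 0 < Real.log 4 := Real.log_pos (by norm_num)
      field_simp
      ring
    refine tendsto_of_tendsto_of_tendsto_of_le_of_le' hlow tendsto_const_nhds ?_ ?_
    · filter_upwards [eventually_ge_atTop 2] with Q hQ
      have hQR : (2:ℝ) ≤ Q := by exact_mod_cast hQ
      push_cast
      have h1 : Real.log (3 * Q + 1) ≤ Real.log 4 + Real.log Q := by
        rw [← Real.log_mul (by norm_num) (by linarith)]
        exact Real.log_le_log (by linarith) (by linarith)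
      have h2 : 0 < Real.log (3 * Q + 1) := Real.log_pos (by linarith)
      exact div_le_div_of_nonneg_left (Real.log_natCast_nonneg Q) h2 h1
    · filter_upwards [eventually_ge_atTop 2] with Q hQ
      have hQR : (2:ℝ) ≤ Q := by exact_mod_cast hQ
      push_cast
      have h2 : 0 < Real.log (3 * Q + 1) := Real.log_pos (by linarith)
      rw [div_le_one h2]
      exact Real.log_le_log (by linarith) (by linarith)
  have hcont : Tendsto (fun t : ℝ => (s / t) * (1 + κ / t)) (nhds 1) (nhds (s / 1 * (1 + κ / 1))) := by
    have : ContinuousAt (fun t : ℝ => (s / t) * (1 + κ / t)) 1 := by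
      fun_prop (disch := norm_num)
    exact this
  have hs1 : s < 1 := by nlinarith
  have e1 := hlog.eventually (hcont.eventually_lt_const (by simpa using h))
  have e2 := hlog.eventually (lt_mem_nhds hs1)
  obtain ⟨Q, ⟨h1, h2⟩, h3⟩ := ((e1.and e2).and (eventually_ge_atTop 2)).exists
  refine ⟨Q, h3, _, h2, ?_, h1⟩
  have hQR : (2:ℝ) ≤ Q := by exact_mod_cast h3
  have hlp : 0 < Real.log (((3 * Q : ℕ):ℝ) + 1) := Real.log_pos (by push_cast; linarith)
  rw [Real.rpow_def_of_pos (by positivity), mul_div_cancel₀ _ hlp.ne', Real.exp_log (by linarith)]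


lemma lower_bound {s : NNReal} {κ : ℝ} (hs : 0 < s) (hκ : 0 ≤ κ) (h : (s:ℝ) * (1 + κ) < 1)
    {x₀ : ℝ} (hx₀ : x₀ ∈ Icc (0:ℝ) 1) {ℓ : ℕ → ℕ} (hfr : ∃ᶠ n : ℕ in atTop, (ℓ n : ℝ) ≤ κ * n) :
    (s : ℝ≥0∞) ≤ dimH (Eset ℓ x₀) := by
  apply le_dimH_of_hausdorffMeasure_ne_zero
  intro h0
  have hsR : (0:ℝ) < s := by exact_mod_cast hs
  obtain ⟨Q, hQ, t, hst, ht, hκs⟩ := exists_base hsR hκ h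
  have hQR : (2:ℝ) ≤ Q := by exact_mod_cast hQ
  have hQ0 : (0:ℝ) < Q := by linarith
  set η := (Q:ℝ) ^ (-((s:ℝ) / t)) / (4 * Q) with hη
  have hη0 : 0 < η := by positivity
  have hη2 : (0:ℝ≥0∞) < ENNReal.ofReal (η/2) := by simpa using hη0
  rw [Measure.hausdorffMeasure_apply] at h0
  have h1 := le_antisymm ((le_iSup₂ (f := fun (r : ℝ≥0∞) (_ : 0 < r) =>
    ⨅ (t : ℕ → Set ℝ) (_ : Eset ℓ x₀ ⊆ ⋃ n, t n) (_ : ∀ n, Metric.ediam (t n) ≤ r),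
        ∑' n, ⨆ _ : (t n).Nonempty, Metric.ediam (t n) ^ (s:ℝ)) 1 one_pos).trans h0.le) bot_le
  have h2 := h1.trans_lt hη2
  simp only [iInf_lt_iff] at h2
  obtain ⟨U, hcov, hd, hlt⟩ := h2
  obtain ⟨e, he0, hesum⟩ := ENNReal.exists_pos_sum_of_countable hη2.ne' ℕ
  have hdt : ∀ i, Metric.ediam (U i) ≠ ⊤ := fun i => ne_top_of_le_ne_top ENNReal.one_ne_top (hd i)
  set d : ℕ → ℝ := fun i => (Metric.ediam (U i)).toReal with hdd
  have hd0 : ∀ i, 0 ≤ d i := fun i => ENNReal.toReal_nonneg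
  have heR : ∀ i, (0:ℝ) < e i := fun i => by exact_mod_cast he0 i
  have hx : ∀ i, 0 < d i ^ (s:ℝ) + e i := fun i => by
    have := Real.rpow_nonneg (hd0 i) (s:ℝ); have := heR i; linarith
  set r : ℕ → ℝ := fun i => (d i ^ (s:ℝ) + e i) ^ ((s:ℝ)⁻¹) with hr
  have hrs : ∀ i, r i ^ (s:ℝ) = d i ^ (s:ℝ) + e i := fun i => by
    simp only [hr]
    exact Real.rpow_inv_rpow (hx i).le hsR.ne'
  refine exists_uncovered (M := 3 * Q) rfl hQ (U := U) (r := r) ?_ ?_ hsR hst ht hκ hκs hx₀ hfr ?_ hcov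
  · intro i; exact Real.rpow_pos_of_pos (hx i) _
  · intro i x hxU y hyU
    have a1 : d i ≤ r i := by
      rw [← Real.rpow_le_rpow_iff (hd0 i) (Real.rpow_nonneg (hx i).le _) hsR, hrs]
      have := heR i; linarith
    have a2 : edist y x ≤ Metric.ediam (U i) := Metric.edist_le_ediam_of_mem hyU hxU
    have a3 := ENNReal.toReal_mono (hdt i) a2
    rw [← dist_edist, Real.dist_eq] at a3
    have := le_abs_self (y - x)
    linarith
  · calc ∑' i, ENNReal.ofReal (r i ^ (s:ℝ))
        ≤ ∑' i, ((⨆ _ : (U i).Nonempty, Metric.ediam (U i) ^ (s:ℝ)) + (e i : ℝ≥0∞)) := by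
          apply ENNReal.tsum_le_tsum
          intro i
          rw [hrs, ENNReal.ofReal_add (Real.rpow_nonneg (hd0 i) _) (heR i).le,
            ENNReal.ofReal_coe_nnreal]
          gcongr
          rcases (U i).eq_empty_or_nonempty with hem | hne
          · simp [hdd, hem, Real.zero_rpow hsR.ne']
          · rw [ciSup_pos hne, ← ENNReal.ofReal_rpow_of_nonneg (hd0 i) hsR.le,
              ENNReal.ofReal_toReal (hdt i)]
      _ = (∑' i, ⨆ _ : (U i).Nonempty, Metric.ediam (U i) ^ (s:ℝ)) + ∑' i, (e i : ℝ≥0∞) :=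
          ENNReal.tsum_add
      _ ≤ ENNReal.ofReal (η/2) + ENNReal.ofReal (η/2) := add_le_add hlt.le hesum.le
      _ = ENNReal.ofReal η := by
        rw [← ENNReal.ofReal_add (by positivity) (by positivity)]; congr 1; ring

lemma main_dim (x₀ : ℝ) (hx₀ : x₀ ∈ Icc (0:ℝ) 1) (ℓ : ℕ → ℕ) :
    dimH (Eset ℓ x₀) =
      1 / (1 + liminf (fun n : ℕ => (ℓ n : ℝ≥0∞) / (n : ℝ≥0∞)) atTop) := by
  set α := liminf (fun n : ℕ => (ℓ n : ℝ≥0∞) / (n : ℝ≥0∞)) atTop with hα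
  apply le_antisymm
  · apply le_of_forall_gt
    intro a ha
    obtain ⟨s, hs1, hs2⟩ := ENNReal.lt_iff_exists_nnreal_btwn.1 ha
    refine lt_of_le_of_lt ?_ hs2
    have hs0 : 0 < s := by
      have : (0:ℝ≥0∞) < s := bot_le.trans_lt hs1
      exact_mod_cast this
    have hsR : (0:ℝ) < s := by exact_mod_cast hs0
    have hinv : (s:ℝ≥0∞)⁻¹ < 1 + α := by
      rw [one_div] at hs1
      exact ENNReal.inv_lt_iff_inv_lt.1 hs1
    rcases lt_or_ge 1 (s:ℝ) with hgt | hle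
    · exact upper_bound x₀ ℓ le_rfl hs0 (by simpa using hgt) (by simp)
    · obtain ⟨κ, hκ1, hκ2⟩ : ∃ κ : NNReal, (s:ℝ≥0∞)⁻¹ < 1 + κ ∧ (κ:ℝ≥0∞) < α := by
        have h1 : (s:ℝ≥0∞)⁻¹ - 1 < α := by
          apply ENNReal.sub_lt_of_lt_add _ (by rwa [add_comm])
          rw [ENNReal.one_le_inv]
          exact_mod_cast hle
        obtain ⟨κ, h2, h3⟩ := ENNReal.lt_iff_exists_nnreal_btwn.1 h1
        exact ⟨κ, lt_of_not_ge fun hc => absurd (ENNReal.le_sub_of_add_le_left ENNReal.one_ne_top hc) (not_le.2 h2), h3⟩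
      apply upper_bound x₀ ℓ (κ := κ) κ.2 hs0
      · rw [← ENNReal.coe_inv hs0.ne'] at hκ1
        have h2 : s⁻¹ < 1 + κ := by exact_mod_cast hκ1
        have h3 : (s:ℝ)⁻¹ < 1 + κ := by exact_mod_cast h2
        rwa [inv_lt_iff_one_lt_mul₀ hsR] at h3
      · filter_upwards [eventually_lt_of_lt_liminf hκ2, eventually_gt_atTop 0] with n hn hn0
        have h4 := hn.le
        rw [ENNReal.le_div_iff_mul_le (by left; exact_mod_cast hn0.ne') (by left; simp)] at h4
        have h5 : κ * (n : NNReal) ≤ (ℓ n : NNReal) := by exact_mod_cast h4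
        exact_mod_cast h5
  · apply le_of_forall_lt
    intro a ha
    obtain ⟨s, hs1, hs2⟩ := ENNReal.lt_iff_exists_nnreal_btwn.1 ha
    refine lt_of_lt_of_le hs1 ?_
    have hs0 : 0 < s := by
      have : (0:ℝ≥0∞) < s := bot_le.trans_lt hs1
      exact_mod_cast this
    have hsR : (0:ℝ) < s := by exact_mod_cast hs0
    have hinv : 1 + α < (s:ℝ≥0∞)⁻¹ := by
      rw [one_div] at hs2
      exact ENNReal.lt_inv_iff_lt_inv.1 hs2
    obtain ⟨κ, hκ1, hκ2⟩ := ENNReal.lt_iff_exists_nnreal_btwn.1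
      (lt_tsub_iff_left.2 hinv)
    have hκ3 : 1 + (κ:ℝ≥0∞) < (s:ℝ≥0∞)⁻¹ := lt_tsub_iff_left.1 hκ2
    apply lower_bound hs0 κ.2 _ hx₀
    · have hfr := frequently_lt_of_liminf_lt (by isBoundedDefault) hκ1
      refine (hfr.and_eventually (eventually_gt_atTop 0)).mono ?_
      rintro n ⟨hn, hn0⟩
      have h4 := hn.le
      rw [ENNReal.div_le_iff (by exact_mod_cast hn0.ne') (by simp)] at h4
      have h5 : (ℓ n : NNReal) ≤ κ * (n : NNReal) := by exact_mod_cast h4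
      exact_mod_cast h5
    · rw [← ENNReal.coe_inv hs0.ne'] at hκ3
      have h2 : 1 + κ < s⁻¹ := by exact_mod_cast hκ3
      have h3 : 1 + (κ:ℝ) < (s:ℝ)⁻¹ := by exact_mod_cast h2
      have := mul_lt_mul_of_pos_left h3 hsR
      rwa [mul_inv_cancel₀ hsR.ne'] at this


/-- Theorem 1.1. For `x₀ ∈ [0,1]` and positive integers `ℓ_n → ∞`,
the set of `β > 1` with `|T_β^n 1 - x₀| < β^{-ℓ_n}` infinitely often has Hausdorff
dimension `1/(1+α)` where `α = liminf ℓ_n/n` (in `[0,∞]`). -/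
theorem dimH_shrinking_target (x₀ : ℝ) (hx₀ : x₀ ∈ Icc (0:ℝ) 1)
    (ℓ : ℕ → ℕ) (hℓpos : ∀ n, 0 < ℓ n) (hℓ : Tendsto ℓ atTop atTop) :
    dimH {β : ℝ | 1 < β ∧
        ∃ᶠ n in atTop, |(betaT β)^[n] 1 - x₀| < β ^ (-(ℓ n : ℤ))} =
      1 / (1 + liminf (fun n : ℕ => (ℓ n : ℝ≥0∞) / (n : ℝ≥0∞)) atTop) := by
  exact main_dim x₀ hx₀ ℓ
end

section
/- Let x : (1,∞) → [0,1] be a Lipschitz continuous function and let (ℓ_n)_{n≥1} be a sequence of positive integers with ℓ_n → ∞ as n → ∞. Set α = liminf_{n→∞} ℓ_n/n (a value in [0,∞]). Then the Hausdorff dimension of the set Ẽ({ℓ_n}, x) = {β > 1 : |T_β^n 1 − x(β)| < β^{−ℓ_n} for infinitely many n ∈ ℕ} equals 1/(1+α), interpreted as 0 when α = ∞. -/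
open Filter MeasureTheory Set
open scoped ENNReal

/-! ### Basic facts on the orbit of 1 -/

/-- `ff n β = T_β^n 1`. -/
noncomputable def ff (n : ℕ) (β : ℝ) : ℝ := (betaT β)^[n] 1

/-- Integer digits. -/
noncomputable def dg (β : ℝ) (k : ℕ) : ℤ := ⌊β * ff k β⌋

/-- Branch polynomials. -/
noncomputable def PP (w : ℕ → ℤ) : ℕ → ℝ → ℝ
  | 0, _ => 1
  | (k+1), β => β * PP w k β - (w k : ℝ)

lemma ff_zero (β : ℝ) : ff 0 β = 1 := rfl

lemma ff_succ (n : ℕ) (β : ℝ) : ff (n+1) β = β * ff n β - (dg β n : ℝ) := by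
  unfold ff dg
  rw [Function.iterate_succ_apply']
  rfl

lemma ff_succ_fract (n : ℕ) (β : ℝ) : ff (n+1) β = Int.fract (β * ff n β) := by
  rw [ff_succ]; rfl

lemma ff_nonneg (n : ℕ) (β : ℝ) : 0 ≤ ff n β := by
  cases n with
  | zero => rw [ff_zero]; norm_num
  | succ n => rw [ff_succ_fract]; exact Int.fract_nonneg _

lemma ff_succ_lt_one (n : ℕ) (β : ℝ) : ff (n+1) β < 1 := by
  rw [ff_succ_fract]; exact Int.fract_lt_one _

lemma ff_le_one (n : ℕ) (β : ℝ) : ff n β ≤ 1 := by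
  cases n with
  | zero => rw [ff_zero]
  | succ n => exact (ff_succ_lt_one n β).le

lemma ff_persist {k n : ℕ} {β : ℝ} (h : ff k β = 0) (hkn : k ≤ n) : ff n β = 0 := by
  induction n, hkn using Nat.le_induction with
  | base => exact h
  | succ n _ ih => rw [ff_succ_fract, ih]; simp

lemma PP_dg (n : ℕ) (β : ℝ) : PP (dg β) n β = ff n β := by
  induction n with
  | zero => rfl
  | succ n ih => rw [ff_succ, PP, ih]

lemma PP_cont (w : ℕ → ℤ) (n : ℕ) : Continuous (PP w n) := by
  induction n with
  | zero => exact continuous_const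
  | succ n ih =>
    have : PP w (n+1) = fun β => β * PP w n β - (w n : ℝ) := rfl
    rw [this]; fun_prop

lemma PP_lower {w : ℕ → ℤ} {β β' : ℝ} (hβ : 1 < β) (hlt : β ≤ β') (k : ℕ)
    (h : ∀ j ≤ k, 0 ≤ PP w j β) :
    (β' - β) * β' ^ k ≤ PP w (k+1) β' - PP w (k+1) β := by
  induction k with
  | zero => simp [PP]
  | succ k ih =>
    have h1 := ih (fun j hj => h j (by omega))
    have h2 := h (k+1) le_rfl
    have e : PP w (k+1+1) β' - PP w (k+1+1) β
        = β' * (PP w (k+1) β' - PP w (k+1) β) + (β' - β) * PP w (k+1) β := by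
      simp only [PP]; ring
    rw [e, pow_succ]
    have h3 : 0 ≤ (β' - β) * PP w (k+1) β := mul_nonneg (by linarith) h2
    have h4 : β' * ((β' - β) * β' ^ k) ≤ β' * (PP w (k+1) β' - PP w (k+1) β) :=
      mul_le_mul_of_nonneg_left h1 (by linarith)
    nlinarith

lemma PP_mono {w : ℕ → ℤ} {β β' : ℝ} (hβ : 1 < β) (hlt : β ≤ β') (k : ℕ)
    (h : ∀ j < k, 0 ≤ PP w j β) : PP w k β ≤ PP w k β' := by
  cases k with
  | zero => simp [PP]
  | succ k =>
    have h1 := PP_lower hβ hlt k (fun j hj => h j (by omega))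
    have : 0 ≤ (β' - β) * β' ^ k := mul_nonneg (by linarith) (pow_nonneg (by linarith) _)
    linarith

lemma PP_upper' {w : ℕ → ℤ} {β β' : ℝ} (hβ : 1 < β) (hlt : β ≤ β') (k : ℕ)
    (h : ∀ j < k, PP w j β ≤ 1) :
    PP w k β' - PP w k β ≤ (β' - β) * ((β' ^ k - 1) / (β' - 1)) := by
  induction k with
  | zero => simp [PP]
  | succ k ih =>
    have h1 := ih (fun j hj => h j (by omega))
    have h2 := h k (by omega)
    have e : PP w (k+1) β' - PP w (k+1) β
        = β' * (PP w k β' - PP w k β) + (β' - β) * PP w k β := by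
      simp only [PP]; ring
    have hne : β' - 1 ≠ 0 := by linarith
    have e2 : (β' - β) * ((β' ^ (k+1) - 1) / (β' - 1))
       = β' * ((β' - β) * ((β' ^ k - 1) / (β' - 1))) + (β' - β) * 1 := by
      field_simp; ring
    rw [e, e2]
    have h3 : (β' - β) * PP w k β ≤ (β' - β) * 1 := mul_le_mul_of_nonneg_left h2 (by linarith)
    have h4 := mul_le_mul_of_nonneg_left h1 (show (0:ℝ) ≤ β' by linarith)
    linarith

lemma PP_upper {w : ℕ → ℤ} {β β' : ℝ} (hβ : 1 < β) (hlt : β ≤ β') (k : ℕ)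
    (h : ∀ j < k, PP w j β ≤ 1) :
    PP w k β' - PP w k β ≤ (β' - β) * (β' ^ k / (β' - 1)) := by
  refine (PP_upper' hβ hlt k h).trans (mul_le_mul_of_nonneg_left ?_ (by linarith))
  apply div_le_div_of_nonneg_right _ (by linarith)
  linarith

/-- On a segment without zeros of `ff n`, the orbit is polynomial. -/
lemma seg {n : ℕ} {u u' : ℝ} (hu : 1 < u) (hz : ∀ y ∈ Ioc u u', ff n y ≠ 0) :
    ∀ k ≤ n, ∀ y ∈ Icc u u', ff k y = PP (dg u) k y := by
  intro k
  induction k with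
  | zero => intro _ y _; rfl
  | succ k ih =>
    intro hk y hy
    have ihk := ih (by omega)
    rcases eq_or_lt_of_le hy.1 with h | h
    · rw [← h, PP_dg]
    have hge : u * PP (dg u) k u ≤ y * PP (dg u) k y := by
      have h1 : PP (dg u) k u ≤ PP (dg u) k y := by
        apply PP_mono hu hy.1
        intro j _; rw [PP_dg]; exact ff_nonneg _ _
      have h0 : 0 ≤ PP (dg u) k u := by rw [PP_dg]; exact ff_nonneg _ _
      exact mul_le_mul hy.1 h1 h0 (by linarith)
    have hfl : dg y k = dg u k := by
      have e1 : dg y k = ⌊y * PP (dg u) k y⌋ := by rw [dg, ihk y hy]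
      rw [e1, Int.floor_eq_iff]
      have e2 : (dg u k : ℝ) ≤ u * ff k u ∧ u * ff k u < dg u k + 1 :=
        ⟨Int.floor_le _, Int.lt_floor_add_one _⟩
      rw [← PP_dg k u] at e2
      refine ⟨e2.1.trans hge, ?_⟩
      by_contra hcon
      push Not at hcon
      have hc : ContinuousOn (fun t => t * PP (dg u) k t) (Icc u y) :=
        (continuous_id.mul (PP_cont _ _)).continuousOn
      obtain ⟨t, ht, hte⟩ := intermediate_value_Icc hy.1 hc
        (show ((dg u k : ℝ) + 1) ∈ Icc _ _ from ⟨e2.2.le, hcon⟩)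
      have htu : u < t := by
        rcases eq_or_lt_of_le ht.1 with h' | h'
        · exfalso; rw [← h'] at hte; simp only at hte; linarith [e2.2]
        · exact h'
      apply hz t ⟨htu, ht.2.trans hy.2⟩
      apply ff_persist _ hk
      rw [ff_succ_fract, ihk t ⟨ht.1, ht.2.trans hy.2⟩]
      simp only at hte
      rw [hte]
      have : ((dg u k : ℝ) + 1) = ((dg u k + 1 : ℤ) : ℝ) := by push_cast; ring
      rw [this, Int.fract_intCast]
    rw [ff_succ, hfl, PP, ihk y hy]

/-- Zero points of exact order `k`. -/
def IsZ (k : ℕ) (u : ℝ) : Prop := ff k u = 0 ∧ ∀ j < k, ff j u ≠ 0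

lemma IsZ.pos {k : ℕ} {u : ℝ} (h : IsZ k u) : 1 ≤ k := by
  rcases Nat.eq_zero_or_pos k with rfl | hk
  · have := h.1; rw [ff_zero] at this; norm_num at this
  · exact hk

lemma exists_isZ {n : ℕ} {u : ℝ} (h : ff n u = 0) : ∃ k, 1 ≤ k ∧ k ≤ n ∧ IsZ k u := by
  classical
  have hex : ∃ k, ff k u = 0 := ⟨n, h⟩
  have hz : IsZ (Nat.find hex) u := ⟨Nat.find_spec hex, fun j hj => Nat.find_min hex hj⟩
  exact ⟨Nat.find hex, hz.pos, Nat.find_min' hex h, hz⟩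

lemma sep {k : ℕ} {u y : ℝ} (hu : 1 < u) (hz : IsZ k u) (hy1 : 1 < y) (hyu : y < u)
    (hy : u - (u - 1) / u ^ k < y) : ff k y ≠ 0 := by
  obtain ⟨k, rfl⟩ : ∃ m, k = m + 1 := ⟨k - 1, by have := hz.pos; omega⟩
  have hu0 : 0 < u := by linarith
  -- lower bounds for the orbit of u
  have hlow : ∀ i ≤ k, (1:ℝ) / u ^ (i+1) ≤ ff (k - i) u := by
    intro i
    induction i with
    | zero =>
      intro _
      have h1 := ff_succ k u
      rw [hz.1] at h1
      have h2 : 0 < ff k u := lt_of_le_of_ne (ff_nonneg _ _) (Ne.symm (hz.2 k (by omega)))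
      have h3 : (0:ℝ) < dg u k := by nlinarith
      have h4 : (1:ℝ) ≤ dg u k := by exact_mod_cast h3
      simp only [zero_add, pow_one, Nat.sub_zero]
      rw [div_le_iff₀ hu0]; linarith
    | succ i ih =>
      intro hi
      have h1 := ih (by omega)
      have h2 := ff_succ (k - (i+1)) u
      rw [show k - (i+1) + 1 = k - i by omega] at h2
      have h3 : (0:ℝ) ≤ dg u (k - (i+1)) := by
        have : 0 ≤ dg u (k - (i+1)) := Int.floor_nonneg.2 (mul_nonneg hu0.le (ff_nonneg _ _))
        exact_mod_cast this
      rw [pow_succ, ← div_div, div_le_iff₀ hu0]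
      linarith
  have hd : (u - y) * (u ^ (k+1) / (u - 1)) < 1 := by
    have h1 : u - y < (u - 1) / u ^ (k+1) := by linarith
    have h2 : 0 < u ^ (k+1) / (u - 1) := div_pos (pow_pos hu0 _) (by linarith)
    calc _ < (u - 1) / u ^ (k+1) * (u ^ (k+1) / (u - 1)) := mul_lt_mul_of_pos_right h1 h2
      _ = 1 := by
        have : u - 1 ≠ 0 := by linarith
        field_simp
  have hP : ∀ j ≤ k, 0 ≤ PP (dg u) j y ∧ PP (dg u) j y ≤ 1 ∧ ff j y = PP (dg u) j y := by
    intro j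
    induction j using Nat.strong_induction_on with
    | _ j ih =>
      intro hj
      have hnn : 0 ≤ PP (dg u) j y := by
        have h1 := PP_upper hy1 hyu.le j (fun i hi => (ih i hi (by omega)).2.1)
        have h2 := hlow (k - j) (by omega)
        rw [show k - (k - j) = j by omega, ← PP_dg] at h2
        have h3 : (u - y) * (u ^ j / (u - 1)) ≤ 1 / u ^ (k - j + 1) := by
          rw [le_div_iff₀ (pow_pos hu0 _)]
          have : (u - y) * (u ^ j / (u - 1)) * u ^ (k - j + 1)
              = (u - y) * (u ^ (k+1) / (u - 1)) := by
            rw [show k + 1 = j + (k - j + 1) by omega, pow_add]; ring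
          linarith
        linarith
      have hle : PP (dg u) j y ≤ PP (dg u) j u :=
        PP_mono hy1 hyu.le j (fun i hi => (ih i hi (by omega)).1)
      refine ⟨hnn, ?_, ?_⟩
      · rw [PP_dg] at hle; exact hle.trans (ff_le_one _ _)
      · cases j with
        | zero => rfl
        | succ j =>
          have hff := (ih j (by omega) (by omega)).2.2
          have hlt : PP (dg u) (j+1) y < 1 := by
            rw [PP_dg] at hle; exact hle.trans_lt (ff_succ_lt_one _ _)
          rw [ff_succ_fract, hff]
          rw [PP] at hnn hlt ⊢
          rw [Int.fract_eq_iff]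
          exact ⟨hnn, hlt, dg u j, by ring⟩
  have h1 := PP_upper hy1 hyu.le (k+1) (fun i hi => (hP i (by omega)).2.1)
  have h2 := PP_lower hy1 hyu.le k (fun i hi => (hP i (by omega)).1)
  have h2' : 0 < (u - y) * u ^ k := mul_pos (by linarith) (pow_pos hu0 _)
  rw [PP_dg, hz.1] at h1 h2
  have h3 : PP (dg u) (k+1) y = y * PP (dg u) k y - dg u k := rfl
  have h4 : ff (k+1) y = PP (dg u) (k+1) y + 1 := by
    rw [ff_succ_fract, (hP k le_rfl).2.2, Int.fract_eq_iff]
    refine ⟨by linarith, by linarith, dg u k - 1, ?_⟩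
    push_cast; rw [h3]; ring
  rw [h4]
  intro h5
  linarith

/-! ### Counting zero points -/

lemma sum_disj (S : Finset ℝ) (p q : ℝ → ℝ) (A B : ℝ) (hAB : A ≤ B)
    (hpq : ∀ u ∈ S, p u ≤ q u)
    (h : ∀ u ∈ S, A ≤ p u ∧ q u ≤ B)
    (hd : (S : Set ℝ).PairwiseDisjoint (fun u => Ioo (p u) (q u))) :
    ∑ u ∈ S, (q u - p u) ≤ B - A := by
  have h1 : volume (⋃ u ∈ S, Ioo (p u) (q u)) = ∑ u ∈ S, volume (Ioo (p u) (q u)) :=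
    measure_biUnion_finset hd (fun _ _ => measurableSet_Ioo)
  have h2 : volume (⋃ u ∈ S, Ioo (p u) (q u)) ≤ volume (Icc A B) := by
    apply measure_mono
    apply iUnion₂_subset
    intro u hu y hy
    exact ⟨(h u hu).1.trans hy.1.le, hy.2.le.trans (h u hu).2⟩
  rw [h1, Real.volume_Icc] at h2
  simp only [Real.volume_Ioo] at h2
  rw [← ENNReal.ofReal_sum_of_nonneg (fun u hu => by linarith [hpq u hu])] at h2
  exact (ENNReal.ofReal_le_ofReal_iff (by linarith)).1 h2

lemma sumZ (k : ℕ) (S : Finset ℝ) {β0 a b : ℝ} (h0 : 1 < β0) (h0a : β0 ≤ a) (hab : a ≤ b)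
    (hS : ∀ u ∈ S, a ≤ u ∧ u ≤ b ∧ IsZ k u) :
    ∑ u ∈ S, (u - 1) / u ^ k ≤ b - a + b / β0 ^ k := by
  have hδ : ∀ u ∈ S, 0 ≤ (u - 1) / u ^ k ∧ (u - 1) / u ^ k ≤ b / β0 ^ k ∧
      (u-1) / u ^ k ≤ u - 1 := by
    intro u hu
    obtain ⟨h1, h2, _⟩ := hS u hu
    refine ⟨div_nonneg (by linarith) (pow_nonneg (by linarith) _), ?_, ?_⟩
    · apply div_le_div₀ (by linarith) (by linarith) (pow_pos (by linarith) _)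
      exact pow_le_pow_left₀ (by linarith) (by linarith) _
    · exact div_le_self (by linarith) (one_le_pow₀ (by linarith))
  have hb : 0 ≤ b / β0 ^ k := div_nonneg (by linarith) (pow_nonneg (by linarith) _)
  have key := sum_disj S (fun u => u - (u - 1) / u ^ k) (fun u => u) (a - b / β0 ^ k) b
    (by linarith) (fun u hu => by have := (hδ u hu).1; linarith)
    (fun u hu => by
      obtain ⟨h1, h2, _⟩ := hS u hu
      have := (hδ u hu).2.1; exact ⟨by linarith, h2⟩) ?_
  · simp only [sub_sub_cancel] at key
    linarith
  · have aux : ∀ u ∈ S, ∀ u' ∈ S, u < u' → 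
      Disjoint (Ioo (u - (u - 1) / u ^ k) u) (Ioo (u' - (u' - 1) / u' ^ k) u') := by
      intro u hu u' hu' hlt
      rw [Set.disjoint_left]
      intro y hy hy'
      obtain ⟨h1, h2, h3⟩ := hS u hu
      obtain ⟨h1', h2', h3'⟩ := hS u' hu'
      exact sep (by linarith) h3' (by linarith) hlt (hy'.1.trans hy.2) h3.1
    intro u hu u' hu' hne
    rcases lt_or_gt_of_ne hne with h | h
    · exact aux u hu u' hu' h
    · exact (aux u' hu' u hu h).symm

lemma cardZ (k : ℕ) (S : Finset ℝ) {a b : ℝ} (h0 : 1 < a) (hab : a ≤ b)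
    (hS : ∀ u ∈ S, a ≤ u ∧ u ≤ b ∧ IsZ k u) :
    (S.card : ℝ) ≤ 2 * b / (a - 1) * b ^ k := by
  have h1 := sumZ k S h0 le_rfl hab hS
  have h2 : (S.card : ℝ) * ((a - 1) / b ^ k) ≤ ∑ u ∈ S, (u - 1) / u ^ k := by
    rw [← nsmul_eq_mul]
    apply Finset.card_nsmul_le_sum
    intro u hu
    obtain ⟨h3, h4, _⟩ := hS u hu
    apply div_le_div₀ (by linarith) (by linarith) (pow_pos (by linarith) _)
    exact pow_le_pow_left₀ (by linarith) (by linarith) _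
  have h3 : b / a ^ k ≤ b := div_le_self (by linarith) (one_le_pow₀ (by linarith))
  have hbk : 0 < b ^ k := pow_pos (by linarith) _
  have h5 : (S.card : ℝ) * ((a - 1) / b ^ k) ≤ 2 * b := by linarith
  rw [← mul_div_assoc, div_le_iff₀ hbk] at h5
  rw [div_mul_eq_mul_div, le_div_iff₀ (by linarith)]
  linarith

lemma finZk (k : ℕ) {a b : ℝ} (h0 : 1 < a) (hab : a ≤ b) :
    {u : ℝ | u ∈ Icc a b ∧ IsZ k u}.Finite := by
  by_contra hinf
  obtain ⟨N, hN⟩ := exists_nat_gt (2 * b / (a - 1) * b ^ k)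
  obtain ⟨S, hS, hc⟩ := Set.Infinite.exists_subset_card_eq hinf N
  have := cardZ k S h0 hab (fun u hu => ⟨(hS hu).1.1, (hS hu).1.2, (hS hu).2⟩)
  rw [hc] at this
  linarith

lemma exZ (n : ℕ) {a b : ℝ} (h0 : 1 < a) (hab : a ≤ b) :
    ∃ Z : Finset ℝ, ∀ u, u ∈ Z ↔ u ∈ Icc a b ∧ ff n u = 0 := by
  have hf : {u : ℝ | u ∈ Icc a b ∧ ff n u = 0}.Finite := by
    apply Set.Finite.subset (Set.Finite.biUnion (Set.finite_Iic n)
      (fun k _ => finZk k h0 hab))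
    intro u hu
    obtain ⟨k, _, hk, hz⟩ := exists_isZ hu.2
    simp only [mem_iUnion]
    exact ⟨k, hk, hu.1, hz⟩
  exact ⟨hf.toFinset, fun u => by simp⟩

/-- pieces of monotonicity -/
def JJ (n : ℕ) (u b : ℝ) : Set ℝ := {y | u ≤ y ∧ y ≤ b ∧ ∀ t ∈ Ioc u y, ff n t ≠ 0}

lemma JJ_cover {n : ℕ} {a b : ℝ} {Z : Finset ℝ} (hZ : ∀ u, u ∈ Z ↔ u ∈ Icc a b ∧ ff n u = 0)
    {y : ℝ} (hy : y ∈ Icc a b) : ∃ u ∈ insert a Z, y ∈ JJ n u b := by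
  classical
  have hne : ((insert a Z).filter (fun u => u ≤ y)).Nonempty :=
    ⟨a, by simp [hy.1]⟩
  obtain ⟨u, hu, hmax⟩ := Finset.exists_max_image _ (fun u => u) hne
  simp only [Finset.mem_filter] at hu hmax
  refine ⟨u, hu.1, hu.2, hy.2, ?_⟩
  intro t ht h0
  have hau : a ≤ u := by
    rcases Finset.mem_insert.1 hu.1 with h | h
    · exact h.ge
    · exact ((hZ u).1 h).1.1
  have := hmax t ⟨Finset.mem_insert_of_mem ((hZ t).2
    ⟨⟨hau.trans ht.1.le, ht.2.trans hy.2⟩, h0⟩), ht.2⟩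
  linarith [ht.1]

lemma JJ_bound {n : ℕ} {u b y y' : ℝ} (hu : 1 < u) (hy : y ∈ JJ (n+1) u b)
    (hy' : y' ∈ JJ (n+1) u b) (hlt : y ≤ y') :
    (y' - y) * y' ^ n ≤ ff (n+1) y' - ff (n+1) y := by
  have hs := seg hu hy'.2.2
  have hyI : y ∈ Icc u y' := ⟨hy.1, hlt⟩
  rw [hs (n+1) le_rfl y' ⟨hy'.1, le_rfl⟩, hs (n+1) le_rfl y hyI]
  apply PP_lower (by linarith [hy.1]) hlt
  intro j hj
  rw [← hs j (by omega) y hyI]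
  exact ff_nonneg _ _

lemma sumBad (m : ℕ) (Z : Finset ℝ) {β0 β1 a b : ℝ} (h0 : 1 < β0) (h0a : β0 ≤ a) (hab : a ≤ b)
    (hb1 : b ≤ β1) (hZ : ∀ u, u ∈ Z ↔ u ∈ Icc a b ∧ ff (m+1) u = 0) :
    ∑ u ∈ Z, 1 / u ^ m ≤ β1 / (β0 - 1) *
      ((b - a) * (β0 / (β0 - 1)) + (m + 1) * (β1 / β0 ^ (m+1))) := by
  classical
  have hpos : ∀ u ∈ Z, 0 < u := fun u hu => by have := ((hZ u).1 hu).1.1; linarith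
  calc ∑ u ∈ Z, 1 / u ^ m
      ≤ ∑ u ∈ Z, ∑ i ∈ Finset.range (m+1), (if IsZ (m+1-i) u then 1 / u ^ m else 0) := by
        apply Finset.sum_le_sum
        intro u hu
        obtain ⟨k, hk1, hk2, hz⟩ := exists_isZ ((hZ u).1 hu).2
        have hp := hpos u hu
        have := Finset.single_le_sum
          (f := fun i => if IsZ (m+1-i) u then 1 / u ^ m else 0)
          (fun i _ => by split_ifs <;> positivity)
          (show m + 1 - k ∈ Finset.range (m+1) by simp; omega)
        simp only [show m + 1 - (m + 1 - k) = k by omega, hz, if_true] at this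
        exact this
    _ = ∑ i ∈ Finset.range (m+1), ∑ u ∈ Z with IsZ (m+1-i) u, 1 / u ^ m := by
        rw [Finset.sum_comm]
        simp only [Finset.sum_filter]
    _ ≤ ∑ i ∈ Finset.range (m+1), β1 / (β0 - 1) *
          ((b - a) * (1 / β0) ^ i + β1 / β0 ^ (m+1)) := by
        apply Finset.sum_le_sum
        intro i hi
        have hi' : i < m + 1 := Finset.mem_range.1 hi
        have hS := sumZ (m+1-i) (Z.filter (fun u => IsZ (m+1-i) u)) h0 h0a hab (by
          intro u hu
          rw [Finset.mem_filter] at hu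
          have := ((hZ u).1 hu.1).1
          exact ⟨this.1, this.2, hu.2⟩)
        have hc : 0 ≤ β1 / (β0 - 1) * (1 / β0 ^ i) := by
          apply mul_nonneg (div_nonneg (by linarith) (by linarith))
          positivity
        calc ∑ u ∈ Z with IsZ (m+1-i) u, 1 / u ^ m
            ≤ ∑ u ∈ Z with IsZ (m+1-i) u, β1 / (β0 - 1) * (1 / β0 ^ i) *
                ((u - 1) / u ^ (m+1-i)) := by
              apply Finset.sum_le_sum
              intro u hu
              rw [Finset.mem_filter] at hu
              have hI := ((hZ u).1 hu.1).1
              have hp := hpos u hu.1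
              have e : 1 / u ^ m = (u / (u - 1)) * (1 / u ^ i) * ((u - 1) / u ^ (m+1-i)) := by
                have hne : u - 1 ≠ 0 := by linarith [hI.1]
                have : u ^ (m+1) = u ^ i * u ^ (m+1-i) := by
                  rw [← pow_add]; congr 1; omega
                rw [pow_succ] at this
                field_simp
                linarith
              rw [e]
              have hI1 := hI.1
              have hI2 := hI.2
              gcongr
              · exact div_nonneg (by linarith) (pow_nonneg hp.le _)
              · exact div_nonneg (by linarith) (by linarith)
              · linarith
              · linarith
              · linarith
              · linarith
          _ ≤ β1 / (β0 - 1) * (1 / β0 ^ i) * (b - a + b / β0 ^ (m+1-i)) := by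
              rw [← Finset.mul_sum]
              exact mul_le_mul_of_nonneg_left hS hc
          _ ≤ β1 / (β0 - 1) * (1 / β0 ^ i) * (b - a + β1 / β0 ^ (m+1-i)) := by
              gcongr
          _ = _ := by
              have : β0 ^ (m+1) = β0 ^ i * β0 ^ (m+1-i) := by
                rw [← pow_add]; congr 1; omega
              rw [this]
              have hne : β0 - 1 ≠ 0 := by linarith
              rw [div_pow, one_pow]
              field_simp
    _ ≤ _ := by
        rw [← Finset.mul_sum, Finset.sum_add_distrib, ← Finset.mul_sum]
        simp only [Finset.sum_const, Finset.card_range, nsmul_eq_mul]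
        have hg : ∑ i ∈ Finset.range (m+1), (1 / β0) ^ i ≤ β0 / (β0 - 1) := by
          have hlt : 1 / β0 < 1 := by rw [div_lt_one (by linarith)]; exact h0
          have h1 := (summable_geometric_of_lt_one (by positivity) hlt).sum_le_tsum
            (Finset.range (m+1)) (fun i _ => by positivity)
          rw [tsum_geometric_of_lt_one (by positivity) hlt] at h1
          refine h1.trans (le_of_eq ?_)
          have hne : β0 - 1 ≠ 0 := by linarith
          field_simp
        push_cast
        have : 0 ≤ b - a := by linarith
        have : 0 ≤ β1 / (β0 - 1) := div_nonneg (by linarith) (by linarith)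
        gcongr

/-! ### Full pieces -/

lemma goodU {m q : ℕ} {u b y : ℝ} (hu : 1 < u) (hz : ff (m+1) u = 0)
    (hy : y ∈ JJ (m+1) u b) (h1 : 1 ≤ u ^ q * ff (m+1) y) :
    ∃ v, u < v ∧ v ∈ JJ (m+1) u b ∧ PP (dg u) (m+1+q) v = 1 ∧
      ∀ t ∈ Ico u v, ∀ j ≤ m+1+q, ff j t = PP (dg u) j t := by
  have hs := seg hu hy.2.2
  have hP : ∀ i t, PP (dg u) (m+1+i) t = t ^ i * PP (dg u) (m+1) t := by
    intro i t
    induction i with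
    | zero => simp
    | succ i ih =>
      have hd : dg u (m+1+i) = 0 := by
        rw [dg, ff_persist hz (by omega)]; simp
      rw [show m + 1 + (i+1) = (m+1+i) + 1 by omega, PP, ih, hd, pow_succ]
      push_cast; ring
  have hPu : PP (dg u) (m+1) u = 0 := by rw [PP_dg, hz]
  have hcont : ContinuousOn (PP (dg u) (m+1+q)) (Icc u y) := (PP_cont _ _).continuousOn
  have hyv : 1 ≤ PP (dg u) (m+1+q) y := by
    rw [hP, ← hs (m+1) le_rfl y ⟨hy.1, le_rfl⟩]
    refine h1.trans (mul_le_mul_of_nonneg_right ?_ (ff_nonneg _ _))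
    exact pow_le_pow_left₀ (by linarith) hy.1 _
  obtain ⟨v, hv, hve⟩ := intermediate_value_Icc hy.1 hcont
    (show (1:ℝ) ∈ Icc _ _ from ⟨by rw [hP, hPu]; simp, hyv⟩)
  have huv : u < v := by
    rcases eq_or_lt_of_le hv.1 with h | h
    · rw [← h, hP, hPu] at hve; simp at hve
    · exact h
  refine ⟨v, huv, ⟨hv.1, hv.2.trans hy.2.1, fun t ht => hy.2.2 t ⟨ht.1, ht.2.trans hv.2⟩⟩, hve, ?_⟩
  intro t ht
  have ht1 : 1 < t := by linarith [ht.1]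
  have htI : t ∈ Icc u y := ⟨ht.1, ht.2.le.trans hv.2⟩
  have htnn : 0 ≤ PP (dg u) (m+1) t := by
    rw [← hs (m+1) le_rfl t htI]; exact ff_nonneg _ _
  have hlt : t ^ q * PP (dg u) (m+1) t < 1 := by
    have hl := PP_lower (w := dg u) ht1 ht.2.le m (by
      intro j hj
      rw [← hs j (by omega) t htI]; exact ff_nonneg _ _)
    have hp : 0 < (v - t) * v ^ m := mul_pos (by linarith [ht.2]) (pow_pos (by linarith) _)
    have hq : t ^ q ≤ v ^ q := pow_le_pow_left₀ (by linarith) ht.2.le _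
    have hvq : 0 < v ^ q := pow_pos (by linarith) _
    rw [hP] at hve
    calc t ^ q * PP (dg u) (m+1) t ≤ v ^ q * PP (dg u) (m+1) t :=
          mul_le_mul_of_nonneg_right hq htnn
      _ < v ^ q * PP (dg u) (m+1) v := mul_lt_mul_of_pos_left (by linarith) hvq
      _ = 1 := hve
  have hext : ∀ i ≤ q, ff (m+1+i) t = PP (dg u) (m+1+i) t := by
    intro i
    induction i with
    | zero => intro _; exact hs (m+1) le_rfl t htI
    | succ i ih =>
      intro hi
      have := ih (by omega)
      rw [hP] at this ⊢
      rw [show m + 1 + (i+1) = (m+1+i) + 1 by omega, ff_succ_fract, this]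
      have e : t * (t ^ i * PP (dg u) (m+1) t) = t ^ (i+1) * PP (dg u) (m+1) t := by
        rw [pow_succ]; ring
      rw [e, Int.fract_eq_self]
      refine ⟨mul_nonneg (pow_nonneg (by linarith) _) htnn, lt_of_le_of_lt ?_ hlt⟩
      exact mul_le_mul_of_nonneg_right (pow_le_pow_right₀ ht1.le hi) htnn
  intro j hj
  rcases le_total j (m+1) with h | h
  · exact hs j h t htI
  · obtain ⟨i, rfl⟩ := Nat.exists_eq_add_of_le h
    exact hext i (by omega)

lemma fullFam {β0 β1 : ℝ} (h0 : 1 < β0) (h01 : β0 < β1) : ∃ c : ℝ, 0 < c ∧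
    ∀ a b : ℝ, β0 ≤ a → a < b → b ≤ β1 → ∃ N : ℕ, ∀ n ≥ N, ∃ Z : Finset ℝ, ∃ v : ℝ → ℝ,
      (∀ u ∈ Z, a ≤ u ∧ u < v u ∧ v u ≤ b ∧ ff n u = 0 ∧ PP (dg u) n (v u) = 1 ∧
        ∀ y ∈ Ico u (v u), ∀ j ≤ n, ff j y = PP (dg u) j y) ∧
      (Z : Set ℝ).PairwiseDisjoint (fun u => Ico u (v u)) ∧
      c * (b - a) ≤ ∑ u ∈ Z, (v u - u) := by
  classical
  have hb0 : 0 < β0 - 1 := by linarith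
  set D := β1 / (β0 - 1) with hD
  have hDpos : 0 < D := div_pos (by linarith) hb0
  set C := D * (β0 / (β0 - 1) + 1) with hC
  have hCpos : 0 < C := mul_pos hDpos (by have := div_pos (show 0 < β0 by linarith) hb0; linarith)
  set η := 1 / (4 * C) with hη
  have hηpos : 0 < η := by positivity
  obtain ⟨q, hq⟩ := pow_unbounded_of_one_lt (1 / η) h0
  set c0 := (β0 - 1) / β1 ^ (q+1) with hc0
  have hc0pos : 0 < c0 := div_pos hb0 (pow_pos (by linarith) _)
  refine ⟨c0 / 2, by positivity, ?_⟩
  intro a b ha hab hb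
  have hba : 0 < b - a := by linarith
  have t1 : Tendsto (fun m : ℕ => (1:ℝ) / β0 ^ m) atTop (nhds 0) := by
    have := tendsto_pow_atTop_nhds_zero_of_lt_one (r := 1 / β0) (by positivity)
      (by rw [div_lt_one (by linarith)]; exact h0)
    simpa [div_pow] using this
  have t2 : Tendsto (fun m : ℕ => ((m:ℝ) + 1) * (β1 / β0 ^ (m+1))) atTop (nhds 0) := by
    have h3 := tendsto_self_mul_const_pow_of_lt_one (r := 1 / β0) (by positivity)
      (by rw [div_lt_one (by linarith)]; exact h0)
    have h4 := ((tendsto_add_atTop_iff_nat 1).2 h3).const_mul β1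
    rw [mul_zero] at h4
    refine h4.congr (fun m => ?_)
    push_cast
    rw [div_pow, one_pow]; ring
  obtain ⟨M, hM⟩ := eventually_atTop.1 ((t1.eventually (ge_mem_nhds (show 0 < (b - a) / 4 by linarith))).and
    (t2.eventually (ge_mem_nhds hba)))
  refine ⟨M + 1 + q, ?_⟩
  intro n hn
  obtain ⟨m, rfl, hmM⟩ : ∃ m, n = m + 1 + q ∧ M ≤ m := ⟨n - 1 - q, by omega, by omega⟩
  obtain ⟨hm1, hm2⟩ := hM m hmM
  obtain ⟨Z, hZ⟩ := exZ (m+1) (show 1 < a by linarith) hab.le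
  set G : Finset ℝ := Z.filter (fun u => ∃ y ∈ JJ (m+1) u b, η ≤ ff (m+1) y) with hG
  have hex : ∀ u, ∃ v, u ∈ G → u < v ∧ v ∈ JJ (m+1) u b ∧ PP (dg u) (m+1+q) v = 1 ∧
      ∀ t ∈ Ico u v, ∀ j ≤ m+1+q, ff j t = PP (dg u) j t := by
    intro u
    by_cases hu : u ∈ G
    · obtain ⟨huZ, y, hy, hyη⟩ := Finset.mem_filter.1 hu
      have huI := (hZ u).1 huZ
      have hua := huI.1.1
      obtain ⟨v, hv⟩ := goodU (q := q) (by linarith) huI.2 hy (by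
        have hq' : 1 / η ≤ u ^ q := hq.le.trans (pow_le_pow_left₀ (by linarith) (by linarith) _)
        calc (1:ℝ) = 1 / η * η := by field_simp
          _ ≤ u ^ q * ff (m+1) y := mul_le_mul hq' hyη hηpos.le (pow_nonneg (by linarith) _))
      exact ⟨v, fun _ => hv⟩
    · exact ⟨0, fun h => absurd h hu⟩
  choose v hv using hex
  have hGI : ∀ u ∈ G, a ≤ u ∧ u ≤ b ∧ ff (m+1) u = 0 := fun u hu => by
    have := (hZ u).1 (Finset.mem_filter.1 hu).1
    exact ⟨this.1.1, this.1.2, this.2⟩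
  refine ⟨G, v, ?_, ?_, ?_⟩
  · intro u hu
    obtain ⟨h1, h2, h3, h4⟩ := hv u hu
    exact ⟨(hGI u hu).1, h1, h2.2.1, ff_persist (hGI u hu).2.2 (by omega), h3, h4⟩
  · have aux : ∀ u ∈ G, ∀ u' ∈ G, u < u' → Disjoint (Ico u (v u)) (Ico u' (v u')) := by
      intro u hu u' hu' hlt
      rw [Set.disjoint_left]
      intro y hy hy'
      exact (hv u hu).2.1.2.2 u' ⟨hlt, hy'.1.trans hy.2.le⟩ (hGI u' hu').2.2
    intro u hu u' hu' hne
    rcases lt_or_gt_of_ne hne with h | h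
    · exact aux u hu u' hu' h
    · exact (aux u' hu' u hu h).symm
  · -- measure estimate
    have hZI : ∀ u ∈ Z, a ≤ u ∧ u ≤ b ∧ ff (m+1) u = 0 := fun u hu => by
      have := (hZ u).1 hu
      exact ⟨this.1.1, this.1.2, this.2⟩
    have hself : ∀ u, u ≤ b → u ∈ JJ (m+1) u b := fun u hu => ⟨le_rfl, hu, fun t ht => by
      exact absurd ht.1 (not_lt.2 ht.2)⟩
    set e : ℝ → ℝ := fun u => if u ∈ G then (v u - u) / c0 else η * (1 / u ^ m) with he
    have hJe : ∀ u ∈ Z, JJ (m+1) u b ⊆ Icc u (u + e u) := by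
      intro u hu z hz
      obtain ⟨hua, hub, hu0⟩ := hZI u hu
      have hup : 1 < u := by linarith
      have hz1 := hz.1
      have hb1 := JJ_bound hup (hself u hub) hz hz1
      rw [hu0, sub_zero] at hb1
      refine ⟨hz.1, ?_⟩
      by_cases hg : u ∈ G
      · simp only [he, hg, if_true]
        obtain ⟨h1, h2, h3, h4⟩ := hv u hg
        have hvb := h2.2.1
        have hvp : 0 < v u := by linarith
        have hkey : z - u ≤ 1 / (v u) ^ m := by
          rw [le_div_iff₀ (pow_pos hvp _)]
          rcases le_total (v u) z with h | h
          · calc (z - u) * v u ^ m ≤ (z - u) * z ^ m := by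
                  gcongr
              _ ≤ 1 := hb1.trans (ff_le_one _ _)
          · have hb2 := JJ_bound hup (hself u hub) h2 h1.le
            rw [hu0, sub_zero] at hb2
            calc (z - u) * v u ^ m ≤ (v u - u) * v u ^ m := by gcongr
              _ ≤ 1 := hb2.trans (ff_le_one _ _)
        have hlen : c0 * (1 / (v u) ^ m) ≤ v u - u := by
          have hU := PP_upper (w := dg u) hup h1.le (m+1+q) (fun j _ => by
            rw [PP_dg]; exact ff_le_one _ _)
          rw [h3, PP_dg, ff_persist hu0 (by omega), sub_zero] at hU
          have hvq : v u ^ (m+1+q) = v u ^ m * v u ^ (q+1) := by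
            rw [← pow_add]; congr 1; omega
          have hU' : (v u - 1) ≤ (v u - u) * (v u ^ m * v u ^ (q+1)) := by
            rw [← mul_div_assoc, le_div_iff₀ (by linarith), hvq] at hU
            linarith
          have hle : v u ^ (q+1) ≤ β1 ^ (q+1) := pow_le_pow_left₀ hvp.le (by linarith) _
          rw [hc0, div_mul_div_comm, mul_one, div_le_iff₀ (mul_pos (pow_pos (by linarith) _) (pow_pos hvp _))]
          have hvm : 0 < v u ^ m := pow_pos hvp _
          calc β0 - 1 ≤ v u - 1 := by linarith
            _ ≤ _ := hU'
            _ ≤ (v u - u) * (v u ^ m * β1 ^ (q+1)) := by gcongr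
            _ = _ := by ring
        have : 1 / (v u) ^ m ≤ (v u - u) / c0 := by
          rw [le_div_iff₀ hc0pos]; linarith
        linarith
      · simp only [he, hg, if_false]
        have hlt : ff (m+1) z < η := by
          by_contra hcon
          exact hg (Finset.mem_filter.2 ⟨hu, z, hz, not_lt.1 hcon⟩)
        have hum : 0 < u ^ m := pow_pos (by linarith) _
        have : z - u ≤ η / u ^ m := by
          rw [le_div_iff₀ hum]
          calc (z - u) * u ^ m ≤ (z - u) * z ^ m := by gcongr
            _ ≤ η := by linarith
        rw [mul_one_div]; linarith
    have hJa : JJ (m+1) a b ⊆ Icc a (a + (b - a) / 4) := by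
      intro z hz
      have ha1 : 1 < a := by linarith
      have hz1 := hz.1
      have hb1 := JJ_bound ha1 (hself a hab.le) hz hz1
      have h3 := ff_le_one (m+1) z
      have h4 := ff_nonneg (m+1) a
      refine ⟨hz.1, ?_⟩
      have hum : 0 < β0 ^ m := pow_pos (by linarith) _
      have : z - a ≤ 1 / β0 ^ m := by
        rw [le_div_iff₀ hum]
        calc (z - a) * β0 ^ m ≤ (z - a) * z ^ m := by gcongr <;> linarith
          _ ≤ 1 := by linarith
      linarith
    have hepos : ∀ u ∈ Z, 0 ≤ e u := by
      intro u hu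
      have h5 := hJe u hu (hself u (hZI u hu).2.1)
      linarith [h5.2]
    have hcov : Icc a b ⊆ Icc a (a + (b - a) / 4) ∪ ⋃ u ∈ Z, Icc u (u + e u) := by
      intro y hy
      obtain ⟨u, hu, hyu⟩ := JJ_cover hZ hy
      rcases Finset.mem_insert.1 hu with h | h
      · left; subst h; exact hJa hyu
      · right; simp only [mem_iUnion]; exact ⟨u, h, hJe u h hyu⟩
    have hvol : b - a ≤ (b - a) / 4 + ∑ u ∈ Z, e u := by
      have h6 : volume (Icc a b) ≤ ENNReal.ofReal ((b - a) / 4) + ∑ u ∈ Z, ENNReal.ofReal (e u) := by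
        refine (measure_mono hcov).trans ((measure_union_le _ _).trans ?_)
        refine add_le_add (by rw [Real.volume_Icc]; simp) ?_
        refine (measure_biUnion_finset_le _ _).trans (le_of_eq ?_)
        apply Finset.sum_congr rfl
        intro u _
        rw [Real.volume_Icc]; simp
      have hs0 : 0 ≤ ∑ u ∈ Z, e u := Finset.sum_nonneg hepos
      rw [Real.volume_Icc, ← ENNReal.ofReal_sum_of_nonneg hepos,
        ← ENNReal.ofReal_add (by linarith) hs0] at h6
      exact (ENNReal.ofReal_le_ofReal_iff (by linarith)).1 h6
    have hsplit : ∑ u ∈ Z, e u ≤ (∑ u ∈ G, (v u - u)) / c0 + η * ∑ u ∈ Z, 1 / u ^ m := by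
      have h7 : ∑ u ∈ Z, e u ≤ ∑ u ∈ Z, ((if u ∈ G then (v u - u) / c0 else 0) + η * (1 / u ^ m)) := by
        apply Finset.sum_le_sum
        intro u hu
        have : 0 ≤ η * (1 / u ^ m) := by
          have := (hZI u hu).1
          have : 0 < u := by linarith
          positivity
        simp only [he]
        split_ifs
        · linarith
        · linarith
      refine h7.trans (le_of_eq ?_)
      rw [Finset.sum_add_distrib, ← Finset.mul_sum, Finset.sum_div, ← Finset.sum_filter]
      congr 2
      ext u
      simp [hG]
    have hbad := sumBad m Z h0 ha hab.le hb hZ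
    have hbad2 : η * ∑ u ∈ Z, 1 / u ^ m ≤ (b - a) / 4 := by
      have : ∑ u ∈ Z, 1 / u ^ m ≤ C * (b - a) := by
        refine hbad.trans ?_
        rw [← hD, hC, mul_assoc]
        apply mul_le_mul_of_nonneg_left _ hDpos.le
        linarith
      calc _ ≤ η * (C * (b - a)) := mul_le_mul_of_nonneg_left this hηpos.le
        _ = (b - a) / 4 := by rw [hη]; field_simp
    have hfin : (b - a) / 2 ≤ (∑ u ∈ G, (v u - u)) / c0 := by linarith
    rw [le_div_iff₀ hc0pos] at hfin
    linarith

/-! ### An abstract lower bound for the Hausdorff dimension of limsup sets -/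

lemma sum_ite_unique {Z : Finset ℝ} {v : ℝ → ℝ} (hd : (Z : Set ℝ).PairwiseDisjoint (fun u => Ico u (v u)))
    (x K : ℝ) (hK : 0 ≤ K) :
    (by classical exact ∑ u ∈ Z, (if x ∈ Ico u (v u) then K else 0)) ≤ K := by
  classical
  rw [← Finset.sum_filter, Finset.sum_const]
  have hc : (Z.filter (fun u => x ∈ Ico u (v u))).card ≤ 1 := by
    rw [Finset.card_le_one]
    intro u hu u' hu'
    rw [Finset.mem_filter] at hu hu'
    by_contra hne
    exact Set.disjoint_left.1 (hd hu.1 hu'.1 hne) hu.2 hu'.2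
  rw [nsmul_eq_mul]
  have : ((Z.filter (fun u => x ∈ Ico u (v u))).card : ℝ) ≤ 1 := by exact_mod_cast hc
  nlinarith

lemma perU {Z : Finset ℝ} {v p q : ℝ → ℝ} {a b s ε : ℝ} (hs : 0 < s) (hε : 0 < ε)
    (hZ : ∀ u ∈ Z, a ≤ u ∧ u ≤ p u ∧ p u < q u ∧ q u < v u ∧ v u ≤ b ∧
      v u - u ≤ ε * (q u - p u) ^ s)
    (hd : (Z : Set ℝ).PairwiseDisjoint (fun u => Ico u (v u))) (x y : ℝ) :
    ∑ u ∈ Z, (v u - u) * (volume.real (Ioo x y ∩ Icc (p u) (q u)) ^ s / (q u - p u) ^ s)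
      ≤ volume.real (Ioo x y ∩ Icc a b) + 2 * ε * volume.real (Ioo x y ∩ Icc a b) ^ s := by
  classical
  set V := volume.real (Ioo x y ∩ Icc a b) with hV
  have hVnn : 0 ≤ V := measureReal_nonneg
  have hfin : ∀ c d : ℝ, volume (Ioo x y ∩ Icc c d) ≠ ⊤ := fun c d =>
    ((measure_mono inter_subset_left).trans_lt measure_Ioo_lt_top).ne
  have hfin2 : ∀ c d : ℝ, volume (Ioo x y ∩ Ico c d) ≠ ⊤ := fun c d =>
    ((measure_mono inter_subset_left).trans_lt measure_Ioo_lt_top).ne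
  have hK : 0 ≤ ε * V ^ s := by positivity
  have hterm : ∀ u ∈ Z, (v u - u) * (volume.real (Ioo x y ∩ Icc (p u) (q u)) ^ s / (q u - p u) ^ s)
      ≤ volume.real (Ioo x y ∩ Ico u (v u)) + ((if x ∈ Ico u (v u) then ε * V ^ s else 0) +
        (if y ∈ Ico u (v u) then ε * V ^ s else 0)) := by
    intro u hu
    obtain ⟨h1, h2, h3, h4, h5, h6⟩ := hZ u hu
    have hq : 0 < q u - p u := by linarith
    have hqs : 0 < (q u - p u) ^ s := Real.rpow_pos_of_pos hq _
    have hvu : 0 < v u - u := by linarith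
    set W := volume.real (Ioo x y ∩ Icc (p u) (q u)) with hW
    have hWnn : 0 ≤ W := measureReal_nonneg
    have hWV : W ≤ V := by
      apply measureReal_mono _ (hfin a b)
      apply inter_subset_inter_right
      exact Icc_subset_Icc (by linarith) (by linarith)
    have hWq : W ≤ q u - p u := by
      have : W ≤ volume.real (Icc (p u) (q u)) :=
        measureReal_mono inter_subset_right (by simp)
      rwa [Real.volume_real_Icc_of_le h3.le] at this
    have hm0 : 0 ≤ volume.real (Ioo x y ∩ Ico u (v u)) := measureReal_nonneg
    have hi1 : 0 ≤ (if x ∈ Ico u (v u) then ε * V ^ s else 0) := by split_ifs <;> simp [hK]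
    have hi2 : 0 ≤ (if y ∈ Ico u (v u) then ε * V ^ s else 0) := by split_ifs <;> simp [hK]
    have hbd : (v u - u) * (W ^ s / (q u - p u) ^ s) ≤ ε * V ^ s := by
      calc (v u - u) * (W ^ s / (q u - p u) ^ s) 
          ≤ (ε * (q u - p u) ^ s) * (W ^ s / (q u - p u) ^ s) := by gcongr
        _ = ε * W ^ s := by field_simp
        _ ≤ ε * V ^ s := by gcongr
    by_cases hx : x ∈ Ico u (v u)
    · rw [if_pos hx] at hi1 ⊢; linarith
    by_cases hy : y ∈ Ico u (v u)
    · rw [if_pos hy] at hi2 ⊢; linarith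
    rw [if_neg hx, if_neg hy]
    by_cases hdis : ∃ t, t ∈ Ioo x y ∩ Ico u (v u)
    · obtain ⟨t, ht, ht'⟩ := hdis
      have hxu : x < u := by
        by_contra hcon
        exact hx ⟨not_lt.1 hcon, ht.1.trans ht'.2⟩
      have hyv : v u ≤ y := by
        by_contra hcon
        exact hy ⟨ht'.1.trans ht.2.le, not_le.1 hcon⟩
      have hsub : Ioo x y ∩ Ico u (v u) = Ico u (v u) := by
        apply inter_eq_right.2
        intro z hz
        exact ⟨hxu.trans_le hz.1, hz.2.trans_le hyv⟩
      rw [hsub, Real.volume_real_Ico_of_le (by linarith)]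
      have : W ^ s / (q u - p u) ^ s ≤ 1 := by
        rw [div_le_one hqs]
        exact Real.rpow_le_rpow hWnn hWq hs.le
      nlinarith
    · have hW0 : W = 0 := by
        have : Ioo x y ∩ Icc (p u) (q u) = ∅ := by
          apply eq_empty_of_forall_notMem
          intro t ht
          exact hdis ⟨t, ht.1, h2.trans ht.2.1, ht.2.2.trans_lt h4⟩
        rw [hW, this]; simp
      rw [hW0, Real.zero_rpow hs.ne']
      simp [hm0]
  refine (Finset.sum_le_sum hterm).trans ?_
  rw [Finset.sum_add_distrib, Finset.sum_add_distrib]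
  have e1 : ∑ u ∈ Z, volume.real (Ioo x y ∩ Ico u (v u)) ≤ V := by
    rw [← measureReal_biUnion_finset
      (fun u hu u' hu' hne => (hd hu hu' hne).mono inter_subset_right inter_subset_right)
      (fun u _ => measurableSet_Ioo.inter measurableSet_Ico) (fun u _ => hfin2 _ _)]
    apply measureReal_mono _ (hfin a b)
    apply iUnion₂_subset
    intro u hu
    obtain ⟨h1, h2, h3, h4, h5, h6⟩ := hZ u hu
    apply inter_subset_inter_right
    exact (Ico_subset_Icc_self).trans (Icc_subset_Icc h1 h5)
  have e2 := sum_ite_unique hd x _ hK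
  have e3 := sum_ite_unique hd y _ hK
  linarith

lemma exists_cover {Λ : Set ℝ} {s : ℝ} (hs : 0 < s) (hs1 : s < 1) (h : μH[s] Λ = 0) {η : ℝ}
    (hη : 0 < η) : ∃ x y : ℕ → ℝ, Λ ⊆ ⋃ i, Ioo (x i) (y i) ∧
      ∀ F : Finset ℕ, ∑ i ∈ F, volume.real (Ioo (x i) (y i)) ^ s ≤ η := by
  classical
  set η' : ℝ≥0∞ := ENNReal.ofReal (η / 4) with hη'
  have hη'pos : 0 < η' := ENNReal.ofReal_pos.2 (by linarith)
  rw [Measure.hausdorffMeasure_apply] at h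
  have h1 : (⨅ (t : ℕ → Set ℝ) (_ : Λ ⊆ ⋃ n, t n) (_ : ∀ n, Metric.ediam (t n) ≤ 1),
          ∑' n, ⨆ _ : (t n).Nonempty, Metric.ediam (t n) ^ s) < η' := by
    refine lt_of_le_of_lt ?_ hη'pos
    rw [← h]
    exact le_iSup₂ (f := fun (r : ℝ≥0∞) (_ : 0 < r) => 
       ⨅ (t : ℕ → Set ℝ) (_ : Λ ⊆ ⋃ n, t n) (_ : ∀ n, Metric.ediam (t n) ≤ r),
          ∑' n, ⨆ _ : (t n).Nonempty, Metric.ediam (t n) ^ s) 1 zero_lt_one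
  simp only [iInf_lt_iff] at h1
  obtain ⟨t, htc, htd, hts⟩ := h1
  obtain ⟨e', he'pos, he'sum⟩ := ENNReal.exists_pos_sum_of_countable hη'pos.ne' ℕ
  have hex : ∀ i, ∃ xy : ℝ × ℝ, t i ⊆ Ioo xy.1 xy.2 ∧
      ENNReal.ofReal (volume.real (Ioo xy.1 xy.2) ^ s)
        ≤ 2 * ((⨆ _ : (t i).Nonempty, Metric.ediam (t i) ^ s) + e' i) := by
    intro i
    rcases (t i).eq_empty_or_nonempty with hemp | hne
    · refine ⟨(0, 0), by simp [hemp], ?_⟩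
      simp [Real.zero_rpow hs.ne']
    · obtain ⟨z, hz⟩ := hne
      have hdt : Metric.ediam (t i) ≠ ⊤ := ((htd i).trans_lt ENNReal.one_lt_top).ne
      set d := (Metric.ediam (t i)).toReal with hd
      have hd0 : 0 ≤ d := ENNReal.toReal_nonneg
      set e : ℝ := (e' i : ℝ) ^ (1 / s) with he
      have hepos : 0 < e := Real.rpow_pos_of_pos (he'pos i) _
      refine ⟨(z - (d + e), z + (d + e)), ?_, ?_⟩
      · intro w hw
        have h2 : edist w z ≤ Metric.ediam (t i) := Metric.edist_le_ediam_of_mem hw hz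
        have h3 : dist w z ≤ d := by
          rw [dist_edist]; exact ENNReal.toReal_mono hdt h2
        rw [Real.dist_eq, abs_le] at h3
        constructor <;> simp only <;> linarith
      · have hne' : (t i).Nonempty := ⟨z, hz⟩
        simp only [hne', iSup_pos]
        rw [Real.volume_real_Ioo_of_le (by linarith)]
        have e0 : z + (d + e) - (z - (d + e)) = 2 * (d + e) := by ring
        rw [e0]
        have h4 : (2 * (d + e)) ^ s ≤ 2 * (d ^ s + e ^ s) := by
          rw [Real.mul_rpow (by norm_num) (by linarith)]
          have h5 : (2:ℝ) ^ s ≤ 2 := by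
            calc (2:ℝ) ^ s ≤ 2 ^ (1:ℝ) := Real.rpow_le_rpow_of_exponent_le (by norm_num) hs1.le
              _ = 2 := by simp
          have h6 : (d + e) ^ s ≤ d ^ s + e ^ s :=
            Real.rpow_add_le_add_rpow hd0 hepos.le hs.le hs1.le
          have : 0 ≤ (d + e) ^ s := Real.rpow_nonneg (by linarith) _
          exact mul_le_mul h5 h6 this (by norm_num)
        have h7 : e ^ s = e' i := by
          rw [he, ← Real.rpow_mul (e' i).coe_nonneg, one_div_mul_cancel hs.ne', Real.rpow_one]
        refine (ENNReal.ofReal_le_ofReal h4).trans (le_of_eq ?_)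
        rw [ENNReal.ofReal_mul (by norm_num), ENNReal.ofReal_add (Real.rpow_nonneg hd0 _)
          (Real.rpow_nonneg hepos.le _), h7, ← ENNReal.ofReal_rpow_of_nonneg hd0 hs.le, hd,
          ENNReal.ofReal_toReal hdt]
        simp
  choose xy hxy1 hxy2 using hex
  refine ⟨fun i => (xy i).1, fun i => (xy i).2, ?_, ?_⟩
  · exact htc.trans (iUnion_mono hxy1)
  · intro F
    rw [← ENNReal.ofReal_le_ofReal_iff hη.le, ENNReal.ofReal_sum_of_nonneg
      (fun i _ => Real.rpow_nonneg measureReal_nonneg _)]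
    calc ∑ i ∈ F, ENNReal.ofReal (volume.real (Ioo (xy i).1 (xy i).2) ^ s)
        ≤ ∑ i ∈ F, 2 * ((⨆ _ : (t i).Nonempty, Metric.ediam (t i) ^ s) + (e' i : ℝ≥0∞)) :=
          Finset.sum_le_sum (fun i _ => hxy2 i)
      _ ≤ ∑' i, 2 * ((⨆ _ : (t i).Nonempty, Metric.ediam (t i) ^ s) + (e' i : ℝ≥0∞)) :=
          ENNReal.sum_le_tsum F
      _ = 2 * ((∑' i, ⨆ _ : (t i).Nonempty, Metric.ediam (t i) ^ s) + ∑' i, (e' i : ℝ≥0∞)) := by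
          rw [ENNReal.tsum_mul_left, ENNReal.tsum_add]
      _ ≤ 2 * (η' + η') := by gcongr
      _ = ENNReal.ofReal η := by
          rw [hη', ← ENNReal.ofReal_add (by linarith) (by linarith)]
          rw [show (2:ℝ≥0∞) = ENNReal.ofReal 2 by simp, ← ENNReal.ofReal_mul (by norm_num)]
          congr 1; ring

lemma step_avg {s c a b τ ε : ℝ} (hs : 0 < s) (hs1 : s < 1) (hc : 0 < c) (hab : a < b)
    (hτ : 0 < τ) (hτc : τ ^ (1 - s) = c / 4) (hε : 0 < ε) (hεc : ε ≤ c * (b - a) ^ (1 - s) / 8)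
    (x y : ℕ → ℝ)
    (hΦ : ∀ F : Finset ℕ, ∑ i ∈ F, volume.real (Ioo (x i) (y i) ∩ Icc a b) ^ s
      ≤ τ ^ s * (b - a) ^ s)
    {Z : Finset ℝ} {v p q : ℝ → ℝ}
    (hZ : ∀ u ∈ Z, a ≤ u ∧ u ≤ p u ∧ p u < q u ∧ q u < v u ∧ v u ≤ b ∧
      v u - u ≤ ε * (q u - p u) ^ s)
    (hd : (Z : Set ℝ).PairwiseDisjoint (fun u => Ico u (v u)))
    (hsum : c * (b - a) ≤ ∑ u ∈ Z, (v u - u)) :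
    ∃ u ∈ Z, ∀ F : Finset ℕ, ∑ i ∈ F, volume.real (Ioo (x i) (y i) ∩ Icc (p u) (q u)) ^ s
      ≤ τ ^ s * (q u - p u) ^ s := by
  classical
  by_contra hcon
  push Not at hcon
  choose! Fu hFu using hcon
  set F := Z.biUnion Fu with hF
  have hba : 0 < b - a := by linarith
  have hbas : 0 < (b - a) ^ s := Real.rpow_pos_of_pos hba _
  have hτs : 0 < τ ^ s := Real.rpow_pos_of_pos hτ _
  set V : ℕ → ℝ := fun i => volume.real (Ioo (x i) (y i) ∩ Icc a b) with hV
  have hVnn : ∀ i, 0 ≤ V i := fun i => measureReal_nonneg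
  have h1 : τ ^ s * (c * (b - a)) ≤ ∑ i ∈ F, (V i + 2 * ε * V i ^ s) := by
    calc τ ^ s * (c * (b - a)) ≤ τ ^ s * ∑ u ∈ Z, (v u - u) := by gcongr
      _ = ∑ u ∈ Z, (v u - u) * τ ^ s := by
          rw [Finset.mul_sum]; exact Finset.sum_congr rfl (fun u _ => mul_comm _ _)
      _ ≤ ∑ u ∈ Z, ∑ i ∈ F, (v u - u) *
          (volume.real (Ioo (x i) (y i) ∩ Icc (p u) (q u)) ^ s / (q u - p u) ^ s) := by
          apply Finset.sum_le_sum
          intro u hu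
          obtain ⟨g1, g2, g3, g4, g5, g6⟩ := hZ u hu
          rw [← Finset.mul_sum, ← Finset.sum_div]
          have hqs : 0 < (q u - p u) ^ s := Real.rpow_pos_of_pos (by linarith) _
          apply mul_le_mul_of_nonneg_left _ (by linarith)
          rw [le_div_iff₀ hqs]
          refine (hFu u hu).le.trans ?_
          apply Finset.sum_le_sum_of_subset_of_nonneg
          · exact Finset.subset_biUnion_of_mem Fu hu
          · intro i _ _; exact Real.rpow_nonneg measureReal_nonneg _
      _ = ∑ i ∈ F, ∑ u ∈ Z, (v u - u) *
          (volume.real (Ioo (x i) (y i) ∩ Icc (p u) (q u)) ^ s / (q u - p u) ^ s) :=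
          Finset.sum_comm
      _ ≤ _ := Finset.sum_le_sum (fun i _ => perU hs hε hZ hd (x i) (y i))
  have h2 : ∀ i, V i ≤ (τ * (b - a)) ^ (1 - s) * V i ^ s := by
    intro i
    have g1 := hΦ {i}
    rw [Finset.sum_singleton, ← Real.mul_rpow hτ.le hba.le] at g1
    have g2 : V i ≤ τ * (b - a) := (Real.rpow_le_rpow_iff (hVnn i) (by positivity) hs).1 g1
    rcases eq_or_lt_of_le (hVnn i) with h | h
    · rw [← h]; positivity
    · calc V i = V i ^ (1 - s) * V i ^ s := by
            rw [← Real.rpow_add h]; simp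
        _ ≤ _ := by
            gcongr
  have h3 : ∑ i ∈ F, (V i + 2 * ε * V i ^ s) ≤ ((τ * (b - a)) ^ (1 - s) + 2 * ε) * (τ ^ s * (b - a) ^ s) := by
    calc _ ≤ ∑ i ∈ F, ((τ * (b - a)) ^ (1 - s) + 2 * ε) * V i ^ s := by
          apply Finset.sum_le_sum
          intro i _
          linarith [h2 i]
      _ ≤ _ := by
          rw [← Finset.mul_sum]
          apply mul_le_mul_of_nonneg_left (hΦ F)
          positivity
  have h4 : ((τ * (b - a)) ^ (1 - s) + 2 * ε) ≤ c / 2 * (b - a) ^ (1 - s) := by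
    rw [Real.mul_rpow hτ.le hba.le, hτc]; linarith
  have h5 : (b - a) ^ (1 - s) * (b - a) ^ s = b - a := by
    rw [← Real.rpow_add hba]; simp
  have h6 : τ ^ s * (c * (b - a)) ≤ c / 2 * (b - a) ^ (1 - s) * (τ ^ s * (b - a) ^ s) :=
    h1.trans (h3.trans (by gcongr))
  have h7 : c / 2 * (b - a) ^ (1 - s) * (τ ^ s * (b - a) ^ s) = τ ^ s * (c * (b - a)) / 2 := by
    calc _ = c / 2 * τ ^ s * ((b - a) ^ (1 - s) * (b - a) ^ s) := by ring
      _ = _ := by rw [h5]; ring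
  have h8 : 0 < τ ^ s * (c * (b - a)) := by positivity
  linarith

theorem limsup_dim {s c a0 b0 : ℝ} (hs : 0 < s) (hs1 : s < 1) (hc : 0 < c) (hc1 : c ≤ 1)
    (hab0 : a0 < b0) (E : ℕ → Set ℝ)
    (H : ∀ a b, a0 ≤ a → a < b → b ≤ b0 → ∀ ε > 0, ∀ N : ℕ, ∃ n ≥ N, ∃ Z : Finset ℝ,
      ∃ v p q : ℝ → ℝ, (∀ u ∈ Z, a ≤ u ∧ u ≤ p u ∧ p u < q u ∧ q u < v u ∧ v u ≤ b ∧
        v u - u ≤ ε * (q u - p u) ^ s ∧ v u - u ≤ ε ∧ Icc (p u) (q u) ⊆ E n) ∧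
      (Z : Set ℝ).PairwiseDisjoint (fun u => Ico u (v u)) ∧
      c * (b - a) ≤ ∑ u ∈ Z, (v u - u)) :
    μH[s] {z | ∃ᶠ n in atTop, z ∈ E n} ≠ 0 := by
  intro hzero
  set τ : ℝ := (c / 4) ^ (1 / (1 - s)) with hτ
  have hτpos : 0 < τ := Real.rpow_pos_of_pos (by linarith) _
  have hτc : τ ^ (1 - s) = c / 4 := by
    rw [hτ, ← Real.rpow_mul (by linarith), one_div_mul_cancel (by linarith), Real.rpow_one]
  have hτ1 : τ < 1 := Real.rpow_lt_one (by linarith) (by linarith) (by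
    apply one_div_pos.2; linarith)
  have hτs1 : τ ^ s < 1 := Real.rpow_lt_one hτpos.le hτ1 hs
  have hτs : 0 < τ ^ s := Real.rpow_pos_of_pos hτpos _
  obtain ⟨x, y, hcov, hxy⟩ := exists_cover hs hs1 hzero
    (η := τ ^ s * (b0 - a0) ^ s) (mul_pos hτs (Real.rpow_pos_of_pos (by linarith) _))
  let Φ : ℝ × ℝ → Prop := fun ab => a0 ≤ ab.1 ∧ ab.1 < ab.2 ∧ ab.2 ≤ b0 ∧
    ∀ F : Finset ℕ, ∑ i ∈ F, volume.real (Ioo (x i) (y i) ∩ Icc ab.1 ab.2) ^ s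
      ≤ τ ^ s * (ab.2 - ab.1) ^ s
  have hstep : ∀ (st : {ab : ℝ × ℝ // Φ ab}) (k : ℕ), ∃ st' : {ab : ℝ × ℝ // Φ ab},
      st.1.1 ≤ st'.1.1 ∧ st'.1.2 ≤ st.1.2 ∧ st'.1.2 - st'.1.1 ≤ (st.1.2 - st.1.1) / 2 ∧
      ∃ n ≥ k, Icc st'.1.1 st'.1.2 ⊆ E n := by
    rintro ⟨⟨a, b⟩, h1, h2, h3, h4⟩ k
    simp only at h1 h2 h3 h4
    have hba : 0 < b - a := by linarith
    set ε := min (c * (b - a) ^ (1 - s) / 8) ((b - a) / 2) with hε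
    have hεpos : 0 < ε := lt_min
      (by have := Real.rpow_pos_of_pos hba (1 - s); positivity) (by linarith)
    obtain ⟨n, hn, Z, v, p, q, hZ, hd, hsum⟩ := H a b h1 h2 h3 ε hεpos k
    obtain ⟨u, hu, hF⟩ := step_avg hs hs1 hc h2 hτpos hτc hεpos (min_le_left _ _) x y h4
      (fun u hu => by
        obtain ⟨g1, g2, g3, g4, g5, g6, _⟩ := hZ u hu
        exact ⟨g1, g2, g3, g4, g5, g6⟩) hd hsum
    obtain ⟨g1, g2, g3, g4, g5, g6, g7, g8⟩ := hZ u hu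
    refine ⟨⟨(p u, q u), by simp only; linarith, g3, by simp only; linarith, hF⟩, ?_, ?_, ?_, n, hn, g8⟩
    · simp only; linarith
    · simp only; linarith
    · have := min_le_right (c * (b - a) ^ (1 - s) / 8) ((b - a) / 2)
      simp only; linarith
  choose next hn1 hn2 hn3 hn4 using hstep
  have hinit : Φ (a0, b0) := by
    refine ⟨le_rfl, hab0, le_rfl, fun F => (Finset.sum_le_sum (fun i _ => ?_)).trans (hxy F)⟩
    apply Real.rpow_le_rpow measureReal_nonneg _ hs.le
    exact measureReal_mono inter_subset_left (by simp)
  let S : ℕ → {ab : ℝ × ℝ // Φ ab} := fun k => Nat.rec ⟨(a0, b0), hinit⟩ (fun k st => next st k) k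
  have hS : ∀ k, S (k+1) = next (S k) k := fun k => rfl
  have hlen : ∀ k, (S k).1.2 - (S k).1.1 ≤ (b0 - a0) * (1 / 2) ^ k := by
    intro k
    induction k with
    | zero => simp [S]
    | succ k ih =>
      rw [hS, pow_succ]
      have := hn3 (S k) k
      linarith
  have hne : ∀ k, (Icc (S k).1.1 (S k).1.2).Nonempty := fun k =>
    nonempty_Icc.2 (S k).2.2.1.le
  obtain ⟨z, hz⟩ := IsCompact.nonempty_iInter_of_sequence_nonempty_isCompact_isClosed
    (fun k => Icc (S k).1.1 (S k).1.2)
    (fun k => by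
      apply Icc_subset_Icc
      · exact hn1 (S k) k
      · exact hn2 (S k) k) hne isCompact_Icc (fun k => isClosed_Icc)
  rw [mem_iInter] at hz
  have hzΛ : z ∈ {z | ∃ᶠ n in atTop, z ∈ E n} := by
    show ∃ᶠ n in atTop, z ∈ E n
    rw [frequently_atTop]
    intro k
    obtain ⟨n, hn, hsub⟩ := hn4 (S k) k
    exact ⟨n, hn, hsub (hz (k+1))⟩
  obtain ⟨i, hi⟩ := mem_iUnion.1 (hcov hzΛ)
  have hpos : 0 < min (z - x i) (y i - z) := lt_min (by linarith [hi.1]) (by linarith [hi.2])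
  have ht : Tendsto (fun k : ℕ => (b0 - a0) * (1 / 2 : ℝ) ^ k) atTop (nhds 0) := by
    have := (tendsto_pow_atTop_nhds_zero_of_lt_one (r := (1/2:ℝ)) (by norm_num)
      (by norm_num)).const_mul (b0 - a0)
    simpa using this
  obtain ⟨k, hk⟩ := (ht.eventually (gt_mem_nhds hpos)).exists
  have hk' := hlen k
  have hzk := hz k
  obtain ⟨-, hk2, -, hk4⟩ := (S k).2
  have hsub : Icc (S k).1.1 (S k).1.2 ⊆ Ioo (x i) (y i) := by
    intro w hw
    have m1 := min_le_left (z - x i) (y i - z)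
    have m2 := min_le_right (z - x i) (y i - z)
    constructor
    · linarith [hw.1, hzk.2]
    · linarith [hw.2, hzk.1]
  have hfin := hk4 {i}
  rw [Finset.sum_singleton, inter_eq_right.2 hsub, Real.volume_real_Icc_of_le hk2.le] at hfin
  have : 0 < ((S k).1.2 - (S k).1.1) ^ s := Real.rpow_pos_of_pos (by linarith) _
  nlinarith

lemma piece {β0 β1 u v : ℝ} {n ℓ : ℕ} {x : ℝ → ℝ} {L : NNReal}
    (hLip : LipschitzOnWith L x (Ioi (1:ℝ)))
    (hval : ∀ β ∈ Ioi (1:ℝ), x β ∈ Icc (0:ℝ) 1)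
    (h0 : 1 < β0) (hu : β0 ≤ u) (huv : u < v) (hv : v ≤ β1)
    (hfu : ff (n+1) u = 0) (hPv : PP (dg u) (n+1) v = 1)
    (hff : ∀ y ∈ Ico u v, ∀ j ≤ n+1, ff j y = PP (dg u) j y) :
    v - u ≤ (β0 ^ n)⁻¹ ∧ ∃ p q, u ≤ p ∧ p < q ∧ q < v ∧
      q - p = (β1 ^ ℓ)⁻¹ / (4 * (β1 ^ (n+1) / (β0 - 1) + L)) ∧
      ∀ y ∈ Icc p q, |ff (n+1) y - x y| < (y ^ ℓ)⁻¹ := by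
  have hb0 : 0 < β0 - 1 := by linarith
  set A := β1 ^ (n+1) / (β0 - 1) with hA
  have hApos : 0 < A := div_pos (pow_pos (by linarith) _) hb0
  set K := A + L with hK
  have hL0 : (0:ℝ) ≤ L := L.coe_nonneg
  have hKpos : 0 < K := by linarith
  have hPu : PP (dg u) (n+1) u = 0 := by rw [PP_dg, hfu]
  have hnn : ∀ y ∈ Ico u v, ∀ j ≤ n+1, 0 ≤ PP (dg u) j y := fun y hy j hj => by
    rw [← hff y hy j hj]; exact ff_nonneg _ _
  have hle : ∀ y ∈ Ico u v, ∀ j ≤ n+1, PP (dg u) j y ≤ 1 := fun y hy j hj => by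
    rw [← hff y hy j hj]; exact ff_le_one _ _
  have hP : ∀ y y', u ≤ y → y ≤ y' → y' ≤ v → 0 ≤ PP (dg u) (n+1) y' - PP (dg u) (n+1) y ∧
      PP (dg u) (n+1) y' - PP (dg u) (n+1) y ≤ A * (y' - y) := by
    intro y y' h1 h2 h3
    rcases eq_or_lt_of_le h2 with rfl | h2'
    · simp
    have hy : y ∈ Ico u v := ⟨h1, by linarith⟩
    constructor
    · have := PP_mono (w := dg u) (show 1 < y by linarith) h2 (n+1) (fun j hj => hnn y hy j hj.le)
      linarith
    · refine (PP_upper (w := dg u) (show 1 < y by linarith) h2 (n+1)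
        (fun j hj => hle y hy j hj.le)).trans ?_
      rw [mul_comm]
      apply mul_le_mul_of_nonneg_right _ (by linarith)
      have : 0 ≤ y' := by linarith
      have : 0 < y' - 1 := by linarith
      rw [hA]
      apply div_le_div₀ (pow_nonneg (by linarith) _) (pow_le_pow_left₀ (by linarith) (by linarith) _) hb0
      linarith
  have hx : ∀ y y', u ≤ y → y ≤ y' → |x y' - x y| ≤ L * (y' - y) := by
    intro y y' h1 h2
    have := hLip.dist_le_mul y' (show 1 < y' by linarith) y (show 1 < y by linarith)
    rw [Real.dist_eq, Real.dist_eq, abs_of_nonneg (show 0 ≤ y' - y by linarith)] at this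
    exact this
  set G : ℝ → ℝ := fun y => PP (dg u) (n+1) y - x y with hG
  have hGL : ∀ y y', u ≤ y → y ≤ y' → y' ≤ v → |G y' - G y| ≤ K * (y' - y) := by
    intro y y' h1 h2 h3
    obtain ⟨g1, g2⟩ := hP y y' h1 h2 h3
    have g3 := abs_le.1 (hx y y' h1 h2)
    rw [abs_le]
    simp only [hG, hK]
    constructor <;> nlinarith
  have hlen : 1 ≤ K * (v - u) := by
    have := (hP u v le_rfl huv.le le_rfl).2
    rw [hPu, hPv] at this
    nlinarith
  have hGc : ContinuousOn G (Icc u v) := by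
    apply (PP_cont _ _).continuousOn.sub
    exact hLip.continuousOn.mono (fun y hy => show 1 < y by linarith [hy.1])
  have hGu : G u ≤ 0 := by
    simp only [hG, hPu]; linarith [(hval u (show 1 < u by linarith)).1]
  have hGv : 0 ≤ G v := by
    simp only [hG, hPv]; linarith [(hval v (show 1 < v by linarith)).2]
  obtain ⟨z, hz, hGz⟩ := intermediate_value_Icc huv.le hGc ⟨hGu, hGv⟩
  have hβ1 : 1 < β1 := by linarith
  set r := (β1 ^ ℓ)⁻¹ with hr
  have hrpos : 0 < r := by positivity
  have hr1 : r ≤ 1 := inv_le_one_of_one_le₀ (one_le_pow₀ hβ1.le)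
  set δ := r / (2 * K) with hδ
  have hδpos : 0 < δ := by positivity
  have hKδ : K * δ = r / 2 := by rw [hδ]; field_simp
  have hδle : δ ≤ (v - u) / 2 := by
    by_contra! h
    nlinarith
  have hfin : ∀ y, u ≤ y → y < v → |y - z| ≤ δ → |ff (n+1) y - x y| < (y ^ ℓ)⁻¹ := by
    intro y h1 h2 h3
    have e1 : |G y| ≤ r / 2 := by
      rw [← hKδ]
      rcases le_total y z with h | h
      · have := hGL y z h1 h hz.2
        rw [hGz, zero_sub, abs_neg] at this
        rw [abs_of_nonpos (by linarith)] at h3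
        refine this.trans (mul_le_mul_of_nonneg_left (by linarith) hKpos.le)
      · have := hGL z y hz.1 h h2.le
        rw [hGz, sub_zero] at this
        rw [abs_of_nonneg (by linarith)] at h3
        refine this.trans (mul_le_mul_of_nonneg_left (by linarith) hKpos.le)
    rw [hff y ⟨h1, h2⟩ (n+1) le_rfl]
    have e2 : r ≤ (y ^ ℓ)⁻¹ := by
      apply inv_anti₀ (pow_pos (by linarith) _)
      exact pow_le_pow_left₀ (by linarith) (by linarith) _
    simp only [hG] at e1
    linarith
  have hd4 : δ / 2 = r / (4 * K) := by rw [hδ]; field_simp; norm_num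
  refine ⟨?_, ?_⟩
  · have := PP_lower (w := dg u) (show 1 < u by linarith) huv.le n
      (fun j hj => hnn u ⟨le_rfl, huv⟩ j (by omega))
    rw [hPu, hPv] at this
    have h2 : β0 ^ n ≤ v ^ n := pow_le_pow_left₀ (by linarith) (by linarith) _
    have h3 : 0 < β0 ^ n := pow_pos (by linarith) _
    rw [← one_div, le_div_iff₀ h3]
    nlinarith
  · rcases le_total z ((u + v) / 2) with h | h
    · refine ⟨z, z + δ / 2, hz.1, by linarith, by linarith, by rw [← hd4]; ring, ?_⟩
      intro y hy
      apply hfin y (by linarith [hy.1, hz.1]) (by linarith [hy.2])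
      rw [abs_le]; constructor <;> linarith [hy.1, hy.2]
    · refine ⟨z - δ, z - δ / 2, by linarith, by linarith, by linarith [hz.2],
        by rw [← hd4]; ring, ?_⟩
      intro y hy
      apply hfin y (by linarith [hy.1]) (by linarith [hy.2, hz.2])
      rw [abs_le]; constructor <;> linarith [hy.1, hy.2]

lemma lower_main {x : ℝ → ℝ} {L : NNReal}
    (hLip : LipschitzOnWith L x (Ioi (1:ℝ)))
    (hval : ∀ β ∈ Ioi (1:ℝ), x β ∈ Icc (0:ℝ) 1)
    (ℓ : ℕ → ℕ) {s α : ℝ} (hs : 0 < s) (hα : 0 ≤ α) (hsα : s * (1 + α) < 1)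
    (hfr : ∃ᶠ n : ℕ in atTop, (ℓ n : ℝ) ≤ α * n) :
    μH[s] {β : ℝ | 1 < β ∧
        ∃ᶠ n in atTop, |(betaT β)^[n] 1 - x β| < β ^ (-(ℓ n : ℤ))} ≠ 0 := by
  have hs1 : s < 1 := by nlinarith
  set σ := s * (1 + α) with hσ
  have hσpos : 0 < σ := by positivity
  set t := (1 + 1 / σ) / 2 with ht
  have htσ : t * σ = (σ + 1) / 2 := by rw [ht]; field_simp
  have ht1 : 1 < t := by
    have : 1 < 1 / σ := by rw [lt_div_iff₀ hσpos]; linarith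
    linarith
  set β1 : ℝ := 2 ^ t with hβ1
  have h21 : 2 < β1 := by
    calc (2:ℝ) = 2 ^ (1:ℝ) := by simp
      _ < _ := Real.rpow_lt_rpow_of_exponent_lt (by norm_num) ht1
  obtain ⟨c, hc, hfam⟩ := fullFam (show (1:ℝ) < 2 by norm_num) h21
  set ρ : ℝ := 2 ^ (t * σ) with hρ
  have hρpos : 0 < ρ := by positivity
  have hρ2 : ρ < 2 := by
    calc ρ < 2 ^ (1:ℝ) := Real.rpow_lt_rpow_of_exponent_lt (by norm_num) (by rw [htσ]; linarith)
      _ = 2 := by simp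
  have hL0 : (0:ℝ) ≤ L := L.coe_nonneg
  set K0 : ℝ := 4 * (1 + L) with hK0
  have hK0pos : 0 < K0 := by positivity
  set E : ℕ → Set ℝ := fun n => {β | 1 < β ∧ |ff n β - x β| < (β ^ (ℓ n))⁻¹} with hE
  have key := limsup_dim (c := min c 1) hs hs1 (lt_min hc one_pos) (min_le_right _ _) h21 E ?_
  · intro h
    apply key
    refine measure_mono_null ?_ h
    intro β hβ
    have hβ' : ∃ᶠ n in atTop, β ∈ E n := hβ
    obtain ⟨n, hn⟩ := hβ'.exists
    refine ⟨hn.1, hβ'.mono ?_⟩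
    intro n hn
    have := hn.2
    rw [zpow_neg, zpow_natCast]
    exact this
  intro a b ha hab hb ε hε N
  obtain ⟨N1, hN1⟩ := hfam a b ha hab hb
  have tend1 : Tendsto (fun n : ℕ => (ρ / 2) ^ n) atTop (nhds 0) :=
    tendsto_pow_atTop_nhds_zero_of_lt_one (by positivity) (by rw [div_lt_one (by norm_num)]; exact hρ2)
  have tend2 : Tendsto (fun n : ℕ => ((1:ℝ) / 2) ^ n) atTop (nhds 0) :=
    tendsto_pow_atTop_nhds_zero_of_lt_one (by positivity) (by norm_num)
  have hKs : 0 < K0 ^ s := by positivity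
  have ev1 := tend1.eventually (ge_mem_nhds (show 0 < ε / K0 ^ s / 2 by positivity))
  have ev2 := tend2.eventually (ge_mem_nhds (show 0 < ε / 2 by positivity))
  obtain ⟨n, hnℓ, hn1, hn2, hnN⟩ := (hfr.and_eventually (ev1.and (ev2.and
    (eventually_ge_atTop (max (max N N1) 1))))).exists
  obtain ⟨m, rfl⟩ : ∃ m, n = m + 1 := ⟨n - 1, by
    have := (le_max_right (max N N1) 1).trans hnN; omega⟩
  have hnN' := (le_max_left (max N N1) 1).trans hnN
  obtain ⟨Z, v, hZ, hd, hsum⟩ := hN1 (m+1) ((le_max_right N N1).trans hnN')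
  have hex : ∀ u, ∃ pq : ℝ × ℝ, u ∈ Z → v u - u ≤ ((2:ℝ) ^ m)⁻¹ ∧ u ≤ pq.1 ∧ pq.1 < pq.2 ∧ pq.2 < v u ∧
      pq.2 - pq.1 = (β1 ^ ℓ (m+1))⁻¹ / (4 * (β1 ^ (m+1) / (2 - 1) + L)) ∧
      ∀ y ∈ Icc pq.1 pq.2, |ff (m+1) y - x y| < (y ^ ℓ (m+1))⁻¹ := by
    intro u
    by_cases hu : u ∈ Z
    · obtain ⟨g1, g2, g3, g4, g5, g6⟩ := hZ u hu
      obtain ⟨k1, p, q, k2⟩ := piece (ℓ := ℓ (m+1)) hLip hval (show (1:ℝ) < 2 by norm_num) (ha.trans g1) g2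
        (g3.trans hb) g4 g5 g6
      exact ⟨(p, q), fun _ => ⟨k1, k2⟩⟩
    · exact ⟨0, fun h => absurd h hu⟩
  choose pq hpq using hex
  refine ⟨m+1, (le_max_left N N1).trans hnN', Z, v, fun u => (pq u).1, fun u => (pq u).2, ?_, hd, ?_⟩
  swap
  · refine le_trans ?_ hsum
    apply mul_le_mul_of_nonneg_right (min_le_left _ _) (by linarith)
  intro u hu
  obtain ⟨g1, g2, g3, g4, g5, g6⟩ := hZ u hu
  obtain ⟨k1, k2, k3, k4, k5, k6⟩ := hpq u hu
  have hpow : ((2:ℝ) ^ m)⁻¹ = 2 * (1/2) ^ (m+1) := by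
    rw [pow_succ, one_div, inv_pow]; ring
  refine ⟨g1, k2, k3, k4, g3, ?_, ?_, ?_⟩
  · refine k1.trans ?_
    simp only
    rw [k5, hpow]
    -- lower bound for the size of the piece
    have hβ1pos : 0 < β1 := by linarith
    have e1 : (β1 ^ (((m+1:ℕ):ℝ) * (1 + α)))⁻¹ / K0 ≤
        (β1 ^ ℓ (m+1))⁻¹ / (4 * (β1 ^ (m+1) / (2 - 1) + L)) := by
      have e2 : β1 ^ (((m+1:ℕ):ℝ) * (1 + α)) = β1 ^ (α * ((m+1:ℕ):ℝ)) * β1 ^ (m+1) := by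
        rw [← Real.rpow_natCast β1 (m+1), ← Real.rpow_add hβ1pos]
        congr 1; ring
      have e3 : β1 ^ ℓ (m+1) ≤ β1 ^ (α * ((m+1:ℕ):ℝ)) := by
        rw [← Real.rpow_natCast]
        exact Real.rpow_le_rpow_of_exponent_le (by linarith) hnℓ
      have e4 : 1 ≤ β1 ^ (m+1) := one_le_pow₀ (by linarith)
      rw [e2]
      have e5 : 4 * (β1 ^ (m+1) / (2 - 1) + L) ≤ K0 * β1 ^ (m+1) := by
        rw [hK0]; norm_num; nlinarith
      calc (β1 ^ (α * ((m+1:ℕ):ℝ)) * β1 ^ (m+1))⁻¹ / K0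
          = (β1 ^ (α * ((m+1:ℕ):ℝ)))⁻¹ / (K0 * β1 ^ (m+1)) := by field_simp
        _ ≤ _ := by
          apply div_le_div₀ (by positivity) (inv_anti₀ (by positivity) e3) (by norm_num; positivity) e5
    have e6 : (ρ ^ (m+1))⁻¹ / K0 ^ s ≤
        ((β1 ^ ℓ (m+1))⁻¹ / (4 * (β1 ^ (m+1) / (2 - 1) + L))) ^ s := by
      refine le_trans (le_of_eq ?_) (Real.rpow_le_rpow (by positivity) e1 hs.le)
      rw [Real.div_rpow (by positivity) hK0pos.le, Real.inv_rpow (by positivity)]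
      congr 2
      rw [hρ, hβ1, ← Real.rpow_mul (by positivity), ← Real.rpow_mul (by positivity),
        ← Real.rpow_natCast, ← Real.rpow_mul (by positivity)]
      congr 1
      rw [hσ]; ring
    refine le_trans ?_ (mul_le_mul_of_nonneg_left e6 hε.le)
    rw [div_pow] at hn1
    have hρm : 0 < ρ ^ (m+1) := by positivity
    have e7 : (1/2:ℝ) ^ (m+1) ≤ ε / K0 ^ s / 2 * (ρ ^ (m+1))⁻¹ := by
      rw [← div_eq_mul_inv, le_div_iff₀ hρm]
      refine le_trans (le_of_eq ?_) hn1
      rw [div_pow, one_pow]; ring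
    calc _ ≤ 2 * (ε / K0 ^ s / 2 * (ρ ^ (m+1))⁻¹) := by linarith
      _ = _ := by ring
  · refine k1.trans ?_
    rw [hpow]; linarith
  · intro y hy
    exact ⟨by have := hy.1; simp only at this; linarith, k6 y hy⟩

lemma card_exZ {n : ℕ} {a b : ℝ} {Z : Finset ℝ} (h0 : 1 < a) (hab : a ≤ b)
    (hZ : ∀ u, u ∈ Z ↔ u ∈ Icc a b ∧ ff n u = 0) :
    (Z.card : ℝ) ≤ (n + 1) * (2 * b / (a - 1) * b ^ n) := by
  classical
  have hsub : Z ⊆ (Finset.range (n+1)).biUnion (fun k => Z.filter (fun u => IsZ k u)) := by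
    intro u hu
    obtain ⟨k, _, hk, hk'⟩ := exists_isZ ((hZ u).1 hu).2
    rw [Finset.mem_biUnion]
    exact ⟨k, Finset.mem_range.2 (by omega), Finset.mem_filter.2 ⟨hu, hk'⟩⟩
  have h1 : Z.card ≤ ∑ k ∈ Finset.range (n+1), (Z.filter (fun u => IsZ k u)).card :=
    (Finset.card_le_card hsub).trans Finset.card_biUnion_le
  have h2 : (Z.card : ℝ) ≤ ∑ k ∈ Finset.range (n+1), ((Z.filter (fun u => IsZ k u)).card : ℝ) := by
    exact_mod_cast h1
  have hC : 0 ≤ 2 * b / (a - 1) := div_nonneg (by linarith) (by linarith)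
  refine h2.trans ?_
  calc _ ≤ ∑ k ∈ Finset.range (n+1), (2 * b / (a - 1) * b ^ n) := by
        apply Finset.sum_le_sum
        intro k hk
        refine (cardZ k _ h0 hab ?_).trans ?_
        · intro u hu
          obtain ⟨h3, h4⟩ := Finset.mem_filter.1 hu
          have := (hZ u).1 h3
          exact ⟨this.1.1, this.1.2, h4⟩
        · apply mul_le_mul_of_nonneg_left _ hC
          exact pow_le_pow_right₀ (by linarith) (by have := Finset.mem_range.1 hk; omega)
    _ = _ := by simp

lemma cantelli {d : ℝ} (hd : 0 < d) (A : Set ℝ) (I : ℕ → Finset ℝ) (U : ℕ → ℝ → Set ℝ)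
    {C q : ℝ} (hC : 0 < C) (hq0 : 0 < q) (hq1 : q < 1) (n0 : ℕ)
    (hdiam : ∀ n ≥ n0, ∀ u ∈ I n, ∀ y ∈ U n u, ∀ y' ∈ U n u, |y - y'| ≤ C * q ^ n)
    (hsum : Summable fun n => ((I n).card : ℝ) * (C * q ^ n) ^ d)
    (hA : ∀ y ∈ A, ∀ N : ℕ, ∃ n ≥ N, ∃ u ∈ I n, y ∈ U n u) : μH[d] A ≠ ⊤ := by
  have hed : ∀ n ≥ n0, ∀ u ∈ I n, Metric.ediam (U n u) ≤ ENNReal.ofReal (C * q ^ n) := by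
    intro n hn u hu
    apply Metric.ediam_le
    intro y hy y' hy'
    rw [edist_dist, Real.dist_eq]
    exact ENNReal.ofReal_le_ofReal (hdiam n hn u hu y hy y' hy')
  have hanti : ∀ m n : ℕ, m ≤ n → C * q ^ n ≤ C * q ^ m := fun m n h =>
    mul_le_mul_of_nonneg_left (pow_le_pow_of_le_one hq0.le hq1.le h) hC.le
  have hnn : ∀ n : ℕ, 0 ≤ C * q ^ n := fun n => by positivity
  set M : ℝ≥0∞ := ∑' n, ENNReal.ofReal (((I n).card : ℝ) * (C * q ^ n) ^ d) with hM
  have hMtop : M ≠ ⊤ := by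
    rw [hM, ← ENNReal.ofReal_tsum_of_nonneg (fun n => by positivity) hsum]
    exact ENNReal.ofReal_ne_top
  have key := Measure.hausdorffMeasure_le_liminf_tsum (β := ℕ)
    (ι := fun N => Σ n : ℕ, {u // u ∈ I (n + N + n0)}) d A (l := atTop)
    (fun N => ENNReal.ofReal (C * q ^ N)) ?_ (fun N i => U (i.1 + N + n0) i.2.1) ?_ ?_
  · refine ne_top_of_le_ne_top hMtop (key.trans ?_)
    refine (liminf_le_liminf (v := fun _ => M) (Eventually.of_forall ?_)).trans ?_
    · intro N
      rw [ENNReal.tsum_sigma' (f := fun i : (Σ n : ℕ, {u // u ∈ I (n + N + n0)}) =>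
        Metric.ediam (U (i.1 + N + n0) i.2.1) ^ d)]
      have h1 : ∀ n : ℕ, ∑' u : {u // u ∈ I (n + N + n0)}, Metric.ediam (U (n + N + n0) u.1) ^ d ≤
          ENNReal.ofReal (((I (n + N + n0)).card : ℝ) * (C * q ^ (n + N + n0)) ^ d) := by
        intro n
        rw [tsum_fintype]
        calc _ ≤ ∑ u : {u // u ∈ I (n + N + n0)}, ENNReal.ofReal ((C * q ^ (n + N + n0)) ^ d) := by
              apply Finset.sum_le_sum
              intro u _
              rw [← ENNReal.ofReal_rpow_of_nonneg (hnn _) hd.le]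
              exact ENNReal.rpow_le_rpow (hed _ (by omega) u.1 u.2) hd.le
          _ = _ := by
              rw [ENNReal.ofReal_mul (by positivity)]
              simp
      refine (ENNReal.tsum_le_tsum h1).trans ?_
      exact ENNReal.tsum_comp_le_tsum_of_injective (f := fun n => n + N + n0)
        (fun a b h => by simpa using h) (fun n => ENNReal.ofReal (((I n).card : ℝ) * (C * q ^ n) ^ d))
    · simp
  · have : Tendsto (fun N : ℕ => C * q ^ N) atTop (nhds 0) := by
      simpa using (tendsto_pow_atTop_nhds_zero_of_lt_one hq0.le hq1).const_mul C
    simpa using ENNReal.tendsto_ofReal this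
  · refine Eventually.of_forall (fun N i => ?_)
    refine (hed _ (by omega) i.2.1 i.2.2).trans (ENNReal.ofReal_le_ofReal (hanti _ _ (by omega)))
  · refine Eventually.of_forall (fun N y hy => ?_)
    obtain ⟨n, hn, u, hu, hyu⟩ := hA y hy (N + n0)
    obtain ⟨m, rfl⟩ : ∃ m, n = m + N + n0 := ⟨n - N - n0, by omega⟩
    rw [mem_iUnion]
    exact ⟨⟨m, u, hu⟩, hyu⟩

lemma upper_loc {x : ℝ → ℝ} {L : NNReal}
    (hLip : LipschitzOnWith L x (Ioi (1:ℝ)))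
    (ℓ : ℕ → ℕ) {d α β0 β1 : ℝ} (hd : 0 < d) (hα : 0 ≤ α) (h0 : 1 < β0) (h01 : β0 ≤ β1)
    (hq : β1 * (β0 ^ (-(1 + α))) ^ d < 1)
    (hev : ∀ᶠ n : ℕ in atTop, α * n ≤ (ℓ n : ℝ)) :
    μH[d] {β : ℝ | β ∈ Icc β0 β1 ∧
        ∃ᶠ n in atTop, |(betaT β)^[n] 1 - x β| < β ^ (-(ℓ n : ℤ))} ≠ ⊤ := by
  classical
  have hβ0 : 0 < β0 := by linarith
  have hL0 : (0:ℝ) ≤ L := L.coe_nonneg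
  set q := β0 ^ (-(1 + α)) with hqdef
  have hq0 : 0 < q := by positivity
  have hq1 : q < 1 := Real.rpow_lt_one_of_one_lt_of_neg h0 (by linarith)
  choose Z hZ using fun n => exZ n h0 h01
  obtain ⟨n1, hn1⟩ := eventually_atTop.1 hev
  obtain ⟨n2, hn2⟩ := pow_unbounded_of_one_lt (2 * (L:ℝ)) h0
  refine cantelli (C := 4 * β0) (q := q) hd _ (fun n => insert β0 (Z n))
    (fun n u => {y | y ∈ JJ n u β1 ∧ |ff n y - x y| < (y ^ (ℓ n))⁻¹}) (by positivity) hq0 hq1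
    (n1 + n2 + 1) ?_ ?_ ?_
  · intro n hn u hu
    obtain ⟨m, rfl⟩ : ∃ m, n = m + 1 := ⟨n - 1, by omega⟩
    have huβ : β0 ≤ u := by
      rcases Finset.mem_insert.1 hu with rfl | h
      · exact le_rfl
      · exact ((hZ _ u).1 h).1.1
    have main : ∀ y ∈ {y | y ∈ JJ (m+1) u β1 ∧ |ff (m+1) y - x y| < (y ^ (ℓ (m+1)))⁻¹},
        ∀ y' ∈ {y | y ∈ JJ (m+1) u β1 ∧ |ff (m+1) y - x y| < (y ^ (ℓ (m+1)))⁻¹}, y ≤ y' →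
        y' - y ≤ 4 * β0 * q ^ (m+1) := by
      rintro y ⟨hy, hy2⟩ y' ⟨hy', hy2'⟩ hle
      have g1 := JJ_bound (by linarith) hy hy' hle
      have hyβ : β0 ≤ y := huβ.trans hy.1
      have g2 : |x y' - x y| ≤ L * (y' - y) := by
        have := hLip.dist_le_mul y' (show 1 < y' by linarith) y (show 1 < y by linarith)
        rw [Real.dist_eq, Real.dist_eq, abs_of_nonneg (show 0 ≤ y' - y by linarith)] at this
        exact this
      have hinv : ∀ z, β0 ≤ z → (z ^ ℓ (m+1))⁻¹ ≤ (β0 ^ ℓ (m+1))⁻¹ := fun z hz =>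
        inv_anti₀ (by positivity) (pow_le_pow_left₀ hβ0.le hz _)
      have g3 := hinv y hyβ
      have g4 := hinv y' (hyβ.trans hle)
      set r := (β0 ^ ℓ (m+1))⁻¹ with hr
      have g5 : β0 ^ m ≤ y' ^ m := pow_le_pow_left₀ hβ0.le (hyβ.trans hle) _
      have g6 : 2 * (L:ℝ) ≤ β0 ^ m :=
        hn2.le.trans (pow_le_pow_right₀ h0.le (by omega))
      have a1 := abs_lt.1 hy2
      have a2 := abs_lt.1 hy2'
      have a3 := abs_le.1 g2
      have g7 : (y' - y) * β0 ^ m ≤ 4 * r := by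
        have b1 : (y' - y) * β0 ^ m ≤ (y' - y) * y' ^ m :=
          mul_le_mul_of_nonneg_left g5 (by linarith)
        have b2 : (y' - y) * (2 * L) ≤ (y' - y) * β0 ^ m :=
          mul_le_mul_of_nonneg_left g6 (by linarith)
        nlinarith
      have hm : 0 < β0 ^ m := by positivity
      have g8 : r ≤ β0 ^ (-(α * ((m+1:ℕ):ℝ))) := by
        rw [hr, Real.rpow_neg hβ0.le]
        apply inv_anti₀ (by positivity)
        rw [← Real.rpow_natCast]
        exact Real.rpow_le_rpow_of_exponent_le h0.le (hn1 (m+1) (by omega))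
      have g9 : β0 * q ^ (m+1) * β0 ^ m = β0 ^ (-(α * ((m+1:ℕ):ℝ))) := by
        rw [hqdef, ← Real.rpow_natCast, ← Real.rpow_natCast, ← Real.rpow_mul hβ0.le]
        conv_lhs => rw [← Real.rpow_one β0]
        rw [← Real.rpow_mul hβ0.le, ← Real.rpow_mul hβ0.le, ← Real.rpow_add hβ0,
          ← Real.rpow_add hβ0]
        congr 1
        push_cast; ring
      have g10 : (y' - y) * β0 ^ m ≤ 4 * β0 * q ^ (m+1) * β0 ^ m := by nlinarith
      exact le_of_mul_le_mul_right g10 hm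
    intro y hy y' hy'
    rcases le_total y y' with h | h
    · rw [abs_of_nonpos (by linarith)]; linarith [main y hy y' hy' h]
    · rw [abs_of_nonneg (by linarith)]; exact main y' hy' y hy h
  · have hqd : 0 < q ^ d := by positivity
    set θ := β1 * q ^ d with hθ
    have hβ1 : 0 < β1 := by linarith
    have hθ0 : 0 < θ := by positivity
    set C1 := 2 * β1 / (β0 - 1) with hC1
    have hC1nn : 0 ≤ C1 := div_nonneg (by linarith) (by linarith)
    have s1 : Summable (fun n : ℕ => ((n:ℝ) + 1) * θ ^ n) := by
      have hθn : ‖θ‖ < 1 := by rw [Real.norm_of_nonneg hθ0.le]; exact hq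
      have := (summable_pow_mul_geometric_of_norm_lt_one 1 hθn).add
        (summable_geometric_of_norm_lt_one hθn)
      refine this.congr (fun n => ?_)
      simp; ring
    refine Summable.of_nonneg_of_le (fun n => by positivity) ?_
      (s1.mul_left ((C1 + 1) * (4 * β0) ^ d))
    intro n
    have c1 : ((insert β0 (Z n)).card : ℝ) ≤ (C1 + 1) * ((n + 1) * β1 ^ n) := by
      have c2 : ((insert β0 (Z n)).card : ℝ) ≤ (Z n).card + 1 := by
        exact_mod_cast Finset.card_insert_le _ _
      have c3 := card_exZ h0 h01 (hZ n)
      have c4 : 1 ≤ β1 ^ n := one_le_pow₀ (by linarith)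
      have c5 : (0:ℝ) ≤ n := Nat.cast_nonneg n
      rw [← hC1] at c3
      nlinarith
    have c6 : (4 * β0 * q ^ n) ^ d = (4 * β0) ^ d * (q ^ d) ^ n := by
      rw [Real.mul_rpow (by positivity) (by positivity)]
      congr 1
      rw [← Real.rpow_natCast, ← Real.rpow_natCast, ← Real.rpow_mul hq0.le, ← Real.rpow_mul hq0.le,
        mul_comm]
    rw [c6]
    calc _ ≤ (C1 + 1) * ((n + 1) * β1 ^ n) * ((4 * β0) ^ d * (q ^ d) ^ n) :=
          mul_le_mul_of_nonneg_right c1 (by positivity)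
      _ = _ := by rw [hθ, mul_pow]; ring
  · rintro y ⟨hy, hfr⟩ N
    obtain ⟨n, hn, h⟩ := frequently_atTop.1 hfr N
    obtain ⟨u, hu, hyu⟩ := JJ_cover (hZ n) hy
    refine ⟨n, hn, u, hu, hyu, ?_⟩
    rw [zpow_neg, zpow_natCast] at h
    exact h

lemma upper_main {x : ℝ → ℝ} {L : NNReal}
    (hLip : LipschitzOnWith L x (Ioi (1:ℝ)))
    (ℓ : ℕ → ℕ) {d : NNReal} {α : ℝ} (hα : 0 ≤ α) (hdα : 1 < d * (1 + α))
    (hev : ∀ᶠ n : ℕ in atTop, α * n ≤ (ℓ n : ℝ)) :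
    dimH {β : ℝ | 1 < β ∧
        ∃ᶠ n in atTop, |(betaT β)^[n] 1 - x β| < β ^ (-(ℓ n : ℤ))} ≤ d := by
  set t := (1 + (d:ℝ) * (1 + α)) / 2 with ht
  have ht1 : 1 < t := by linarith
  have hd : (0:ℝ) < d := by
    by_contra! h
    nlinarith
  have hsub : {β : ℝ | 1 < β ∧
        ∃ᶠ n in atTop, |(betaT β)^[n] 1 - x β| < β ^ (-(ℓ n : ℤ))} ⊆
      ⋃ r : {r : ℚ // 1 < r}, {β : ℝ | β ∈ Icc ((r.1 : ℚ) : ℝ) (((r.1 : ℚ) : ℝ) ^ t) ∧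
        ∃ᶠ n in atTop, |(betaT β)^[n] 1 - x β| < β ^ (-(ℓ n : ℤ))} := by
    rintro β ⟨hβ, hfr⟩
    have hlt : β ^ (1 / t) < β := by
      calc β ^ (1 / t) < β ^ (1:ℝ) :=
            Real.rpow_lt_rpow_of_exponent_lt hβ (by rw [div_lt_one (by linarith)]; exact ht1)
        _ = β := Real.rpow_one β
    obtain ⟨r, hr1, hr2⟩ := exists_rat_btwn hlt
    have h1 : 1 < β ^ (1 / t) := Real.one_lt_rpow hβ (by positivity)
    have hr : (1:ℚ) < r := by exact_mod_cast h1.trans hr1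
    rw [mem_iUnion]
    refine ⟨⟨r, hr⟩, ⟨hr2.le, ?_⟩, hfr⟩
    calc β = (β ^ (1 / t)) ^ t := by
          rw [← Real.rpow_mul (by linarith), one_div_mul_cancel (by linarith), Real.rpow_one]
      _ ≤ _ := Real.rpow_le_rpow (by linarith) hr1.le (by linarith)
  refine (dimH_mono hsub).trans ?_
  rw [dimH_iUnion]
  refine iSup_le (fun r => ?_)
  have hr : (1:ℝ) < ((r.1:ℚ):ℝ) := by exact_mod_cast r.2
  apply dimH_le_of_hausdorffMeasure_ne_top
  apply upper_loc hLip ℓ hd hα hr _ _ hev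
  · calc ((r.1:ℚ):ℝ) = ((r.1:ℚ):ℝ) ^ (1:ℝ) := (Real.rpow_one _).symm
      _ ≤ _ := Real.rpow_le_rpow_of_exponent_le hr.le ht1.le
  · rw [← Real.rpow_mul (by linarith), ← Real.rpow_add (by linarith)]
    apply Real.rpow_lt_one_of_one_lt_of_neg hr
    rw [ht]; linarith

lemma ratio_lt {l n : ℕ} (hn : 1 ≤ n) {a : NNReal}
    (h : (l : ℝ≥0∞) / (n : ℝ≥0∞) < a) : (l : ℝ) ≤ a * n := by
  have hn0 : (n : ℝ≥0∞) ≠ 0 := by exact_mod_cast (by omega : n ≠ 0)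
  have h1 := (ENNReal.div_le_iff hn0 (ENNReal.natCast_ne_top n)).1 h.le
  exact_mod_cast h1

lemma lt_ratio {l n : ℕ} (hn : 1 ≤ n) {a : NNReal}
    (h : (a : ℝ≥0∞) < (l : ℝ≥0∞) / (n : ℝ≥0∞)) : (a : ℝ) * n ≤ l := by
  have hn0 : (n : ℝ≥0∞) ≠ 0 := by exact_mod_cast (by omega : n ≠ 0)
  have h1 := (ENNReal.le_div_iff_mul_le (Or.inl hn0) (Or.inl (ENNReal.natCast_ne_top n))).1 h.le
  exact_mod_cast h1

/-- Theorem 1.2. For a Lipschitz function `x : (1,∞) → [0,1]` and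
positive integers `ℓ_n → ∞`, the set of `β > 1` with `|T_β^n 1 - x(β)| < β^{-ℓ_n}`
infinitely often has Hausdorff dimension `1/(1+α)` where `α = liminf ℓ_n/n`. -/
theorem dimH_moving_target (x : ℝ → ℝ) (L : NNReal)
    (hLip : LipschitzOnWith L x (Ioi (1:ℝ)))
    (hval : ∀ β ∈ Ioi (1:ℝ), x β ∈ Icc (0:ℝ) 1)
    (ℓ : ℕ → ℕ) (hℓpos : ∀ n, 0 < ℓ n) (hℓ : Tendsto ℓ atTop atTop) :
    dimH {β : ℝ | 1 < β ∧
        ∃ᶠ n in atTop, |(betaT β)^[n] 1 - x β| < β ^ (-(ℓ n : ℤ))} =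
      1 / (1 + liminf (fun n : ℕ => (ℓ n : ℝ≥0∞) / (n : ℝ≥0∞)) atTop) := by
  set α := liminf (fun n : ℕ => (ℓ n : ℝ≥0∞) / (n : ℝ≥0∞)) atTop with hα
  apply le_antisymm
  · apply le_of_forall_gt_imp_ge_of_dense
    intro d' hd'
    induction d' using ENNReal.recTopCoe with
    | top => exact le_top
    | coe d =>
    have hd0 : d ≠ 0 := by
      rintro rfl
      simp at hd'
    have hdpos : (0:ℝ) < d := by exact_mod_cast pos_iff_ne_zero.2 hd0
    by_cases hcase : (1:ℝ) < d
    · refine upper_main hLip ℓ (α := 0) le_rfl (by simpa using hcase) (Eventually.of_forall ?_)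
      intro n; simp
    · push Not at hcase
      have hd1 : d ≤ 1 := by exact_mod_cast hcase
      have h1 : 1 ≤ d⁻¹ := (one_le_inv₀ (pos_iff_ne_zero.2 hd0)).2 hd1
      have h2 : ((d⁻¹ - 1 : NNReal) : ℝ≥0∞) < α := by
        by_contra! hle
        have h3 : 1 + α ≤ ((d⁻¹ : NNReal) : ℝ≥0∞) := by
          calc 1 + α ≤ 1 + ((d⁻¹ - 1 : NNReal) : ℝ≥0∞) := by gcongr
            _ = ((1 + (d⁻¹ - 1) : NNReal) : ℝ≥0∞) := by push_cast; rfl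
            _ = _ := by rw [add_tsub_cancel_of_le h1]
        have h4 : (d : ℝ≥0∞) ≤ 1 / (1 + α) := by
          rw [one_div, ENNReal.le_inv_iff_le_inv]
          rwa [ENNReal.coe_inv hd0] at h3
        exact absurd hd' (not_lt.2 h4)
      obtain ⟨a, ha1, ha2⟩ := ENNReal.lt_iff_exists_nnreal_btwn.1 h2
      have ha1' : d⁻¹ - 1 < a := by exact_mod_cast ha1
      refine upper_main hLip ℓ (α := a) a.coe_nonneg ?_ ?_
      · have h5 : d⁻¹ < 1 + a := by
          calc d⁻¹ = 1 + (d⁻¹ - 1) := (add_tsub_cancel_of_le h1).symm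
            _ < 1 + a := by gcongr
        have h6 : ((d:ℝ))⁻¹ < 1 + a := by exact_mod_cast h5
        rwa [inv_lt_iff_one_lt_mul₀' hdpos] at h6
      · filter_upwards [eventually_lt_of_lt_liminf ha2, eventually_ge_atTop 1] with n hn hn1
        exact lt_ratio hn1 hn
  · apply ENNReal.le_of_forall_nnreal_lt
    intro s hs
    rcases eq_or_ne s 0 with rfl | hs0
    · simp
    have hspos : (0:ℝ) < s := by exact_mod_cast pos_iff_ne_zero.2 hs0
    have hαtop : α ≠ ⊤ := by
      intro h
      rw [h] at hs
      simp at hs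
    obtain ⟨a, ha⟩ : ∃ a : NNReal, (a : ℝ≥0∞) = α := ⟨α.toNNReal, ENNReal.coe_toNNReal hαtop⟩
    have h1 : s < 1 / (1 + a) := by
      rw [← ha] at hs
      have e : (1:ℝ≥0∞) / (1 + (a:ℝ≥0∞)) = ((1 / (1 + a) : NNReal) : ℝ≥0∞) := by
        rw [ENNReal.coe_div (by positivity)]; push_cast; rfl
      rw [e] at hs
      exact_mod_cast hs
    have h2 : (s:ℝ) < 1 / (1 + a) := by exact_mod_cast h1
    have ha0 : (0:ℝ) ≤ a := a.coe_nonneg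
    rw [lt_div_iff₀ (by linarith)] at h2
    -- a slightly larger exponent
    set η : NNReal := Real.toNNReal ((1 - s * (1 + a)) / (2 * s)) with hη
    have hηv : (s:ℝ) * (η:ℝ) = (1 - s * (1 + a)) / 2 := by
      rw [hη, Real.coe_toNNReal _ (div_nonneg (by linarith) (by linarith))]; field_simp
    have hηpos : 0 < η := by
      have : (0:ℝ) < η := by
        by_contra! h
        nlinarith
      exact_mod_cast this
    have hlt : α < ((a + η : NNReal) : ℝ≥0∞) := by
      rw [← ha]
      exact_mod_cast lt_add_of_pos_right a hηpos
    have hfr : ∃ᶠ n : ℕ in atTop, (ℓ n : ℝ) ≤ ((a + η : NNReal) : ℝ) * n := by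
      refine ((frequently_lt_of_liminf_lt (by isBoundedDefault) hlt).and_eventually
        (eventually_ge_atTop 1)).mono ?_
      rintro n ⟨hn, hn1⟩
      exact ratio_lt hn1 hn
    apply le_dimH_of_hausdorffMeasure_ne_zero
    refine lower_main hLip hval ℓ hspos (NNReal.coe_nonneg _) ?_ hfr
    push_cast
    nlinarith
end

section
/- Let x_0 ∈ [0,1], let (ℓ_n)_{n≥1} be a sequence of positive integers with ℓ_n → ∞, and set α = liminf_{n→∞} ℓ_n/n. For any 1 < β_0 < β_1, the set E(β_0,β_1) = {β ∈ (β_0, β_1] : |T_β^n 1 − x_0| < β^{−ℓ_n} for infinitely many n ∈ ℕ} has Hausdorff dimension at most (1/(1+α))·(log β_1 / log β_0). -/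
open Filter MeasureTheory Set
open scoped ENNReal

noncomputable def codeW (β : ℝ) : ℕ → ℝ → List ℤ
  | 0, _ => []
  | n + 1, x => ⌊β * x⌋ :: codeW β n (betaT β x)

lemma betaT_nonneg (β x : ℝ) : 0 ≤ betaT β x := by
  unfold betaT; linarith [Int.floor_le (β * x)]

lemma betaT_lt_one (β x : ℝ) : betaT β x < 1 := by
  unfold betaT; linarith [Int.lt_floor_add_one (β * x)]

noncomputable def cntA (b : ℝ) : ℕ → ℝ
  | 0 => 0
  | n + 1 => b * (1 + cntA b n)

lemma cntA_nonneg {b : ℝ} (hb : 1 < b) (n : ℕ) : 0 ≤ cntA b n := by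
  induction n with
  | zero => simp [cntA]
  | succ n ih => simp only [cntA]; positivity

lemma cntA_eq {b : ℝ} (hb : 1 < b) (n : ℕ) : 1 + cntA b n ≤ b / (b - 1) * b ^ n := by
  have h1 : 0 < b - 1 := by linarith
  have key : 1 + cntA b n = (b ^ (n + 1) - 1) / (b - 1) := by
    induction n with
    | zero => simp [cntA]; field_simp
    | succ n ih => simp only [cntA]; rw [ih]; field_simp; ring
  rw [key, div_mul_eq_mul_div, pow_succ']
  gcongr
  linarith

lemma code_count {b : ℝ} (hb : 1 < b) (n : ℕ) : ∀ y : ℝ, 0 ≤ y → y ≤ 1 →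
    ∃ F : Finset (List ℤ), (F.card : ℝ) ≤ 1 + cntA b n * y ∧
      ∀ β x : ℝ, 1 < β → β ≤ b → 0 ≤ x → x ≤ y → codeW β n x ∈ F := by
  classical
  induction n with
  | zero =>
    intro y _ _
    exact ⟨{[]}, by simp [cntA], by intros; simp [codeW]⟩
  | succ n ih =>
    intro y hy0 hy1
    obtain ⟨F1, hc1, hF1⟩ := ih 1 zero_le_one le_rfl
    obtain ⟨F2, hc2, hF2⟩ := ih (betaT b y) (betaT_nonneg _ _) (betaT_lt_one _ _).le
    have hfl : 0 ≤ ⌊b * y⌋ := Int.floor_nonneg.2 (by positivity)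
    refine ⟨((Finset.Ico 0 ⌊b * y⌋ ×ˢ F1).image fun p => p.1 :: p.2) ∪
      F2.image (fun w => ⌊b * y⌋ :: w), ?_, ?_⟩
    · have h1 := Finset.card_union_le ((Finset.Ico 0 ⌊b * y⌋ ×ˢ F1).image fun p => p.1 :: p.2)
        (F2.image (fun w => ⌊b * y⌋ :: w))
      have h2 := Finset.card_image_le (s := Finset.Ico 0 ⌊b * y⌋ ×ˢ F1) (f := fun p => p.1 :: p.2)
      have h3 := Finset.card_image_le (s := F2) (f := fun w => ⌊b * y⌋ :: w)
      rw [Finset.card_product, Int.card_Ico, sub_zero] at h2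
      have h4 := h1.trans (Nat.add_le_add h2 h3)
      have h5 : ((⌊b * y⌋.toNat : ℕ) : ℝ) = (⌊b * y⌋ : ℝ) := by
        exact_mod_cast congrArg (Int.cast (R := ℝ)) (Int.toNat_of_nonneg hfl)
      refine (Nat.cast_le (α := ℝ).2 h4).trans ?_
      push_cast
      rw [h5]
      have hfl' : (0 : ℝ) ≤ (⌊b * y⌋ : ℝ) := by exact_mod_cast hfl
      have h6 := mul_le_mul_of_nonneg_left hc1 hfl'
      have h7 := Int.floor_le (b * y)
      simp only [cntA]
      unfold betaT at hc2
      nlinarith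
    · intro β x h1 hβ hx0 hxy
      have hle : β * x ≤ b * y := by gcongr
      have hf := Int.floor_le_floor hle
      have h0 : 0 ≤ ⌊β * x⌋ := Int.floor_nonneg.2 (by positivity)
      rw [Finset.mem_union, codeW]
      rcases hf.lt_or_eq with h | h
      · left
        refine Finset.mem_image.2 ⟨(⌊β * x⌋, codeW β n (betaT β x)), ?_, rfl⟩
        rw [Finset.mem_product]
        exact ⟨Finset.mem_Ico.2 ⟨h0, h⟩, hF1 _ _ h1 hβ (betaT_nonneg _ _) (betaT_lt_one _ _).le⟩
      · right
        refine Finset.mem_image.2 ⟨codeW β n (betaT β x), ?_, by rw [h]⟩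
        refine hF2 _ _ h1 hβ (betaT_nonneg _ _) ?_
        unfold betaT
        rw [h]; linarith

lemma code_sep {β γ : ℝ} (h1 : 1 < β) (h : β ≤ γ) (n : ℕ) : ∀ x y : ℝ, 0 ≤ x → x ≤ y →
    codeW β n x = codeW γ n y → β ^ n * (y - x) ≤ (betaT γ)^[n] y - (betaT β)^[n] x := by
  induction n with
  | zero => intro x y _ _ _; simp
  | succ n ih =>
    intro x y hx hxy hc
    simp only [codeW, List.cons.injEq] at hc
    have hd : β * (y - x) ≤ betaT γ y - betaT β x := by
      unfold betaT; rw [hc.1]; nlinarith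
    have hxy' : betaT β x ≤ betaT γ y := by
      have : 0 ≤ β * (y - x) := mul_nonneg (by linarith) (by linarith)
      linarith
    have := ih _ _ (betaT_nonneg _ _) hxy' hc.2
    simp only [Function.iterate_succ_apply]
    refine le_trans ?_ this
    rw [pow_succ, mul_assoc]
    gcongr

lemma code_sep_one {β γ : ℝ} (h1 : 1 < β) (h : β ≤ γ) (n : ℕ)
    (hc : codeW β (n + 1) 1 = codeW γ (n + 1) 1) :
    β ^ n * (γ - β) ≤ (betaT γ)^[n + 1] 1 - (betaT β)^[n + 1] 1 := by
  simp only [codeW, List.cons.injEq] at hc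
  have hd : betaT γ 1 - betaT β 1 = γ - β := by
    unfold betaT; rw [hc.1]; ring
  have := code_sep h1 h n _ _ (betaT_nonneg _ _) (by linarith) hc.2
  simpa only [Function.iterate_succ_apply, hd] using this

lemma sep_bound {β₀ β γ x₀ : ℝ} (h0 : 1 < β₀) (hβ : β₀ < β) (h : β ≤ γ) (n l : ℕ)
    (hc : codeW β (n + 1) 1 = codeW γ (n + 1) 1)
    (h1 : |(betaT β)^[n + 1] 1 - x₀| < β ^ (-(l : ℤ)))
    (h2 : |(betaT γ)^[n + 1] 1 - x₀| < γ ^ (-(l : ℤ))) :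
    γ - β ≤ 2 * β₀ * (β₀ ^ (l + (n + 1)))⁻¹ := by
  have hs := code_sep_one (h0.trans hβ) h n hc
  have hp : 0 < β₀ := by linarith
  have e1 : β ^ (-(l : ℤ)) ≤ (β₀ ^ l)⁻¹ := by
    rw [zpow_neg, zpow_natCast]; gcongr
  have e2 : γ ^ (-(l : ℤ)) ≤ (β₀ ^ l)⁻¹ := by
    rw [zpow_neg, zpow_natCast]
    have : β₀ ≤ γ := by linarith
    gcongr
  have e3 : β₀ ^ n * (γ - β) ≤ β ^ n * (γ - β) :=
    mul_le_mul_of_nonneg_right (pow_le_pow_left₀ hp.le hβ.le n) (by linarith)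
  have e4 : β₀ ^ n * (γ - β) ≤ 2 * (β₀ ^ l)⁻¹ := by
    have a1 := (abs_lt.1 h1).1
    have a2 := (abs_lt.1 h2).2
    linarith
  have e5 : 2 * β₀ * (β₀ ^ (l + (n + 1)))⁻¹ = 2 * (β₀ ^ l)⁻¹ / β₀ ^ n := by
    field_simp; ring
  rw [e5, le_div_iff₀ (by positivity)]
  linarith

lemma dim_core (s : Set ℝ) (J : ℕ → List ℤ → Set ℝ) (F : ℕ → Finset (List ℤ))
    (r : NNReal) (A ρ C b : ℝ) (hA : 0 ≤ A) (hρ0 : 0 < ρ) (hρ1 : ρ < 1) (hC : 0 ≤ C) (hb : 0 < b)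
    (hq : b * ρ ^ (r : ℝ) < 1) (hF : ∀ n, ((F n).card : ℝ) ≤ C * b ^ n)
    (hJ : ∀ᶠ n in atTop, ∀ w, Metric.ediam (J n w) ≤ ENNReal.ofReal (A * ρ ^ n))
    (hs : ∀ β ∈ s, ∃ᶠ n in atTop, ∃ w ∈ F n, β ∈ J n w) : dimH s ≤ r := by
  obtain ⟨N₀, hN₀⟩ := eventually_atTop.1 hJ
  have hq0 : 0 ≤ b * ρ ^ (r : ℝ) := by positivity
  apply dimH_le_of_hausdorffMeasure_ne_top
  set q := b * ρ ^ (r : ℝ) with hqdef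
  set K : ℝ≥0∞ := ∑' m : ℕ, ENNReal.ofReal (C * A ^ (r : ℝ) * q ^ m) with hK
  have hKtop : K ≠ ∞ := by
    rw [hK, ← ENNReal.ofReal_tsum_of_nonneg]
    · exact ENNReal.ofReal_ne_top
    · intro n; positivity
    · exact (summable_geometric_of_lt_one hq0 hq).mul_left _
  have hmain := Measure.hausdorffMeasure_le_liminf_tsum (ι := fun N : ℕ => Σ m : ℕ, {w // w ∈ F (N + m)})
    (r : ℝ) s (l := atTop) (fun N => ENNReal.ofReal (A * ρ ^ N)) ?_
    (fun N i => J (N + i.1) i.2.1) ?_ ?_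
  · refine ne_top_of_le_ne_top hKtop (hmain.trans ?_)
    refine liminf_le_of_le (by isBoundedDefault) ?_
    intro c hc
    obtain ⟨N, h1, h2⟩ := (hc.and (eventually_ge_atTop N₀)).exists
    refine h1.trans ?_
    rw [ENNReal.tsum_sigma']
    refine ENNReal.tsum_le_tsum fun m => ?_
    rw [tsum_fintype]
    have hterm : ∀ i ∈ (Finset.univ : Finset {w // w ∈ F (N + m)}),
        Metric.ediam (J (N + m) i.1) ^ (r : ℝ) ≤ ENNReal.ofReal ((A * ρ ^ (N + m)) ^ (r : ℝ)) := by
      intro i _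
      rw [← ENNReal.ofReal_rpow_of_nonneg (by positivity) (NNReal.coe_nonneg r)]
      exact ENNReal.rpow_le_rpow (hN₀ _ (by omega) _) (NNReal.coe_nonneg r)
    refine (Finset.sum_le_card_nsmul _ _ _ hterm).trans ?_
    rw [Finset.card_univ, Fintype.card_coe, nsmul_eq_mul, ← ENNReal.ofReal_natCast,
      ← ENNReal.ofReal_mul (by positivity)]
    apply ENNReal.ofReal_le_ofReal
    calc _ ≤ C * b ^ (N + m) * (A * ρ ^ (N + m)) ^ (r : ℝ) := by
            gcongr; exact hF _
      _ = C * A ^ (r : ℝ) * q ^ (N + m) := by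
            rw [Real.mul_rpow hA (by positivity), hqdef, mul_pow, ← Real.rpow_natCast_mul hρ0.le,
              ← Real.rpow_mul_natCast hρ0.le, mul_comm (r : ℝ)]
            ring
      _ ≤ _ := by
            gcongr _ * ?_
            exact pow_le_pow_of_le_one hq0 hq.le (by omega)
  · have := (tendsto_pow_atTop_nhds_zero_of_lt_one hρ0.le hρ1).const_mul A
    rw [mul_zero] at this
    simpa using ENNReal.tendsto_ofReal this
  · filter_upwards [eventually_ge_atTop N₀] with N hN i
    refine (hN₀ _ (by omega) _).trans (ENNReal.ofReal_le_ofReal ?_)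
    gcongr _ * ?_
    exact pow_le_pow_of_le_one hρ0.le hρ1.le (by omega)
  · refine Eventually.of_forall fun N β hβ => ?_
    obtain ⟨n, ⟨w, hw, hβw⟩, hn⟩ := ((hs β hβ).and_eventually (eventually_ge_atTop N)).exists
    obtain ⟨m, rfl⟩ := Nat.exists_eq_add_of_le hn
    exact mem_iUnion.2 ⟨⟨m, w, hw⟩, hβw⟩

lemma exists_a (ℓ : ℕ → ℕ) (t : ℝ) (r : NNReal)
    (hr : (1 / (1 + liminf (fun n : ℕ => (ℓ n : ℝ≥0∞) / (n : ℝ≥0∞)) atTop)) *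
        ENNReal.ofReal t < r) :
    ∃ a : ℝ, 0 ≤ a ∧ t < r * (1 + a) ∧ ∀ᶠ n : ℕ in atTop, a * n ≤ ℓ n := by
  set α := liminf (fun n : ℕ => (ℓ n : ℝ≥0∞) / (n : ℝ≥0∞)) atTop with hα
  have hr0 : 0 < r := by
    have := (zero_le (a := _)).trans_lt hr
    exact_mod_cast this
  have hr0' : (0 : ℝ) < r := hr0
  rcases lt_or_ge t r with h | h
  · exact ⟨0, le_rfl, by simpa using h, Eventually.of_forall fun n => by simp⟩
  have ht : 0 ≤ t := hr0'.le.trans h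
  have hu0 : 0 ≤ t / r - 1 := by
    rw [sub_nonneg, one_le_div hr0']; exact h
  have key : ENNReal.ofReal (t / r - 1) < α := by
    by_contra hcon
    push Not at hcon
    have h1 : 1 + α ≤ ENNReal.ofReal (t / r) := by
      calc 1 + α ≤ ENNReal.ofReal 1 + ENNReal.ofReal (t / r - 1) := by
            rw [ENNReal.ofReal_one]; gcongr
        _ = _ := by rw [← ENNReal.ofReal_add zero_le_one hu0]; congr 1; ring
    have htr : 0 < t / r := by linarith
    have h2 : (ENNReal.ofReal (t / r))⁻¹ * ENNReal.ofReal t ≤ 1 / (1 + α) * ENNReal.ofReal t := by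
      rw [one_div]; gcongr
    have h3 : (ENNReal.ofReal (t / r))⁻¹ * ENNReal.ofReal t = r := by
      rw [← ENNReal.ofReal_inv_of_pos htr, ← ENNReal.ofReal_mul (by positivity)]
      have htpos : 0 < t := hr0'.trans_le h
      have : (t / r)⁻¹ * t = r := by field_simp
      rw [this, ENNReal.ofReal_coe_nnreal]
    exact absurd hr (not_lt.2 (h3 ▸ h2))
  obtain ⟨a, ha1, ha2⟩ := ENNReal.lt_iff_exists_nnreal_btwn.1 key
  refine ⟨a, a.2, ?_, ?_⟩
  · have : t / r - 1 < a := by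
      rw [← ENNReal.ofReal_coe_nnreal] at ha1
      exact (ENNReal.ofReal_lt_ofReal_iff_of_nonneg hu0).1 ha1
    have h4 : t / r < 1 + a := by linarith
    rw [div_lt_iff₀ hr0'] at h4
    linarith
  · filter_upwards [eventually_lt_of_lt_liminf ha2, eventually_gt_atTop 0] with n hn hn0
    rw [ENNReal.lt_div_iff_mul_lt (by left; exact_mod_cast hn0.ne') (by simp)] at hn
    have : a * (n : NNReal) < (ℓ n : NNReal) := by exact_mod_cast hn
    exact_mod_cast this.le

/-- Proposition 4.2. For `1 < β₀ < β₁`, the set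
`E(β₀,β₁) = {β ∈ (β₀,β₁] : |T_β^n 1 - x₀| < β^{-ℓ_n} i.o.}` has Hausdorff dimension
at most `(1/(1+α)) · (log β₁ / log β₀)`, where `α = liminf ℓ_n/n`. -/
theorem dimH_upper_bound (x₀ : ℝ) (hx₀ : x₀ ∈ Icc (0:ℝ) 1)
    (ℓ : ℕ → ℕ) (hℓpos : ∀ n, 0 < ℓ n) (hℓ : Tendsto ℓ atTop atTop)
    (β₀ β₁ : ℝ) (h0 : 1 < β₀) (h01 : β₀ < β₁) :
    dimH {β : ℝ | β ∈ Ioc β₀ β₁ ∧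
        ∃ᶠ n in atTop, |(betaT β)^[n] 1 - x₀| < β ^ (-(ℓ n : ℤ))} ≤
      (1 / (1 + liminf (fun n : ℕ => (ℓ n : ℝ≥0∞) / (n : ℝ≥0∞)) atTop)) *
        ENNReal.ofReal (Real.log β₁ / Real.log β₀) := by
  refine le_of_forall_gt_imp_ge_of_dense fun c hc => ?_
  obtain ⟨r, hr, hrc⟩ := ENNReal.lt_iff_exists_nnreal_btwn.1 hc
  refine le_trans ?_ hrc.le
  obtain ⟨a, ha0, hat, hae⟩ := exists_a ℓ _ r hr
  have hb1 : 1 < β₁ := h0.trans h01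
  have hb0 : 0 < β₀ := by linarith
  have hlog : 0 < Real.log β₀ := Real.log_pos h0
  choose F hFc hF using fun n => code_count hb1 n 1 zero_le_one le_rfl
  refine dim_core _ (fun n w => {β | β ∈ Ioc β₀ β₁ ∧ codeW β n 1 = w ∧
      |(betaT β)^[n] 1 - x₀| < β ^ (-(ℓ n : ℤ))}) F r (2 * β₀) (β₀ ^ (-(1 + a)))
      (β₁ / (β₁ - 1)) β₁ (by linarith) (by positivity)
      (Real.rpow_lt_one_of_one_lt_of_neg h0 (by linarith))
      (div_nonneg (by linarith) (by linarith)) (by linarith) ?_ ?_ ?_ ?_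
  · rw [div_lt_iff₀ hlog] at hat
    rw [← Real.rpow_mul hb0.le]
    have h1 : β₁ < β₀ ^ ((1 + a) * r) := by
      rw [Real.lt_rpow_iff_log_lt (by linarith) hb0]
      linarith
    rw [neg_mul, Real.rpow_neg hb0.le, ← div_eq_mul_inv, div_lt_one (by positivity)]
    exact h1
  · intro n
    refine (hFc n).trans ?_
    rw [mul_one]
    exact cntA_eq hb1 n
  · filter_upwards [hae, eventually_gt_atTop 0] with n hn hn0 w
    obtain ⟨m, rfl⟩ := Nat.exists_eq_succ_of_ne_zero hn0.ne'
    have hD : 2 * β₀ * (β₀ ^ (ℓ (m + 1) + (m + 1)))⁻¹ ≤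
        2 * β₀ * (β₀ ^ (-(1 + a))) ^ (m + 1) := by
      gcongr
      rw [← Real.rpow_mul_natCast hb0.le, ← Real.rpow_natCast, ← Real.rpow_neg hb0.le]
      apply Real.rpow_le_rpow_of_exponent_le h0.le
      push_cast at hn ⊢
      nlinarith
    refine Metric.ediam_le_of_forall_dist_le ?_
    rintro x ⟨hx, hxw, hxd⟩ y ⟨hy, hyw, hyd⟩
    refine le_trans ?_ hD
    rw [Real.dist_eq]
    rcases le_total x y with h | h
    · rw [abs_sub_comm, abs_of_nonneg (by linarith)]
      exact sep_bound h0 hx.1 h m _ (hxw.trans hyw.symm) hxd hyd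
    · rw [abs_of_nonneg (by linarith)]
      exact sep_bound h0 hy.1 h m _ (hyw.trans hxw.symm) hyd hxd
  · rintro β ⟨hβ, hfreq⟩
    refine hfreq.mono fun n hn => ?_
    exact ⟨_, hF n β 1 (h0.trans hβ.1) hβ.2 zero_le_one le_rfl, hβ, rfl, hn⟩
end
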